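/- arXiv:0901.2331 — 2 statements merged into one kernel-verified Lean document; each statement's English description precedes it below -/
import Mathlib

section
/- Let h be a 6×6 complex Hadamard matrix such that every pair of distinct rows of h is binary or ternary, and such that at least one pair is binary and at least one pair is ternary. Then: (1) there do not exist three distinct rows of h that are pairwise binary; (2) there do not exist four distinct rows of h that are pairwise ternary; (3) there exist three distinct rows of h that are pairwise ternary. -/
/-- The primitive cube root of unity `j = exp(2πi/3)`. -/
noncomputable def ω : ℂ := Complex.exp (2 * Real.pi * Complex.I / 3)

/-- The multiset of entrywise products `h i₁ k * conj (h i₂ k)` of two rows of `h`. -/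
def rowProd {m n : ℕ} (h : Matrix (Fin m) (Fin n) ℂ) (i₁ i₂ : Fin m) : Multiset ℂ :=
  Multiset.map (fun k => h i₁ k * (starRingEnd ℂ) (h i₂ k)) Finset.univ.val

/-- The pair of rows `(i₁, i₂)` is binary: the multiset of entrywise products is
`{x, -x, y, -y, z, -z}` for some unimodular `x, y, z`. -/
def BinaryPair {m n : ℕ} (h : Matrix (Fin m) (Fin n) ℂ) (i₁ i₂ : Fin m) : Prop :=
  ∃ x y z : ℂ, ‖x‖ = 1 ∧ ‖y‖ = 1 ∧ ‖z‖ = 1 ∧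
    rowProd h i₁ i₂ = {x, -x, y, -y, z, -z}

/-- The pair of rows `(i₁, i₂)` is ternary: the multiset of entrywise products is
`{x, jx, j²x, y, jy, j²y}` for some unimodular `x, y`. -/
def TernaryPair {m n : ℕ} (h : Matrix (Fin m) (Fin n) ℂ) (i₁ i₂ : Fin m) : Prop :=
  ∃ x y : ℂ, ‖x‖ = 1 ∧ ‖y‖ = 1 ∧
    rowProd h i₁ i₂ = {x, ω * x, ω ^ 2 * x, y, ω * y, ω ^ 2 * y}

/-- Hadamard equivalence: `k` is obtained from `h` by permuting rows and columns and
multiplying rows and columns by unimodular scalars. -/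
def MatEquiv {m n : ℕ} (h k : Matrix (Fin m) (Fin n) ℂ) : Prop :=
  ∃ (σ : Equiv.Perm (Fin m)) (τ : Equiv.Perm (Fin n)) (a : Fin m → ℂ) (b : Fin n → ℂ),
    (∀ i, ‖a i‖ = 1) ∧ (∀ j, ‖b j‖ = 1) ∧
    ∀ i j, k i j = a i * b j * h (σ i) (τ j)

/-- `h` is a complex Hadamard matrix: unimodular entries and pairwise orthogonal rows. -/
def IsCHM {n : ℕ} (h : Matrix (Fin n) (Fin n) ℂ) : Prop :=
  (∀ i j, ‖h i j‖ = 1) ∧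
  ∀ i₁ i₂, i₁ ≠ i₂ → ∑ k, h i₁ k * (starRingEnd ℂ) (h i₂ k) = 0


/-- Unimodular functions on the six columns. -/
def Uni (f : Fin 6 → ℂ) : Prop := ∀ k, ‖f k‖ = 1

/-- Binary functions: a fixed point free involution of the columns changes the sign. -/
def BinF (f : Fin 6 → ℂ) : Prop :=
  ∃ σ : Fin 6 → Fin 6, (∀ k, σ (σ k) = k) ∧ (∀ k, σ k ≠ k) ∧ ∀ k, f (σ k) = - f k

/-- Ternary functions: the columns split into two triples of zero sum. -/
def TerF (f : Fin 6 → ℂ) : Prop :=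
  ∃ S : Finset (Fin 6), S.card = 3 ∧ ∑ k ∈ S, f k = 0 ∧ ∑ k ∈ Sᶜ, f k = 0

theorem Uni.ne {f : Fin 6 → ℂ} (hf : Uni f) (k : Fin 6) : f k ≠ 0 := by
  intro h0
  have := hf k
  simp [h0] at this

theorem Uni.div {f g : Fin 6 → ℂ} (hf : Uni f) (hg : Uni g) : Uni (fun k => f k / g k) := by
  intro k; simp [hf k, hg k]

theorem Uni.pow {f : Fin 6 → ℂ} (hf : Uni f) (n : ℕ) : Uni (fun k => f k ^ n) := by
  intro k; simp [hf k]

theorem two_ne_aux {x : ℂ} (hx : x ≠ 0) : x ≠ -x := by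
  intro h0
  apply hx
  linear_combination (1 / 2) * h0

/-- Three unimodular numbers of zero sum. -/
theorem three_aux {x y z : ℂ} (hx : ‖x‖ = 1) (hy : ‖y‖ = 1) (hz : ‖z‖ = 1) (h : x + y + z = 0) :
    x ^ 3 = x * y * z ∧ y ^ 3 = x * y * z ∧ z ^ 3 = x * y * z ∧ x * y + y * z + z * x = 0 ∧
      x ≠ y ∧ y ≠ z ∧ x ≠ z := by
  have hx0 : x ≠ 0 := by rintro rfl; simp at hx
  have hy0 : y ≠ 0 := by rintro rfl; simp at hy
  have hz0 : z ≠ 0 := by rintro rfl; simp at hz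
  have hc : x⁻¹ + y⁻¹ + z⁻¹ = 0 := by
    rw [Complex.inv_eq_conj hx, Complex.inv_eq_conj hy, Complex.inv_eq_conj hz, ← map_add,
      ← map_add, h, map_zero]
  have he : x * y + y * z + z * x = 0 := by
    field_simp at hc
    linear_combination hc
  have key : ∀ a b c : ℂ, a ≠ 0 → a + b + c = 0 → a * b + b * c + c * a = 0 → a ≠ b := by
    rintro a b c ha h1 h2 rfl
    have : a ^ 2 = 0 := by
      linear_combination (-1 / 3) * h2 + (2 / 3) * a * h1
    exact ha (by simpa using this)
  refine ⟨?_, ?_, ?_, he, key x y z hx0 h he, key y z x hy0 (by linear_combination h)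
    (by linear_combination he), ?_⟩
  · linear_combination x ^ 2 * h - x * he
  · linear_combination y ^ 2 * h - y * he
  · linear_combination z ^ 2 * h - z * he
  · exact (key z x y hz0 (by linear_combination h) (by linear_combination he)).symm

theorem three_sum {f : Fin 6 → ℂ} (hf : Uni f) {S : Finset (Fin 6)} (hS : S.card = 3)
    (h : ∑ k ∈ S, f k = 0) :
    (∀ k ∈ S, f k ^ 3 = ∏ m ∈ S, f m) ∧ (∀ k ∈ S, ∀ l ∈ S, f k = f l → k = l) := by
  obtain ⟨p, q, r, hpq, hpr, hqr, rfl⟩ := Finset.card_eq_three.1 hS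
  have hs : f p + f q + f r = 0 := by
    rw [Finset.sum_insert (by simp [hpq, hpr]), Finset.sum_pair hqr] at h
    linear_combination h
  obtain ⟨h1, h2, h3, -, h4, h5, h6⟩ := three_aux (hf p) (hf q) (hf r) hs
  rw [Finset.prod_insert (by simp [hpq, hpr]), Finset.prod_pair hqr]
  constructor
  · intro k hk
    simp only [Finset.mem_insert, Finset.mem_singleton] at hk
    rcases hk with rfl | rfl | rfl
    · rw [h1]; ring
    · rw [h2]; ring
    · rw [h3]; ring
  · intro k hk l hl hkl
    simp only [Finset.mem_insert, Finset.mem_singleton] at hk hl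
    rcases hk with rfl | rfl | rfl <;> rcases hl with rfl | rfl | rfl <;>
      first | rfl | exact absurd hkl (by assumption) | exact absurd hkl.symm (by assumption)

theorem card_compl3 {S : Finset (Fin 6)} (hS : S.card = 3) : Sᶜ.card = 3 := by
  rw [Finset.card_compl, hS]; rfl

theorem BinF.pow {f : Fin 6 → ℂ} (hf : BinF f) (n : ℕ) (hn : Odd n) :
    BinF (fun k => f k ^ n) := by
  obtain ⟨σ, h1, h2, h3⟩ := hf
  exact ⟨σ, h1, h2, fun k => by simp only [h3, hn.neg_pow]⟩

theorem BinF.inv {f g : Fin 6 → ℂ} (hf : BinF (fun k => f k / g k)) :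
    BinF (fun k => g k / f k) := by
  obtain ⟨σ, h1, h2, h3⟩ := hf
  refine ⟨σ, h1, h2, fun k => ?_⟩
  have := congrArg (·⁻¹) (h3 k)
  simp only [inv_div, inv_neg] at this
  exact this

theorem TerF.inv {f g : Fin 6 → ℂ} (hfu : Uni f) (hgu : Uni g) (hf : TerF (fun k => f k / g k)) :
    TerF (fun k => g k / f k) := by
  obtain ⟨S, h1, h2, h3⟩ := hf
  have key : ∀ k, g k / f k = (starRingEnd ℂ) (f k / g k) := fun k => by
    rw [← Complex.inv_eq_conj ((hfu.div hgu) k), inv_div]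
  refine ⟨S, h1, ?_, ?_⟩
  · simp only [key]; rw [← map_sum, h2, map_zero]
  · simp only [key]; rw [← map_sum, h3, map_zero]

theorem BinF.sat {f : Fin 6 → ℂ} (hf : BinF f) (L : Finset (Fin 6))
    (hL : ∀ k l, f k ^ 6 = f l ^ 6 → k ∈ L → l ∈ L) : Even L.card ∧ ∑ k ∈ L, f k = 0 := by
  obtain ⟨σ, h1, h2, h3⟩ := hf
  have hm : ∀ k ∈ L, σ k ∈ L := fun k hk => hL k _ (by rw [h3]; ring) hk
  constructor
  · have : ∑ k ∈ L, (1 : ZMod 2) = 0 := by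
      refine Finset.sum_involution (fun k _ => σ k) ?_ ?_ ?_ ?_
      · intros; decide
      · intro k _ _; exact h2 k
      · intro k hk; exact hm k hk
      · intro k _; exact h1 k
    rw [Finset.sum_const, nsmul_one] at this
    exact (ZMod.natCast_eq_zero_iff_even).1 this
  · refine Finset.sum_involution (fun k _ => σ k) ?_ ?_ ?_ ?_
    · intro k _; rw [h3]; ring
    · intro k _ _; exact h2 k
    · intro k hk; exact hm k hk
    · intro k _; exact h1 k

theorem BinF.sum {f : Fin 6 → ℂ} (hf : BinF f) : ∑ k, f k = 0 :=
  (hf.sat Finset.univ (by simp)).2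

theorem BinF.not_const {f : Fin 6 → ℂ} (hf : BinF f) (hu : Uni f) (c : ℂ) (h : ∀ k, f k = c) :
    False := by
  obtain ⟨σ, h1, h2, h3⟩ := hf
  have := h3 0
  rw [h, h] at this
  exact two_ne_aux (by rw [← h 0]; exact hu.ne 0) this

theorem BinF.two {f : Fin 6 → ℂ} (hf : BinF f) (hu : Uni f) {S : Finset (Fin 6)} (hS : S.card = 3)
    {x y : ℂ} (h1 : ∀ k ∈ S, f k = x) (h2 : ∀ k ∉ S, f k = y) : y = -x := by
  obtain ⟨σ, _, _, h3⟩ := hf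
  obtain ⟨k, hk⟩ : S.Nonempty := by rw [← Finset.card_pos]; omega
  have hx : x ≠ 0 := by rw [← h1 k hk]; exact hu.ne k
  have := h3 k
  rw [h1 k hk] at this
  by_cases hs : σ k ∈ S
  · rw [h1 _ hs] at this
    exact absurd this (two_ne_aux hx)
  · rw [h2 _ hs] at this; exact this

/-- the level set of a binary function with two opposite values has three elements -/
theorem BinF.level {f : Fin 6 → ℂ} (hf : BinF f) (hu : Uni f) (c : ℂ) (h : ∀ k, f k ^ 2 = c) :
    ∃ P : Finset (Fin 6), P.card = 3 ∧ (∀ k ∈ P, f k = f 0) ∧ (∀ k ∉ P, f k = - f 0) := by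
  classical
  have h0 : ∀ k, f k = f 0 ∨ f k = - f 0 := fun k => by
    rw [← sq_eq_sq_iff_eq_or_eq_neg, h, h]
  obtain ⟨σ, h1, h2, h3⟩ := hf
  refine ⟨Finset.univ.filter (fun k => f k = f 0), ?_, ?_, ?_⟩
  · have e : (Finset.univ.filter (fun k => f k = f 0)).card
        = (Finset.univ.filter (fun k => ¬ f k = f 0)).card := by
      refine Finset.card_bij' (fun k _ => σ k) (fun k _ => σ k) ?_ ?_ ?_ ?_
      · intro k hk
        simp only [Finset.mem_filter, Finset.mem_univ, true_and] at hk ⊢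
        rw [h3, hk]
        exact (two_ne_aux (hu.ne 0)).symm
      · intro k hk
        simp only [Finset.mem_filter, Finset.mem_univ, true_and] at hk ⊢
        rw [h3, (h0 k).resolve_left hk, neg_neg]
      · intro k _; exact h1 k
      · intro k _; exact h1 k
    have := Finset.card_filter_add_card_filter_not (s := (Finset.univ : Finset (Fin 6)))
      (fun k => f k = f 0)
    rw [← e, Finset.card_univ, Fintype.card_fin] at this
    omega
  · intro k hk; simpa using hk
  · intro k hk
    exact (h0 k).resolve_left (by simpa using hk)

/-- values of a ternary function -/
theorem TerF.spec {f : Fin 6 → ℂ} (hf : TerF f) (hu : Uni f) :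
    ∃ (S : Finset (Fin 6)) (x y : ℂ), S.card = 3 ∧ ∑ k ∈ S, f k = 0 ∧ ∑ k ∈ Sᶜ, f k = 0 ∧
      (∀ k ∈ S, f k ^ 3 = x) ∧ (∀ k ∉ S, f k ^ 3 = y) ∧
      (∀ k ∈ S, ∀ l ∈ S, f k = f l → k = l) ∧ (∀ k ∉ S, ∀ l ∉ S, f k = f l → k = l) ∧
      ∏ k ∈ S, f k = x ∧ ∏ k ∈ Sᶜ, f k = y := by
  obtain ⟨S, hS, h1, h2⟩ := hf
  obtain ⟨a1, a2⟩ := three_sum hu hS h1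
  obtain ⟨b1, b2⟩ := three_sum hu (card_compl3 hS) h2
  simp only [Finset.mem_compl] at b1 b2
  exact ⟨S, _, _, hS, h1, h2, a1, b1, a2, b2, rfl, rfl⟩

/-- A ternary function has no three equal values. -/
theorem TerF.no_three {f : Fin 6 → ℂ} (hf : TerF f) (hu : Uni f) {k l m : Fin 6} (hkl : k ≠ l)
    (hkm : k ≠ m) (hlm : l ≠ m) (h1 : f k = f l) (h2 : f k = f m) : False := by
  obtain ⟨S, x, y, -, -, -, -, -, hi, hj, -⟩ := hf.spec hu
  have h3 : f l = f m := h1.symm.trans h2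
  by_cases a : k ∈ S <;> by_cases b : l ∈ S <;> by_cases c : m ∈ S
  · exact hkl (hi k a l b h1)
  · exact hkl (hi k a l b h1)
  · exact hkm (hi k a m c h2)
  · exact hlm (hj l b m c h3)
  · exact hlm (hi l b m c h3)
  · exact hkm (hj k a m c h2)
  · exact hkl (hj k a l b h1)
  · exact hkl (hj k a l b h1)

/-- If the cubes are not constant, any triple with constant cubes has zero sum. -/
theorem TerF.nonconst_sum {f : Fin 6 → ℂ} (hf : TerF f) (hu : Uni f) {k₀ l₀ : Fin 6}
    (hne : f k₀ ^ 3 ≠ f l₀ ^ 3) {P : Finset (Fin 6)} (hP : P.card = 3)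
    (hc : ∀ k ∈ P, ∀ l ∈ P, f k ^ 3 = f l ^ 3) : ∑ k ∈ P, f k = 0 := by
  obtain ⟨S, x, y, hS, hs1, hs2, hx, hy, -⟩ := hf.spec hu
  have hxy : x ≠ y := by
    rintro rfl
    apply hne
    have : ∀ k, f k ^ 3 = x := fun k => by
      by_cases h : k ∈ S
      · exact hx k h
      · exact hy k h
    rw [this, this]
  obtain ⟨p, hp⟩ : P.Nonempty := by rw [← Finset.card_pos]; omega
  by_cases h : p ∈ S
  · have : P ⊆ S := fun k hk => by
      by_contra hkS
      exact hxy (by rw [← hx p h, ← hy k hkS, hc p hp k hk])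
    rw [Finset.eq_of_subset_of_card_le this (by omega)]; exact hs1
  · have : P ⊆ Sᶜ := fun k hk => by
      rw [Finset.mem_compl]
      intro hkS
      exact hxy (by rw [← hx k hkS, ← hy p h, hc p hp k hk])
    rw [Finset.eq_of_subset_of_card_le this (by rw [card_compl3 hS]; omega)]; exact hs2

/-- Sums over saturated sets. -/
theorem TerF.sat {f : Fin 6 → ℂ} (hf : TerF f) (hu : Uni f) (L : Finset (Fin 6))
    (hL : ∀ k l, f k ^ 6 = f l ^ 6 → k ∈ L → l ∈ L) : ∑ k ∈ L, f k = 0 := by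
  obtain ⟨S, x, y, hS, hs1, hs2, hx, hy, -⟩ := hf.spec hu
  have hx' : ∀ k ∈ S, f k ^ 6 = x ^ 2 := fun k hk => by rw [← hx k hk]; ring
  have hy' : ∀ k ∉ S, f k ^ 6 = y ^ 2 := fun k hk => by rw [← hy k hk]; ring
  have e1 : ∑ k ∈ L ∩ S, f k = 0 := by
    rcases (L ∩ S).eq_empty_or_nonempty with h | ⟨p, hp⟩
    · rw [h, Finset.sum_empty]
    · rw [Finset.mem_inter] at hp
      have : L ∩ S = S := Finset.inter_eq_right.2 fun k hk =>
        hL p k (by rw [hx' p hp.2, hx' k hk]) hp.1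
      rw [this, hs1]
  have e2 : ∑ k ∈ L ∩ Sᶜ, f k = 0 := by
    rcases (L ∩ Sᶜ).eq_empty_or_nonempty with h | ⟨p, hp⟩
    · rw [h, Finset.sum_empty]
    · rw [Finset.mem_inter, Finset.mem_compl] at hp
      have : L ∩ Sᶜ = Sᶜ := Finset.inter_eq_right.2 fun k hk =>
        hL p k (by rw [hy' p hp.2, hy' k (Finset.mem_compl.1 hk)]) hp.1
      rw [this, hs2]
  rw [← Finset.sum_inter_add_sum_sdiff L S, e1, Finset.sdiff_eq_inter_compl, e2, add_zero]

theorem exists_pair {f : Fin 6 → ℂ} (hf : BinF f) {k₀ l₀ : Fin 6} (hne : f k₀ ^ 6 ≠ f l₀ ^ 6) :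
    ∃ L : Finset (Fin 6), L.card = 2 ∧ (∀ k l, f k ^ 6 = f l ^ 6 → k ∈ L → l ∈ L) ∧
      (∀ k l, f k ^ 6 = f l ^ 6 → k ∈ Lᶜ → l ∈ Lᶜ) := by
  classical
  set L := Finset.univ.filter (fun k => f k ^ 6 = f k₀ ^ 6) with hLdef
  have s1 : ∀ k l, f k ^ 6 = f l ^ 6 → k ∈ L → l ∈ L := by
    intro k l h hk
    simp only [hLdef, Finset.mem_filter, Finset.mem_univ, true_and] at hk ⊢
    rw [← h, hk]
  have s2 : ∀ k l, f k ^ 6 = f l ^ 6 → k ∈ Lᶜ → l ∈ Lᶜ := by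
    intro k l h hk
    rw [Finset.mem_compl] at hk ⊢
    exact fun hl => hk (s1 l k h.symm hl)
  have c1 : 0 < L.card := Finset.card_pos.2 ⟨k₀, by simp [hLdef]⟩
  have c2 : 0 < Lᶜ.card := Finset.card_pos.2 ⟨l₀, by simp [hLdef, hne.symm]⟩
  have c3 : L.card + Lᶜ.card = 6 := by rw [Finset.card_add_card_compl]; rfl
  obtain ⟨n, hn⟩ := (hf.sat L s1).1
  by_cases h : L.card = 2
  · exact ⟨L, h, s1, s2⟩
  · exact ⟨Lᶜ, by omega, s2, by rw [compl_compl]; exact s1⟩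

theorem peel {f : Fin 6 → ℂ} {s : Finset (Fin 6)} {a : ℂ} {m : Multiset ℂ}
    (h : Multiset.map f s.val = a ::ₘ m) :
    ∃ k ∈ s, f k = a ∧ Multiset.map f (s.erase k).val = m := by
  obtain ⟨k, hk, h1, h2⟩ := (Multiset.map_eq_cons f s.val m a).2 h
  exact ⟨k, hk, h1, by rw [Finset.erase_val]; exact h2⟩

theorem exists_perm {f : Fin 6 → ℂ} {a b c d e g : ℂ}
    (h : Multiset.map f Finset.univ.val = {a, b, c, d, e, g}) :
    ∃ τ : Equiv.Perm (Fin 6), f (τ 0) = a ∧ f (τ 1) = b ∧ f (τ 2) = c ∧ f (τ 3) = d ∧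
      f (τ 4) = e ∧ f (τ 5) = g := by
  obtain ⟨p0, m0, e0, h⟩ := peel h
  obtain ⟨p1, m1, e1, h⟩ := peel h
  obtain ⟨p2, m2, e2, h⟩ := peel h
  obtain ⟨p3, m3, e3, h⟩ := peel h
  obtain ⟨p4, m4, e4, h⟩ := peel h
  obtain ⟨p5, m5, e5, h⟩ := peel (m := 0) h
  simp only [Finset.mem_erase, Finset.mem_univ, and_true] at m1 m2 m3 m4 m5
  have hinj : Function.Injective ![p0, p1, p2, p3, p4, p5] := by
    intro i j hij
    fin_cases i <;> fin_cases j <;> simp_all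
  refine ⟨Equiv.ofBijective _ (Finite.injective_iff_bijective.1 hinj), ?_⟩
  simp only [Equiv.ofBijective_apply]
  exact ⟨e0, e1, e2, e3, e4, e5⟩

theorem ratio_eq {x y : ℂ} (hy : ‖y‖ = 1) : x * (starRingEnd ℂ) y = x / y := by
  rw [← Complex.inv_eq_conj hy, div_eq_mul_inv]

theorem omega_sum : 1 + ω + ω ^ 2 = 0 := by
  have h := (Complex.isPrimitiveRoot_exp 3 (by norm_num)).geom_sum_eq_zero (by norm_num)
  simp only [Finset.sum_range_succ, Finset.sum_range_zero] at h
  have e : ω = Complex.exp (2 * Real.pi * Complex.I / (3 : ℕ)) := by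
    unfold ω; norm_num
  rw [e]
  linear_combination h

theorem binF_of {h : Matrix (Fin 6) (Fin 6) ℂ} (hu : ∀ i j, ‖h i j‖ = 1) {i j : Fin 6}
    (hb : BinaryPair h i j) : BinF (fun k => h i k / h j k) := by
  obtain ⟨x, y, z, -, -, -, he⟩ := hb
  obtain ⟨τ, h0, h1, h2, h3, h4, h5⟩ := exists_perm he
  simp only [ratio_eq (hu j _)] at h0 h1 h2 h3 h4 h5
  let s : Fin 6 → Fin 6 := ![1, 0, 3, 2, 5, 4]
  have s1 : ∀ k, s (s k) = k := by decide
  have s2 : ∀ k, s k ≠ k := by decide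
  refine ⟨fun k => τ (s (τ.symm k)), ?_, ?_, ?_⟩
  · intro k; simp [s1]
  · intro k hk
    exact s2 (τ.symm k) (τ.injective (by simpa using hk))
  · intro k
    obtain ⟨m, rfl⟩ := τ.surjective k
    simp only [Equiv.symm_apply_apply]
    fin_cases m <;> simp_all [s]

theorem terF_of {h : Matrix (Fin 6) (Fin 6) ℂ} (hu : ∀ i j, ‖h i j‖ = 1) {i j : Fin 6}
    (hb : TernaryPair h i j) : TerF (fun k => h i k / h j k) := by
  obtain ⟨x, y, -, -, he⟩ := hb
  obtain ⟨τ, h0, h1, h2, h3, h4, h5⟩ := exists_perm he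
  simp only [ratio_eq (hu j _)] at h0 h1 h2 h3 h4 h5
  have hw := omega_sum
  have hS : ∑ k ∈ ({0, 1, 2} : Finset (Fin 6)).map τ.toEmbedding, h i k / h j k = 0 := by
    rw [Finset.sum_map]
    rw [Finset.sum_insert (by decide), Finset.sum_pair (by decide)]
    simp only [Equiv.toEmbedding_apply, h0, h1, h2]
    linear_combination x * hw
  refine ⟨({0, 1, 2} : Finset (Fin 6)).map τ.toEmbedding, by rw [Finset.card_map]; rfl, hS, ?_⟩
  have ht : ∑ k, h i k / h j k = 0 := by
    rw [← Equiv.sum_comp τ, Fin.sum_univ_six, h0, h1, h2, h3, h4, h5]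
    linear_combination (x + y) * hw
  rw [← Finset.sum_add_sum_compl (({0, 1, 2} : Finset (Fin 6)).map τ.toEmbedding), hS,
    zero_add] at ht
  exact ht

/-- In a binary triple the sixth powers of a ratio are not constant. -/
theorem lemmaR {a b c : Fin 6 → ℂ} (ha : Uni a) (hb : Uni b) (hc : Uni c)
    (hab : BinF (fun k => a k / b k)) (hac : BinF (fun k => a k / c k))
    (hbc : BinF (fun k => b k / c k)) : ∃ k l, (a k / b k) ^ 6 ≠ (a l / b l) ^ 6 := by
  by_contra! hcon
  have odd3 : Odd 3 := by decide
  obtain ⟨P, hP, hP1, hP2⟩ := (hab.pow 3 odd3).level ((ha.div hb).pow 3) ((a 0 / b 0) ^ 6)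
    (fun k => by rw [← hcon k 0]; ring)
  set ρ := (a 0 / b 0) ^ 3 with hρ
  have hρ0 : ρ ≠ 0 := pow_ne_zero _ ((ha.div hb).ne 0)
  have s1 := (hbc.pow 3 odd3).sum
  have s2 := (hac.pow 3 odd3).sum
  have e : ∀ k, (a k / c k) ^ 3 = (a k / b k) ^ 3 * (b k / c k) ^ 3 := fun k => by
    have := ha.ne k; have := hb.ne k; have := hc.ne k
    field_simp
  simp only [e] at s2
  rw [← Finset.sum_add_sum_compl P] at s1 s2
  have t1 : ∑ k ∈ P, (a k / b k) ^ 3 * (b k / c k) ^ 3 = ρ * ∑ k ∈ P, (b k / c k) ^ 3 := by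
    rw [Finset.mul_sum]
    exact Finset.sum_congr rfl fun k hk => by rw [hP1 k hk]
  have t2 : ∑ k ∈ Pᶜ, (a k / b k) ^ 3 * (b k / c k) ^ 3 = -ρ * ∑ k ∈ Pᶜ, (b k / c k) ^ 3 := by
    rw [Finset.mul_sum]
    exact Finset.sum_congr rfl fun k hk => by rw [hP2 k (Finset.mem_compl.1 hk)]
  rw [t1, t2] at s2
  have u1 : ∑ k ∈ P, (b k / c k) ^ 3 = 0 := by
    have : ρ * (∑ k ∈ P, (b k / c k) ^ 3) = 0 := by linear_combination (1 / 2) * s2 + ρ / 2 * s1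
    exact (mul_eq_zero.1 this).resolve_left hρ0
  have u2 : ∑ k ∈ Pᶜ, (b k / c k) ^ 3 = 0 := by rw [u1, zero_add] at s1; exact s1
  obtain ⟨v1, -⟩ := three_sum ((hb.div hc).pow 3) hP u1
  obtain ⟨v2, -⟩ := three_sum ((hb.div hc).pow 3) (card_compl3 hP) u2
  simp only [Finset.mem_compl] at v1 v2
  have w := ((hbc.pow 3 odd3).pow 3 odd3).two (((hb.div hc).pow 3).pow 3) hP v1 v2
  refine ((hac.pow 3 odd3).pow 3 odd3).not_const (((ha.div hc).pow 3).pow 3)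
    (ρ ^ 3 * ∏ m ∈ P, (b m / c m) ^ 3) fun k => ?_
  simp only [e]
  rw [mul_pow]
  by_cases hk : k ∈ P
  · rw [hP1 k hk, v1 k hk]
  · rw [hP2 k hk, v2 k hk, w]; ring

/-- counting for products of two two-valued functions -/
theorem sum_two_two {S T : Finset (Fin 6)} (hS : S.card = 3) (hT : T.card = 3)
    {F G : Fin 6 → ℂ} {x y s t : ℂ} (h1 : ∀ k ∈ S, F k = x) (h2 : ∀ k ∉ S, F k = y)
    (h3 : ∀ k ∈ T, G k = s) (h4 : ∀ k ∉ T, G k = t) :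
    ∑ k, F k * G k = (S ∩ T).card * (x * s + y * t) + (3 - (S ∩ T).card) * (x * t + y * s) := by
  have c1 : (S ∩ T).card + (S \ T).card = 3 := by rw [Finset.card_inter_add_card_sdiff, hS]
  have c2 : (S ∩ T).card + (T \ S).card = 3 := by
    rw [Finset.inter_comm, Finset.card_inter_add_card_sdiff, hT]
  have c3 : (T \ S).card + (Sᶜ \ T).card = 3 := by
    have := Finset.card_inter_add_card_sdiff Sᶜ T
    rw [card_compl3 hS, Finset.inter_comm, ← Finset.sdiff_eq_inter_compl] at this
    exact this
  have d1 : ((S \ T).card : ℂ) = 3 - (S ∩ T).card := by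
    have : (((S ∩ T).card + (S \ T).card : ℕ) : ℂ) = 3 := by rw [c1]; norm_num
    push_cast at this; linear_combination this
  have d2 : ((T \ S).card : ℂ) = 3 - (S ∩ T).card := by
    have : (((S ∩ T).card + (T \ S).card : ℕ) : ℂ) = 3 := by rw [c2]; norm_num
    push_cast at this; linear_combination this
  have d3 : ((Sᶜ \ T).card : ℂ) = (S ∩ T).card := by
    have : (((T \ S).card + (Sᶜ \ T).card : ℕ) : ℂ) = 3 := by rw [c3]; norm_num
    push_cast at this; linear_combination this - d2
  have e1 : ∑ k ∈ S, F k * G k = ∑ k ∈ S ∩ T, x * s + ∑ k ∈ S \ T, x * t := by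
    rw [← Finset.sum_inter_add_sum_sdiff S T]
    congr 1
    · refine Finset.sum_congr rfl fun k hk => ?_
      rw [Finset.mem_inter] at hk
      rw [h1 k hk.1, h3 k hk.2]
    · refine Finset.sum_congr rfl fun k hk => ?_
      rw [Finset.mem_sdiff] at hk
      rw [h1 k hk.1, h4 k hk.2]
  have e2 : ∑ k ∈ Sᶜ, F k * G k = ∑ k ∈ T \ S, y * s + ∑ k ∈ Sᶜ \ T, y * t := by
    rw [← Finset.sum_inter_add_sum_sdiff Sᶜ T, Finset.inter_comm, ← Finset.sdiff_eq_inter_compl]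
    congr 1
    · refine Finset.sum_congr rfl fun k hk => ?_
      rw [Finset.mem_sdiff] at hk
      rw [h2 k hk.2, h3 k hk.1]
    · refine Finset.sum_congr rfl fun k hk => ?_
      rw [Finset.mem_sdiff, Finset.mem_compl] at hk
      rw [h2 k hk.1, h4 k hk.2]
  rw [← Finset.sum_add_sum_compl S, e1, e2]
  simp only [Finset.sum_const, nsmul_eq_mul]
  rw [d1, d2, d3]
  ring

/-- A row that is ternary with two rows of a binary triple does not exist. -/
theorem lemma1a {a b c d : Fin 6 → ℂ} (ha : Uni a) (hb : Uni b) (hc : Uni c) (hd : Uni d)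
    (hab : BinF (fun k => a k / b k)) (hac : BinF (fun k => a k / c k))
    (hbc : BinF (fun k => b k / c k)) (had : TerF (fun k => a k / d k))
    (hbd : TerF (fun k => b k / d k)) : False := by
  obtain ⟨k₀, l₀, hne⟩ := lemmaR ha hb hc hab hac hbc
  have odd3 : Odd 3 := by decide
  have odd9 : Odd 9 := by decide
  obtain ⟨S, x, y, hS, -, -, h1, h2, -⟩ := had.spec (ha.div hd)
  obtain ⟨T, s, t, hT, -, -, h3, h4, -⟩ := (hbd.inv hb hd).spec (hd.div hb)
  have e : ∀ k, (a k / b k) ^ 3 = (a k / d k) ^ 3 * (d k / b k) ^ 3 := fun k => by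
    have := ha.ne k; have := hb.ne k; have := hd.ne k
    field_simp
  have e9 : ∀ k, (a k / b k) ^ 9 = ((a k / d k) ^ 3) ^ 3 * ((d k / b k) ^ 3) ^ 3 := fun k => by
    rw [← mul_pow, ← e]; ring
  have s1 := (hab.pow 3 odd3).sum
  have s2 := (hab.pow 9 odd9).sum
  simp only [e] at s1
  simp only [e9] at s2
  rw [sum_two_two hS hT h1 h2 h3 h4] at s1
  rw [sum_two_two (x := x ^ 3) (y := y ^ 3) (s := s ^ 3) (t := t ^ 3) hS hT
    (fun k hk => by rw [h1 k hk]) (fun k hk => by rw [h2 k hk])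
    (fun k hk => by rw [h3 k hk]) (fun k hk => by rw [h4 k hk])] at s2
  have hn : (S ∩ T).card ≤ 3 := hS ▸ Finset.card_le_card Finset.inter_subset_left
  have e6 : ∀ k, (a k / b k) ^ 6 = ((a k / d k) ^ 3 * (d k / b k) ^ 3) ^ 2 := fun k => by
    rw [← e]; ring
  apply hne
  rw [e6, e6]
  have val : ∀ k, ((k ∈ S ∧ k ∈ T) ∧ (a k / d k) ^ 3 * (d k / b k) ^ 3 = x * s) ∨
      ((k ∈ S ∧ k ∉ T) ∧ (a k / d k) ^ 3 * (d k / b k) ^ 3 = x * t) ∨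
      ((k ∉ S ∧ k ∈ T) ∧ (a k / d k) ^ 3 * (d k / b k) ^ 3 = y * s) ∨
      ((k ∉ S ∧ k ∉ T) ∧ (a k / d k) ^ 3 * (d k / b k) ^ 3 = y * t) := by
    intro k
    by_cases hk : k ∈ S <;> by_cases hl : k ∈ T
    · left; exact ⟨⟨hk, hl⟩, by rw [h1 k hk, h3 k hl]⟩
    · right; left; exact ⟨⟨hk, hl⟩, by rw [h1 k hk, h4 k hl]⟩
    · right; right; left; exact ⟨⟨hk, hl⟩, by rw [h2 k hk, h3 k hl]⟩
    · right; right; right; exact ⟨⟨hk, hl⟩, by rw [h2 k hk, h4 k hl]⟩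
  have four : x * s + y * t = 0 → x * t + y * s = 0 → ∀ k,
      ((a k / d k) ^ 3 * (d k / b k) ^ 3) ^ 2 = (x * s) ^ 2 := by
    intro p q k
    have hq : (x * t) ^ 2 = (x * s) ^ 2 := by
      linear_combination (x * t) * q - (x * s) * p
    rcases val k with ⟨-, h⟩ | ⟨-, h⟩ | ⟨-, h⟩ | ⟨-, h⟩ <;> rw [h]
    · exact hq
    · rw [← hq]; linear_combination (y * s - x * t) * q
    · linear_combination (y * t - x * s) * p
  generalize hN : (S ∩ T).card = n at *
  interval_cases n
  · -- empty intersection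
    have hST : Disjoint S T := by
      rw [Finset.disjoint_iff_inter_eq_empty, ← Finset.card_eq_zero, hN]
    have hTS : T = Sᶜ := Finset.eq_of_subset_of_card_le
      (fun k hk => Finset.mem_compl.2 fun hk' => Finset.disjoint_left.1 hST hk' hk)
      (by rw [card_compl3 hS, hT])
    have hq : x * t + y * s = 0 := by
      push_cast at s1; linear_combination (1 / 3) * s1
    have : ∀ k, ((a k / d k) ^ 3 * (d k / b k) ^ 3) ^ 2 = (x * t) ^ 2 := by
      intro k
      rcases val k with ⟨⟨u, v⟩, h⟩ | ⟨-, h⟩ | ⟨-, h⟩ | ⟨⟨u, v⟩, h⟩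
      · rw [hTS] at v; exact absurd u (Finset.mem_compl.1 v)
      · rw [h]
      · rw [h]; linear_combination (y * s - x * t) * hq
      · rw [hTS, Finset.mem_compl] at v; exact absurd u v
    rw [this, this]
  · have hq3 : (x * t + y * s) ^ 3 = 0 := by
      push_cast at s1 s2
      linear_combination (-1 / 6) * s2 +
        (1 / 6) * ((x * s + y * t) ^ 2 - 2 * (x * s + y * t) * (x * t + y * s)
          + 4 * (x * t + y * s) ^ 2 - 3 * (x * y * s * t)) * s1
    have hq : x * t + y * s = 0 := by simpa using hq3
    have hp : x * s + y * t = 0 := by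
      push_cast at s1; linear_combination s1 - 2 * hq
    rw [four hp hq, four hp hq]
  · have hp3 : (x * s + y * t) ^ 3 = 0 := by
      push_cast at s1 s2
      linear_combination (-1 / 6) * s2 +
        (1 / 6) * (4 * (x * s + y * t) ^ 2 - 2 * (x * s + y * t) * (x * t + y * s)
          + (x * t + y * s) ^ 2 - 3 * (x * y * s * t)) * s1
    have hp : x * s + y * t = 0 := by simpa using hp3
    have hq : x * t + y * s = 0 := by
      push_cast at s1; linear_combination s1 - 2 * hp
    rw [four hp hq, four hp hq]
  · have hST : S = T := by
      have i1 : S ∩ T = S := Finset.eq_of_subset_of_card_le Finset.inter_subset_left (by omega)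
      have i2 : S ∩ T = T := Finset.eq_of_subset_of_card_le Finset.inter_subset_right (by omega)
      rw [← i1, i2]
    have hp : x * s + y * t = 0 := by
      push_cast at s1; linear_combination (1 / 3) * s1
    have : ∀ k, ((a k / d k) ^ 3 * (d k / b k) ^ 3) ^ 2 = (x * s) ^ 2 := by
      intro k
      rcases val k with ⟨-, h⟩ | ⟨⟨u, v⟩, h⟩ | ⟨⟨u, v⟩, h⟩ | ⟨-, h⟩
      · rw [h]
      · rw [← hST] at v; exact absurd u v
      · rw [← hST] at v; exact absurd v u
      · rw [h]; linear_combination (y * t - x * s) * hp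
    rw [this, this]

theorem roots_aux {x y z t : ℂ} (hx : ‖x‖ = 1) (hy : ‖y‖ = 1) (hz : ‖z‖ = 1) (h : x + y + z = 0)
    (ht : t ^ 3 = x ^ 3) : t = x ∨ t = y ∨ t = z := by
  obtain ⟨h1, -, -, h2, -⟩ := three_aux hx hy hz h
  have : (t - x) * ((t - y) * (t - z)) = 0 := by
    linear_combination ht + h1 - t ^ 2 * h + t * h2
  rcases mul_eq_zero.1 this with h | h
  · left; linear_combination h
  · rcases mul_eq_zero.1 h with h | h
    · right; left; linear_combination h
    · right; right; linear_combination h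

theorem split_three {S : Finset (Fin 6)} (hS : S.card = 3) {k : Fin 6} (hk : k ∈ S) :
    ∃ q r, k ≠ q ∧ k ≠ r ∧ q ≠ r ∧ S = {k, q, r} := by
  have hc : (S.erase k).card = 2 := by rw [Finset.card_erase_of_mem hk, hS]
  obtain ⟨q, r, hqr, he⟩ := Finset.card_eq_two.1 hc
  have hq : q ∈ S.erase k := by rw [he]; simp
  have hr : r ∈ S.erase k := by rw [he]; simp
  refine ⟨q, r, (Finset.ne_of_mem_erase hq).symm, (Finset.ne_of_mem_erase hr).symm, hqr, ?_⟩
  rw [← he, Finset.insert_erase hk]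

theorem sum_three {F : Fin 6 → ℂ} {k q r : Fin 6} (h1 : k ≠ q) (h2 : k ≠ r) (h3 : q ≠ r) :
    ∑ m ∈ ({k, q, r} : Finset (Fin 6)), F m = F k + F q + F r := by
  rw [Finset.sum_insert (by simp [h1, h2]), Finset.sum_pair h3]; ring

theorem classes_aux {K : Fin 6 → ℂ} (hu : Uni K) {S : Finset (Fin 6)} (hS : S.card = 3)
    (hs1 : ∑ k ∈ S, K k = 0) (hs2 : ∑ k ∈ Sᶜ, K k = 0) (hK : ∀ k l, K k ^ 3 = K l ^ 3)
    {k l : Fin 6} (hk : k ∈ S) (hl : l ∈ Sᶜ) (hkl : K k = K l) :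
    ∃ q q' r r', K q = K q' ∧ K r = K r' ∧ K k ≠ K q ∧ K k ≠ K r ∧ K q ≠ K r ∧
      (∀ F : Fin 6 → ℂ, ∑ m, F m = F k + F l + (F q + F q') + (F r + F r')) ∧
      (∀ m, m = k ∨ m = l ∨ m = q ∨ m = q' ∨ m = r ∨ m = r') := by
  obtain ⟨q, r, e1, e2, e3, hSe⟩ := split_three hS hk
  obtain ⟨q', r', f1, f2, f3, hSe'⟩ := split_three (card_compl3 hS) hl
  have hsum : ∀ F : Fin 6 → ℂ, ∑ m, F m = (F k + F q + F r) + (F l + F q' + F r') := by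
    intro F
    rw [← Finset.sum_add_sum_compl S, hSe', hSe, sum_three e1 e2 e3, sum_three f1 f2 f3]
  have hall : ∀ m, m = k ∨ m = q ∨ m = r ∨ m = l ∨ m = q' ∨ m = r' := by
    intro m
    by_cases hm : m ∈ S
    · rw [hSe] at hm; simp at hm; tauto
    · rw [← Finset.mem_compl, hSe'] at hm; simp at hm; tauto
  rw [hSe, sum_three e1 e2 e3] at hs1
  rw [hSe', sum_three f1 f2 f3] at hs2
  obtain ⟨-, -, -, -, a1, a2, a3⟩ := three_aux (hu k) (hu q) (hu r) hs1
  obtain ⟨-, -, -, -, b1, b2, b3⟩ := three_aux (hu l) (hu q') (hu r') hs2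
  rw [← hkl] at b1 b3
  rcases roots_aux (hu k) (hu q) (hu r) hs1 (hK q' k) with h | h | h
  · exact absurd h.symm b1
  · have hr : K r = K r' := by linear_combination hs1 - hs2 - hkl + h
    refine ⟨q, q', r, r', h.symm, hr, a1, a3, a2, ?_, ?_⟩
    · intro F; rw [hsum]; ring
    · intro m; have := hall m; tauto
  · have hr : K q = K r' := by linear_combination hs1 - hs2 - hkl + h
    refine ⟨q, r', r, q', hr, h.symm, a1, a3, a2, ?_, ?_⟩
    · intro F; rw [hsum]; ring
    · intro m; have := hall m; tauto

theorem classes {K : Fin 6 → ℂ} (hT : TerF K) (hu : Uni K) (hK : ∀ k l, K k ^ 3 = K l ^ 3)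
    {k l : Fin 6} (hne : k ≠ l) (hkl : K k = K l) :
    ∃ q q' r r', K q = K q' ∧ K r = K r' ∧ K k ≠ K q ∧ K k ≠ K r ∧ K q ≠ K r ∧
      (∀ F : Fin 6 → ℂ, ∑ m, F m = F k + F l + (F q + F q') + (F r + F r')) ∧
      (∀ m, m = k ∨ m = l ∨ m = q ∨ m = q' ∨ m = r ∨ m = r') := by
  obtain ⟨S, x, y, hS, hs1, hs2, -, -, hi, hj, -⟩ := hT.spec hu
  by_cases hk : k ∈ S <;> by_cases hl : l ∈ S
  · exact absurd (hi k hk l hl hkl) hne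
  · exact classes_aux hu hS hs1 hs2 hK hk (Finset.mem_compl.2 hl) hkl
  · exact classes_aux hu (card_compl3 hS) hs2 (by rw [compl_compl]; exact hs1) hK
      (Finset.mem_compl.2 hk) (by rw [compl_compl]; exact hl) hkl
  · exact absurd (hj k hk l hl hkl) hne

theorem opp_on_classes {u K : Fin 6 → ℂ} (hu : Uni u) (hKu : Uni K) (hT : TerF K)
    (hK : ∀ k l, K k ^ 3 = K l ^ 3) (hb : BinF u) (hbK : BinF (fun k => u k / K k))
    {k₀ l₀ : Fin 6} (hne : u k₀ ^ 6 ≠ u l₀ ^ 6) :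
    ∀ k l, k ≠ l → K k = K l → u k + u l = 0 := by
  obtain ⟨L, hL, hsat, -⟩ := exists_pair hb hne
  have s1 := (hb.sat L hsat).2
  have hK6 : ∀ k l, K k ^ 6 = K l ^ 6 := fun k l => by
    linear_combination (K k ^ 3 + K l ^ 3) * hK k l
  have s2 := (hbK.sat L (fun k l h hk => by
    refine hsat k l ?_ hk
    rw [div_pow, div_pow, hK6 l k] at h
    have := pow_ne_zero 6 (hKu.ne k)
    exact (div_left_inj' this).1 h)).2
  obtain ⟨p, p', hpp, rfl⟩ := Finset.card_eq_two.1 hL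
  rw [Finset.sum_pair hpp] at s1 s2
  have hKp : K p = K p' := by
    have := hKu.ne p; have := hKu.ne p'; have h3 := hu.ne p
    have e : u p' = - u p := by linear_combination s1
    rw [e] at s2
    field_simp at s2
    have : u p * (K p - K p') = 0 := by linear_combination (-1) * s2
    rcases mul_eq_zero.1 this with h | h
    · exact absurd h h3
    · linear_combination h
  obtain ⟨q, q', r, r', hq, hr, n1, n2, n3, hsum, hall⟩ := classes hT hKu hK hpp hKp
  have t1 := hb.sum
  have t2 := hbK.sum
  rw [hsum] at t1 t2
  rw [s1] at t1
  rw [s2, ← hq, ← hr] at t2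
  have z1 : u q + u q' = 0 := by
    have := hKu.ne q; have := hKu.ne r
    have e : u r' = - u r - u q - u q' := by linear_combination t1
    rw [e] at t2
    field_simp at t2
    have : (K r - K q) * (u q + u q') = 0 := by linear_combination t2
    rcases mul_eq_zero.1 this with h | h
    · exact absurd (by linear_combination -h) n3
    · exact h
  have z2 : u r + u r' = 0 := by linear_combination t1 - z1
  intro k l hkl hKkl
  rcases hall k with rfl | rfl | rfl | rfl | rfl | rfl <;>
    rcases hall l with rfl | rfl | rfl | rfl | rfl | rfl <;>
    first
      | exact absurd rfl hkl
      | assumption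
      | (rw [add_comm]; assumption)
      | (exfalso; simp_all)

/-- sums on a ternary splitting with different cubes -/
theorem split_sum {a c d : Fin 6 → ℂ} (ha : Uni a) (hc : Uni c) (hd : Uni d)
    {S : Finset (Fin 6)} (hS : S.card = 3) {x y : ℂ} (hxy : x ≠ y)
    (h1 : ∀ k ∈ S, (c k / d k) ^ 3 = x) (h2 : ∀ k ∉ S, (c k / d k) ^ 3 = y)
    (hac : BinF (fun k => a k / c k)) (had : BinF (fun k => a k / d k)) :
    ∃ α, (∀ k ∈ S, ((a k / d k) ^ 3) ^ 3 = α) ∧ (∀ k ∉ S, ((a k / d k) ^ 3) ^ 3 = -α) := by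
  have odd3 : Odd 3 := by decide
  have s1 := (had.pow 3 odd3).sum
  have s2 := (hac.pow 3 odd3).sum
  have e : ∀ k, (a k / d k) ^ 3 = (c k / d k) ^ 3 * (a k / c k) ^ 3 := fun k => by
    have := ha.ne k; have := hc.ne k; have := hd.ne k
    field_simp
  rw [← Finset.sum_add_sum_compl S] at s1 s2
  have t1 : ∑ k ∈ S, (a k / d k) ^ 3 = x * ∑ k ∈ S, (a k / c k) ^ 3 := by
    rw [Finset.mul_sum]
    exact Finset.sum_congr rfl fun k hk => by rw [e, h1 k hk]
  have t2 : ∑ k ∈ Sᶜ, (a k / d k) ^ 3 = y * ∑ k ∈ Sᶜ, (a k / c k) ^ 3 := by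
    rw [Finset.mul_sum]
    exact Finset.sum_congr rfl fun k hk => by rw [e, h2 k (Finset.mem_compl.1 hk)]
  have u0 : ∑ k ∈ S, (a k / c k) ^ 3 = 0 := by
    rw [t1, t2] at s1
    have : (x - y) * ∑ k ∈ S, (a k / c k) ^ 3 = 0 := by linear_combination s1 - y * s2
    exact (mul_eq_zero.1 this).resolve_left (sub_ne_zero.2 hxy)
  have u1 : ∑ k ∈ S, (a k / d k) ^ 3 = 0 := by rw [t1, u0, mul_zero]
  have u2 : ∑ k ∈ Sᶜ, (a k / d k) ^ 3 = 0 := by rw [u1, zero_add] at s1; exact s1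
  obtain ⟨v1, -⟩ := three_sum ((ha.div hd).pow 3) hS u1
  obtain ⟨v2, -⟩ := three_sum ((ha.div hd).pow 3) (card_compl3 hS) u2
  simp only [Finset.mem_compl] at v1 v2
  have w := ((had.pow 3 odd3).pow 3 odd3).two (((ha.div hd).pow 3).pow 3) hS v1 v2
  exact ⟨_, v1, fun k hk => by rw [v2 k hk, w]⟩

theorem lemma1b {a b c d : Fin 6 → ℂ} (ha : Uni a) (hb : Uni b) (hc : Uni c) (hd : Uni d)
    (hab : BinF (fun k => a k / b k)) (hac : BinF (fun k => a k / c k))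
    (hbc : BinF (fun k => b k / c k)) (had : BinF (fun k => a k / d k))
    (hbd : BinF (fun k => b k / d k)) (hcd : TerF (fun k => c k / d k)) : False := by
  have odd3 : Odd 3 := by decide
  obtain ⟨S, x, y, hS, hs1, hs2, hx, hy, -⟩ := hcd.spec (hc.div hd)
  by_cases hxy : x = y
  · subst hxy
    have hall : ∀ k, (c k / d k) ^ 3 = x := fun k => by
      by_cases h : k ∈ S
      · exact hx k h
      · exact hy k h
    have hK : ∀ k l, (c k / d k) ^ 3 = (c l / d l) ^ 3 := fun k l => by rw [hall, hall]
    have hqu : ∀ f : Fin 6 → ℂ, BinF (fun k => f k / c k) →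
        BinF (fun k => (f k / d k) / (c k / d k)) := by
      intro f hf
      have : (fun k => (f k / d k) / (c k / d k)) = (fun k => f k / c k) := by
        funext k
        exact div_div_div_cancel_right₀ (hd.ne k) _ _
      rw [this]; exact hf
    obtain ⟨k₁, l₁, h₁⟩ := lemmaR ha hd hb had hab hbd.inv
    obtain ⟨k₂, l₂, h₂⟩ := lemmaR hb hd ha hbd hab.inv had.inv
    have oa := opp_on_classes (ha.div hd) (hc.div hd) hcd hK had (hqu a hac) h₁
    have ob := opp_on_classes (hb.div hd) (hc.div hd) hcd hK hbd (hqu b hbc) h₂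
    have heq : ∀ k l, k ≠ l → c k / d k = c l / d l → a k / b k = a l / b l := by
      intro k l hkl h
      have e1 := oa k l hkl h
      have e2 := ob k l hkl h
      have h1 : ∀ m, a m / b m = (a m / d m) / (b m / d m) := fun m =>
        (div_div_div_cancel_right₀ (hd.ne m) _ _).symm
      rw [h1, h1, eq_neg_of_add_eq_zero_left e1, eq_neg_of_add_eq_zero_left e2, neg_div_neg_eq]
    -- two columns in the same class
    obtain ⟨p, hp⟩ : S.Nonempty := by rw [← Finset.card_pos]; omega
    obtain ⟨q, r, e1, e2, e3, hSe⟩ := split_three hS hp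
    obtain ⟨p', hp'⟩ : Sᶜ.Nonempty := by rw [← Finset.card_pos, card_compl3 hS]; omega
    have hs1' := hs1
    rw [hSe, sum_three e1 e2 e3] at hs1'
    have hex : ∃ k l, k ≠ l ∧ c k / d k = c l / d l := by
      rw [Finset.mem_compl, hSe] at hp'
      simp only [Finset.mem_insert, Finset.mem_singleton, not_or] at hp'
      rcases roots_aux (hc.div hd p) (hc.div hd q) (hc.div hd r) hs1' (hK p' p) with h | h | h
      · exact ⟨p', p, hp'.1, h⟩
      · exact ⟨p', q, hp'.2.1, h⟩
      · exact ⟨p', r, hp'.2.2, h⟩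
    obtain ⟨k, l, hkl, hKkl⟩ := hex
    obtain ⟨q, q', r, r', hq, hr, n1, n2, n3, hsum, -⟩ :=
      classes hcd (hc.div hd) hK hkl hKkl
    have heq' : ∀ k l, c k / d k = c l / d l → a k / b k = a l / b l := fun k l h => by
      by_cases e : k = l
      · rw [e]
      · exact heq k l e h
    have g1 := heq' _ _ hKkl
    have g2 := heq' _ _ hq
    have g3 := heq' _ _ hr
    have t1 := hab.sum
    have t2 := (hab.pow 3 odd3).sum
    rw [hsum, ← g1, ← g2, ← g3] at t1 t2
    have t3 : a k / b k + a q / b q + a r / b r = 0 := by linear_combination (1 / 2) * t1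
    obtain ⟨c1, c2, c3, -⟩ := three_aux (ha.div hb k) (ha.div hb q) (ha.div hb r) t3
    rw [c2, c3, ← c1] at t2
    have : (a k / b k) ^ 3 = 0 := by linear_combination (1 / 6) * t2
    exact pow_ne_zero 3 ((ha.div hb).ne k) this
  · obtain ⟨α, ha1, ha2⟩ := split_sum ha hc hd hS hxy hx hy hac had
    obtain ⟨β, hb1, hb2⟩ := split_sum hb hc hd hS hxy hx hy hbc hbd
    refine ((hab.pow 3 odd3).pow 3 odd3).not_const (((ha.div hb).pow 3).pow 3) (α / β) fun k => ?_
    have e : ((a k / b k) ^ 3) ^ 3 = ((a k / d k) ^ 3) ^ 3 / ((b k / d k) ^ 3) ^ 3 := by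
      rw [← div_div_div_cancel_right₀ (hd.ne k) (a k) (b k), div_pow, div_pow]
    rw [e]
    by_cases hk : k ∈ S
    · rw [ha1 k hk, hb1 k hk]
    · rw [ha2 k hk, hb2 k hk, neg_div_neg_eq]

theorem fourRoots {H : Fin 4 → Fin 6 → ℂ} (hH : ∀ i, Uni (H i)) {k m : Fin 6}
    (h : ∀ i j, i ≠ j → (H i k / H j k) ^ 3 = (H i m / H j m) ^ 3 ∧
      H i k / H j k ≠ H i m / H j m) : False := by
  have key : ∀ i j, i ≠ j → H i k / H i m ≠ H j k / H j m ∧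
      (H i k / H i m) ^ 2 + (H i k / H i m) * (H j k / H j m) + (H j k / H j m) ^ 2 = 0 := by
    intro i j hij
    obtain ⟨h1, h2⟩ := h i j hij
    have a1 := (hH i).ne k
    have a2 := (hH i).ne m
    have a3 := (hH j).ne k
    have a4 := (hH j).ne m
    have h3 : H i k / H i m ≠ H j k / H j m := by
      intro h3
      apply h2
      rw [div_eq_div_iff a2 a4] at h3
      rw [div_eq_div_iff a3 a4]
      linear_combination h3
    refine ⟨h3, ?_⟩
    have h4 : (H i k / H i m) ^ 3 = (H j k / H j m) ^ 3 := by
      rw [div_pow, div_pow, div_eq_div_iff (pow_ne_zero 3 a3) (pow_ne_zero 3 a4)] at h1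
      rw [div_pow, div_pow, div_eq_div_iff (pow_ne_zero 3 a2) (pow_ne_zero 3 a4)]
      linear_combination h1
    refine (mul_eq_zero.1 ?_).resolve_left (sub_ne_zero.2 h3)
    linear_combination h4
  have k01 := key 0 1 (by decide)
  have k02 := key 0 2 (by decide)
  have k03 := key 0 3 (by decide)
  have k12 := key 1 2 (by decide)
  have k13 := key 1 3 (by decide)
  have k23 := key 2 3 (by decide)
  apply k23.1
  have s1 : H 0 k / H 0 m + H 1 k / H 1 m + H 2 k / H 2 m = 0 := by
    refine (mul_eq_zero.1 ?_).resolve_left (sub_ne_zero.2 k12.1)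
    linear_combination k01.2 - k02.2
  have s2 : H 0 k / H 0 m + H 1 k / H 1 m + H 3 k / H 3 m = 0 := by
    refine (mul_eq_zero.1 ?_).resolve_left (sub_ne_zero.2 k13.1)
    linear_combination k01.2 - k03.2
  linear_combination s1 - s2

/-- Functions taking a value on three columns, and a value on the three others. -/
def Two (g : Fin 6 → ℂ) : Prop :=
  ∃ (S : Finset (Fin 6)) (x y : ℂ), S.card = 3 ∧ (∀ k ∈ S, g k = x) ∧ (∀ k ∉ S, g k = y)

open Classical in
theorem Two.level {g : Fin 6 → ℂ} (hg : Two g) {p q : Fin 6} (h : g p ≠ g q) :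
    (∀ k, g k = g p ∨ g k = g q) ∧ (Finset.univ.filter (fun k => g k = g p)).card = 3 := by
  obtain ⟨S, x, y, hS, h1, h2⟩ := hg
  by_cases hp : p ∈ S
  · by_cases hq : q ∈ S
    · exact absurd (by rw [h1 p hp, h1 q hq]) h
    · rw [h1 p hp, h2 q hq] at *
      refine ⟨fun k => ?_, ?_⟩
      · by_cases hk : k ∈ S
        · left; exact h1 k hk
        · right; exact h2 k hk
      · rw [← hS]
        congr 1
        ext k
        simp only [Finset.mem_filter, Finset.mem_univ, true_and]
        refine ⟨fun hk => ?_, fun hk => h1 k hk⟩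
        by_contra hn
        exact h (by rw [← hk, h2 k hn])
  · by_cases hq : q ∈ S
    · rw [h2 p hp, h1 q hq] at *
      refine ⟨fun k => ?_, ?_⟩
      · by_cases hk : k ∈ S
        · right; exact h1 k hk
        · left; exact h2 k hk
      · rw [← card_compl3 hS]
        congr 1
        ext k
        simp only [Finset.mem_filter, Finset.mem_univ, true_and, Finset.mem_compl]
        refine ⟨fun hk hn => ?_, fun hk => h2 k hk⟩
        exact h (by rw [← hk, h1 k hn])
    · exact absurd (by rw [h2 p hp, h2 q hq]) h

theorem Two.const_on {F G K : Fin 6 → ℂ} (hG : Two G) (hK : Two K) (hG0 : ∀ k, G k ≠ 0)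
    (hFG : ∀ k, K k = F k * G k) {S : Finset (Fin 6)} (hS : S.card = 3) {x y : ℂ} (hxy : x ≠ y)
    (hx0 : x ≠ 0) (h1 : ∀ k ∈ S, F k = x) (h2 : ∀ k ∉ S, F k = y) :
    ∀ p ∈ S, ∀ q ∈ S, G p = G q := by
  classical
  intro p hp q hq
  by_contra hne
  have hpK : K p = x * G p := by rw [hFG, h1 p hp]
  have hqK : K q = x * G q := by rw [hFG, h1 q hq]
  have hneK : K p ≠ K q := by
    rw [hpK, hqK]
    exact fun h => hne (mul_left_cancel₀ hx0 h)
  obtain ⟨g1, g2⟩ := hG.level hne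
  obtain ⟨k1, k2⟩ := hK.level hneK
  have i1 : ∀ k ∈ S, (K k = K p ↔ G k = G p) := by
    intro k hk
    rw [hFG k, h1 k hk, hpK]
    exact mul_right_inj' hx0
  have i2 : ∀ k ∉ S, (K k = K p ↔ ¬ G k = G p) := by
    intro k hk
    have e : K k = y * G k := by rw [hFG, h2 k hk]
    constructor
    · intro h h'
      rw [e, hpK, h'] at h
      exact hxy (mul_right_cancel₀ (hG0 p) h).symm
    · intro h
      have hGq := (g1 k).resolve_left h
      refine (k1 k).resolve_right fun h' => ?_
      rw [e, hqK, hGq] at h'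
      exact hxy (mul_right_cancel₀ (hG0 q) h').symm
  have c1 := Finset.card_filter_add_card_filter_not (s := Finset.univ.filter (fun k => G k = G p))
    (fun k => k ∈ S)
  have c2 := Finset.card_filter_add_card_filter_not (s := Finset.univ.filter (fun k => K k = K p))
    (fun k => k ∈ S)
  have c3 := Finset.card_filter_add_card_filter_not (s := Sᶜ) (fun k => G k = G p)
  have e1 : ((Finset.univ.filter (fun k => K k = K p)).filter (fun k => k ∈ S))
      = ((Finset.univ.filter (fun k => G k = G p)).filter (fun k => k ∈ S)) := by
    ext k
    simp only [Finset.mem_filter, Finset.mem_univ, true_and]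
    exact ⟨fun h => ⟨(i1 k h.2).1 h.1, h.2⟩, fun h => ⟨(i1 k h.2).2 h.1, h.2⟩⟩
  have e2 : ((Finset.univ.filter (fun k => K k = K p)).filter (fun k => ¬ k ∈ S))
      = Sᶜ.filter (fun k => ¬ G k = G p) := by
    ext k
    simp only [Finset.mem_filter, Finset.mem_univ, true_and, Finset.mem_compl]
    exact ⟨fun h => ⟨h.2, (i2 k h.2).1 h.1⟩, fun h => ⟨(i2 k h.1).2 h.2, h.1⟩⟩
  have e3 : ((Finset.univ.filter (fun k => G k = G p)).filter (fun k => ¬ k ∈ S))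
      = Sᶜ.filter (fun k => G k = G p) := by
    ext k
    simp only [Finset.mem_filter, Finset.mem_univ, true_and, Finset.mem_compl]
    exact ⟨fun h => ⟨h.2, h.1⟩, fun h => ⟨h.2, h.1⟩⟩
  rw [g2, e3] at c1
  rw [k2, e1, e2] at c2
  rw [card_compl3 hS] at c3
  omega

theorem TerF.cube_two {f : Fin 6 → ℂ} (hf : TerF f) (hu : Uni f) : Two (fun k => f k ^ 3) := by
  obtain ⟨S, x, y, hS, -, -, h1, h2, -⟩ := hf.spec hu
  exact ⟨S, x, y, hS, h1, h2⟩

/-- Case A: a nonconstant cube. -/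
theorem lemma2A {H : Fin 4 → Fin 6 → ℂ} (hH : ∀ i, Uni (H i))
    (hT : ∀ i j, i ≠ j → TerF (fun k => H i k / H j k)) {i j : Fin 4} (hij : i ≠ j)
    (hne : ∃ k l, (H i k / H j k) ^ 3 ≠ (H i l / H j l) ^ 3) : False := by
  obtain ⟨k₀, l₀, hne⟩ := hne
  have hu : ∀ a b, Uni (fun k => H a k / H b k) := fun a b => (hH a).div (hH b)
  obtain ⟨S, x, y, hS, hs1, hs2, hx, hy, -⟩ := (hT i j hij).spec (hu i j)
  have hxy : x ≠ y := by
    rintro rfl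
    apply hne
    have : ∀ k, (H i k / H j k) ^ 3 = x := fun k => by
      by_cases h : k ∈ S
      · exact hx k h
      · exact hy k h
    rw [this, this]
  have hx0 : x ≠ 0 := by
    obtain ⟨k, hk⟩ : S.Nonempty := by rw [← Finset.card_pos]; omega
    rw [← hx k hk]
    exact pow_ne_zero 3 ((hu i j).ne k)
  have claim1 : ∀ a, ∀ p ∈ S, ∀ q ∈ S, (H j p / H a p) ^ 3 = (H j q / H a q) ^ 3 := by
    intro a p hp q hq
    by_cases haj : a = j
    · subst haj
      rw [div_self ((hH a).ne p), div_self ((hH a).ne q)]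
    by_cases hai : a = i
    · subst hai
      have e : ∀ m, (H j m / H a m) ^ 3 = ((H a m / H j m) ^ 3)⁻¹ := fun m => by
        rw [← inv_pow, inv_div]
      rw [e, e, hx p hp, hx q hq]
    · refine Two.const_on (F := fun k => (H i k / H j k) ^ 3) (K := fun k => (H i k / H a k) ^ 3)
        ((hT j a (Ne.symm haj)).cube_two (hu j a)) ((hT i a (Ne.symm hai)).cube_two (hu i a))
        (fun k => pow_ne_zero 3 ((hu j a).ne k)) ?_ hS hxy hx0 hx hy p hp q hq
      intro k
      show (H i k / H a k) ^ 3 = (H i k / H j k) ^ 3 * (H j k / H a k) ^ 3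
      rw [← mul_pow, div_mul_div_cancel₀ ((hH j).ne k)]
  have claim2 : ∀ a b, ∀ p ∈ S, ∀ q ∈ S, (H a p / H b p) ^ 3 = (H a q / H b q) ^ 3 := by
    intro a b p hp q hq
    have e : ∀ m, (H a m / H b m) ^ 3 = (H j m / H b m) ^ 3 / (H j m / H a m) ^ 3 := fun m => by
      have := (hH a).ne m; have := (hH b).ne m; have := (hH j).ne m
      field_simp
    rw [e, e, claim1 b p hp q hq, claim1 a p hp q hq]
  have nsum : ∀ a b, (∃ k l, (H a k / H b k) ^ 3 ≠ (H a l / H b l) ^ 3) →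
      ∑ k ∈ S, H a k / H b k = 0 := by
    rintro a b ⟨k, l, hkl⟩
    have hab : a ≠ b := by
      rintro rfl
      rw [div_self ((hH a).ne k), div_self ((hH a).ne l)] at hkl
      exact hkl rfl
    exact (hT a b hab).nonconst_sum (hu a b) hkl hS (claim2 a b)
  have inj : ∀ a b, a ≠ b → ∀ p ∈ S, ∀ q ∈ S, p ≠ q → H a p / H b p ≠ H a q / H b q := by
    intro a b hab p hp q hq hpq hK
    by_cases hc : ∃ k l, (H a k / H b k) ^ 3 ≠ (H a l / H b l) ^ 3
    · exact hpq ((three_sum (hu a b) hS (nsum a b hc)).2 p hp q hq hK)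
    · push Not at hc
      have hm : ∃ m, ∃ k l, (H a k / H m k) ^ 3 ≠ (H a l / H m l) ^ 3 := by
        by_contra hcon
        push Not at hcon
        apply hne
        have e : ∀ m, (H i m / H j m) ^ 3 = (H a m / H j m) ^ 3 / (H a m / H i m) ^ 3 := fun m => by
          have := (hH a).ne m; have := (hH i).ne m; have := (hH j).ne m
          field_simp
        rw [e, e, hcon j k₀ l₀, hcon i k₀ l₀]
      obtain ⟨m, k, l, hkl⟩ := hm
      have s1 := nsum a m ⟨k, l, hkl⟩
      have s2 := nsum b m ⟨k, l, fun h => by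
        apply hkl
        have e : ∀ n, (H a n / H m n) ^ 3 = (H a n / H b n) ^ 3 * (H b n / H m n) ^ 3 := fun n => by
          rw [← mul_pow, div_mul_div_cancel₀ ((hH b).ne n)]
        rw [e, e, h, hc k l]⟩
      obtain ⟨q', r, e1, e2, e3, hSe⟩ := split_three hS hp
      obtain ⟨r, n1, n2, hSe⟩ : ∃ r, p ≠ r ∧ q ≠ r ∧ S = {p, q, r} := by
        rw [hSe] at hq
        simp only [Finset.mem_insert, Finset.mem_singleton] at hq
        rcases hq with rfl | rfl | rfl
        · exact absurd rfl hpq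
        · exact ⟨r, e2, e3, hSe⟩
        · exact ⟨q', e1, e3.symm, by rw [hSe, Finset.pair_comm]⟩
      rw [hSe, sum_three hpq n1 n2] at s1 s2
      have e : ∀ n, H a n / H m n = (H a n / H b n) * (H b n / H m n) := fun n => by
        rw [div_mul_div_cancel₀ ((hH b).ne n)]
      rw [e, e, e, ← hK] at s1
      have : (H b r / H m r) * (H a p / H b p - H a r / H b r) = 0 := by
        linear_combination (H a p / H b p) * s2 - s1
      have hr := (mul_eq_zero.1 this).resolve_left ((hu b m).ne r)
      exact (hT a b hab).no_three (hu a b) hpq n1 n2 hK (by linear_combination hr)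
  obtain ⟨p, q, r, hpq, -, -, hSe⟩ := Finset.card_eq_three.1 hS
  have hp : p ∈ S := by rw [hSe]; simp
  have hq : q ∈ S := by rw [hSe]; simp
  exact fourRoots hH (k := p) (m := q) fun a b hab =>
    ⟨claim2 a b p hp q hq, inj a b hab p hp q hq hpq⟩

theorem prod_opp {f : Fin 6 → ℂ} (hu : Uni f) (h : BinF f ∨ TerF f) {P : Finset (Fin 6)}
    (hP : P.card = 3) {c : ℂ} (h1 : ∀ k ∈ P, f k ^ 3 = c) (h2 : ∀ k ∉ P, f k ^ 3 = -c) :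
    ∏ k ∈ P, f k = - ∏ k ∈ Pᶜ, f k := by
  obtain ⟨p, hp⟩ : P.Nonempty := by rw [← Finset.card_pos]; omega
  obtain ⟨q, hq⟩ : Pᶜ.Nonempty := by rw [← Finset.card_pos, card_compl3 hP]; omega
  have hc : c ≠ 0 := by rw [← h1 p hp]; exact pow_ne_zero 3 (hu.ne p)
  have hcc := two_ne_aux hc
  rcases h with h | h
  · obtain ⟨σ, s1, s2, s3⟩ := h
    have s4 : ∀ k, f (σ k) ^ 3 = - f k ^ 3 := fun k => by rw [s3]; ring
    have a1 : ∀ k ∈ P, σ k ∈ Pᶜ := fun k hk => by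
      rw [Finset.mem_compl]
      intro h
      have := s4 k
      rw [h1 _ h, h1 k hk] at this
      exact hcc this
    have a2 : ∀ k ∈ Pᶜ, σ k ∈ P := fun k hk => by
      by_contra h
      have := s4 k
      rw [h2 _ h, h2 k (Finset.mem_compl.1 hk), neg_neg] at this
      exact hcc this.symm
    have : ∏ k ∈ P, (- f k) = ∏ k ∈ Pᶜ, f k :=
      Finset.prod_nbij' σ σ a1 a2 (fun k _ => s1 k) (fun k _ => s1 k) (fun k _ => (s3 k).symm)
    rw [← this, Finset.prod_neg, hP]
    ring
  · have hne : f p ^ 3 ≠ f q ^ 3 := by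
      rw [h1 p hp, h2 q (Finset.mem_compl.1 hq)]; exact hcc
    have t1 := h.nonconst_sum hu hne hP (fun k hk l hl => by rw [h1 k hk, h1 l hl])
    have t2 := h.nonconst_sum hu hne (card_compl3 hP) (fun k hk l hl => by
      rw [h2 k (Finset.mem_compl.1 hk), h2 l (Finset.mem_compl.1 hl)])
    rw [← (three_sum hu hP t1).1 p hp, ← (three_sum hu (card_compl3 hP) t2).1 q hq, h1 p hp,
      h2 q (Finset.mem_compl.1 hq), neg_neg]

theorem inj_of_prod {K : Fin 6 → ℂ} (hT : TerF K) (hu : Uni K) (hK : ∀ k l, K k ^ 3 = K l ^ 3)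
    {P : Finset (Fin 6)} (hp : ∏ k ∈ P, K k = ∏ k ∈ Pᶜ, K k)
    {p q r : Fin 6} (hpq : p ≠ q) (hpr : p ≠ r) (hqr : q ≠ r) (hPe : P = {p, q, r}) :
    K p ≠ K q := by
  intro hKpq
  obtain ⟨S, x, y, hS, -, -, hx, hy, -, -, px, py⟩ := hT.spec hu
  obtain ⟨s, hs⟩ : S.Nonempty := by rw [← Finset.card_pos]; omega
  obtain ⟨t, ht⟩ : Sᶜ.Nonempty := by rw [← Finset.card_pos, card_compl3 hS]; omega
  have ex : x = K p ^ 3 := by rw [← hx s hs, hK s p]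
  have ey : y = K p ^ 3 := by rw [← hy t (Finset.mem_compl.1 ht), hK t p]
  have tot := (Finset.prod_mul_prod_compl S K).trans (Finset.prod_mul_prod_compl P K).symm
  rw [px, py, ex, ey, ← hp] at tot
  have hA : (∏ k ∈ P, K k) = K p * K q * K r := by
    rw [hPe, Finset.prod_insert (by simp [hpq, hpr]), Finset.prod_pair hqr]; ring
  rw [hA, ← hKpq] at tot
  have h3 := hK r p
  have n1 := hu.ne p
  have n2 := hu.ne r
  have e2 : K r ^ 2 = K p ^ 2 := by
    apply mul_left_cancel₀ (pow_ne_zero 4 n1)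
    linear_combination -tot
  have : K p ^ 2 * (K p - K r) = 0 := by linear_combination K r * e2 - h3
  have h := (mul_eq_zero.1 this).resolve_left (pow_ne_zero 2 n1)
  exact hT.no_three hu hpq hpr hqr hKpq (by linear_combination h)

/-- Case B: constant cubes. -/
theorem lemma2B {H : Fin 4 → Fin 6 → ℂ} (hH : ∀ i, Uni (H i))
    (hT : ∀ i j, i ≠ j → TerF (fun k => H i k / H j k))
    (hcst : ∀ i j k l, (H i k / H j k) ^ 3 = (H i l / H j l) ^ 3)
    {e : Fin 6 → ℂ} (he : Uni e)
    (hbt : ∀ i, BinF (fun k => e k / H i k) ∨ TerF (fun k => e k / H i k))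
    (hb : BinF (fun k => e k / H 0 k)) : False := by
  have odd3 : Odd 3 := by decide
  have hu : ∀ a b, Uni (fun k => H a k / H b k) := fun a b => (hH a).div (hH b)
  have heu : ∀ a, Uni (fun k => e k / H a k) := fun a => he.div (hH a)
  have hfac : ∀ j k, e k / H j k = (e k / H 0 k) * (H 0 k / H j k) := fun j k => by
    rw [div_mul_div_cancel₀ ((hH 0).ne k)]
  by_cases hQ : ∃ k l, (e k / H 0 k) ^ 6 ≠ (e l / H 0 l) ^ 6
  · obtain ⟨k₀, l₀, hQ⟩ := hQ
    obtain ⟨L, hL, hsat, -⟩ := exists_pair hb hQ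
    have hs : ∀ j k l, (e k / H j k) ^ 6 = (e l / H j l) ^ 6 → k ∈ L → l ∈ L := by
      intro j k l h hk
      refine hsat k l ?_ hk
      have c6 : (H 0 k / H j k) ^ 6 = (H 0 l / H j l) ^ 6 := by
        linear_combination ((H 0 k / H j k) ^ 3 + (H 0 l / H j l) ^ 3) * hcst 0 j k l
      rw [hfac j k, hfac j l, mul_pow, mul_pow, c6] at h
      exact mul_right_cancel₀ (pow_ne_zero 6 ((hu 0 j).ne l)) h
    have hsum : ∀ j, ∑ k ∈ L, e k / H j k = 0 := fun j => by
      rcases hbt j with h | h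
      · exact (h.sat L (hs j)).2
      · exact h.sat (heu j) L (hs j)
    obtain ⟨m, hm⟩ : Lᶜ.Nonempty := by
      rw [← Finset.card_pos, Finset.card_compl, hL]; decide
    obtain ⟨k, l, hkl, rfl⟩ := Finset.card_eq_two.1 hL
    simp only [Finset.mem_compl, Finset.mem_insert, Finset.mem_singleton, not_or] at hm
    have heq : ∀ i j, H i k / H j k = H i l / H j l := by
      intro i j
      have e1 := hsum i
      have e2 := hsum j
      rw [Finset.sum_pair hkl] at e1 e2
      have h1 : ∀ n, H i n / H j n = (e n / H j n) / (e n / H i n) := fun n => by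
        have := (hH i).ne n; have := (hH j).ne n; have := he.ne n
        field_simp
      rw [h1, h1, eq_neg_of_add_eq_zero_left e1, eq_neg_of_add_eq_zero_left e2, neg_div_neg_eq]
    exact fourRoots hH (k := k) (m := m) fun i j hij => ⟨hcst i j k m, fun h =>
      (hT i j hij).no_three (hu i j) hkl (Ne.symm hm.1) (Ne.symm hm.2) (heq i j) h⟩
  · push Not at hQ
    obtain ⟨P, hP, hP1, hP2⟩ := (hb.pow 3 odd3).level ((heu 0).pow 3) ((e 0 / H 0 0) ^ 6)
      (fun k => by rw [← hQ k 0]; ring)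
    have hopp : ∀ j, ∏ k ∈ P, e k / H j k = - ∏ k ∈ Pᶜ, e k / H j k := by
      intro j
      refine prod_opp (heu j) (hbt j) hP (c := (e 0 / H 0 0) ^ 3 * (H 0 0 / H j 0) ^ 3) ?_ ?_
      · intro k hk
        show (e k / H j k) ^ 3 = _
        have := hP1 k hk
        rw [hfac, mul_pow, this, hcst 0 j k 0]
      · intro k hk
        show (e k / H j k) ^ 3 = _
        have := hP2 k hk
        rw [hfac, mul_pow, this, hcst 0 j k 0]
        ring
    have hprod : ∀ i j, ∏ k ∈ P, H i k / H j k = ∏ k ∈ Pᶜ, H i k / H j k := by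
      intro i j
      have h1 : ∀ n, H i n / H j n = (e n / H j n) / (e n / H i n) := fun n => by
        have := (hH i).ne n; have := (hH j).ne n; have := he.ne n
        field_simp
      simp only [h1]
      rw [Finset.prod_div_distrib (s := P) (f := fun n => e n / H j n),
        Finset.prod_div_distrib (s := Pᶜ) (f := fun n => e n / H j n), hopp i, hopp j,
        neg_div_neg_eq]
    obtain ⟨p, q, r, hpq, hpr, hqr, hPe⟩ := Finset.card_eq_three.1 hP
    exact fourRoots hH (k := p) (m := q) fun i j hij => ⟨hcst i j p q,
      inj_of_prod (hT i j hij) (hu i j) (hcst i j) (hprod i j) hpq hpr hqr hPe⟩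

theorem lemma2 {H : Fin 4 → Fin 6 → ℂ} (hH : ∀ i, Uni (H i))
    (hT : ∀ i j, i ≠ j → TerF (fun k => H i k / H j k))
    {e : Fin 6 → ℂ} (he : Uni e)
    (hbt : ∀ i, BinF (fun k => e k / H i k) ∨ TerF (fun k => e k / H i k))
    (hb : BinF (fun k => e k / H 0 k)) : False := by
  by_cases hc : ∃ i j, ∃ k l, (H i k / H j k) ^ 3 ≠ (H i l / H j l) ^ 3
  · obtain ⟨i, j, k, l, h⟩ := hc
    have hij : i ≠ j := by
      rintro rfl
      rw [div_self ((hH i).ne k), div_self ((hH i).ne l)] at h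
      exact h rfl
    exact lemma2A hH hT hij ⟨k, l, h⟩
  · push Not at hc
    exact lemma2B hH hT hc he hbt hb

theorem no_triple {B T : Fin 6 → Fin 6 → Prop} (hBs : ∀ i j, B i j → B j i)
    (hTs : ∀ i j, T i j → T j i) (hbt : ∀ i j, i ≠ j → B i j ∨ T i j)
    (key : ∀ a b c d, a ≠ b → a ≠ c → b ≠ c → a ≠ d → b ≠ d → c ≠ d →
      B a b → B a c → B b c → T c d → False)
    (ht : ∃ i j, i ≠ j ∧ T i j) (a b c : Fin 6) (hab : a ≠ b) (hac : a ≠ c) (hbc : b ≠ c)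
    (h1 : B a b) (h2 : B a c) (h3 : B b c) : False := by
  let M : Finset (Fin 6) → Prop := fun s => s.card = 3 ∧ ∀ x ∈ s, ∀ y ∈ s, x ≠ y → B x y
  have keyM : ∀ s, M s → ∀ x ∈ s, ∀ d ∉ s, ¬ T x d := by
    rintro s ⟨hs, hB⟩ x hx d hd hT
    obtain ⟨q, r, e1, e2, e3, rfl⟩ := split_three hs hx
    simp only [Finset.mem_insert, Finset.mem_singleton, not_or] at hd
    exact key q r x d e3 e1.symm e2.symm (Ne.symm hd.2.1) (Ne.symm hd.2.2) (Ne.symm hd.1)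
      (hB _ (by simp) _ (by simp) e3) (hB _ (by simp) _ (by simp) e1.symm)
      (hB _ (by simp) _ (by simp) e2.symm) hT
  have hM0 : M {a, b, c} := by
    refine ⟨Finset.card_eq_three.2 ⟨a, b, c, hab, hac, hbc, rfl⟩, ?_⟩
    intro x hx y hy hxy
    simp only [Finset.mem_insert, Finset.mem_singleton] at hx hy
    rcases hx with rfl | rfl | rfl <;> rcases hy with rfl | rfl | rfl <;>
      first | exact absurd rfl hxy | assumption | (apply hBs; assumption)
  -- replacing an element
  have repl : ∀ s, M s → ∀ x ∈ s, ∀ d ∉ s, M (insert d (s.erase x)) := by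
    rintro s hs x hx d hd
    have hBd : ∀ y ∈ s, B y d := fun y hy =>
      (hbt y d (by rintro rfl; exact hd hy)).resolve_right (keyM s hs y hy d hd)
    refine ⟨?_, ?_⟩
    · rw [Finset.card_insert_of_notMem (fun h => hd (Finset.mem_of_mem_erase h)),
        Finset.card_erase_of_mem hx, hs.1]
    · intro y hy z hz hyz
      rcases Finset.mem_insert.1 hy with rfl | hy₁ <;>
        rcases Finset.mem_insert.1 hz with rfl | hz₁
      · exact absurd rfl hyz
      · exact hBs _ _ (hBd z (Finset.mem_of_mem_erase hz₁))
      · exact hBd y (Finset.mem_of_mem_erase hy₁)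
      · exact hs.2 y (Finset.mem_of_mem_erase hy₁) z (Finset.mem_of_mem_erase hz₁) hyz
  obtain ⟨i, j, hij, hT⟩ := ht
  have fin : ∀ s, M s → i ∈ s → j ∈ s → False := by
    intro s hs hi hj
    obtain ⟨d, hd⟩ : sᶜ.Nonempty := by rw [← Finset.card_pos, card_compl3 hs.1]; omega
    rw [Finset.mem_compl] at hd
    refine keyM _ (repl s hs i hi d hd) j ?_ i ?_ (hTs _ _ hT)
    · exact Finset.mem_insert_of_mem (Finset.mem_erase.2 ⟨hij.symm, hj⟩)
    · simp only [Finset.mem_insert, Finset.mem_erase, not_or]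
      exact ⟨by rintro rfl; exact hd hi, fun h => h.1 rfl⟩
  have fin2 : ∀ s, M s → i ∈ s → False := by
    intro s hs hi
    by_cases hj : j ∈ s
    · exact fin s hs hi hj
    · exact keyM s hs i hi j hj hT
  by_cases hi : i ∈ ({a, b, c} : Finset (Fin 6))
  · exact fin2 _ hM0 hi
  · exact fin2 _ (repl _ hM0 a (by simp) i hi) (Finset.mem_insert_self _ _)

theorem no_quad {B T : Fin 6 → Fin 6 → Prop} (hBs : ∀ i j, B i j → B j i)
    (hTs : ∀ i j, T i j → T j i) (hbt : ∀ i j, i ≠ j → B i j ∨ T i j)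
    (key : ∀ v : Fin 4 → Fin 6, Function.Injective v → ∀ e, (∀ i, v i ≠ e) →
      (∀ i j, i ≠ j → T (v i) (v j)) → B e (v 0) → False)
    (hb : ∃ i j, i ≠ j ∧ B i j) (v : Fin 4 → Fin 6) (hv : Function.Injective v)
    (hvT : ∀ i j, i ≠ j → T (v i) (v j)) : False := by
  let M : Finset (Fin 6) → Prop := fun s => s.card = 4 ∧ ∀ x ∈ s, ∀ y ∈ s, x ≠ y → T x y
  have keyM : ∀ s, M s → ∀ x ∈ s, ∀ d ∉ s, ¬ B x d := by
    rintro s ⟨hs, hB⟩ x hx d hd hT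
    let w := (s.equivFinOfCardEq hs)
    let u : Fin 4 → Fin 6 := fun n => w.symm (Equiv.swap 0 (w ⟨x, hx⟩) n)
    have hu : ∀ n, u n ∈ s := fun n => (w.symm _).2
    have hinj : Function.Injective u := fun n m h =>
      (Equiv.swap 0 (w ⟨x, hx⟩)).injective (w.symm.injective (Subtype.ext h))
    refine key u hinj d (fun n h => hd (h ▸ hu n))
      (fun n m hnm => hB _ (hu n) _ (hu m) (hinj.ne hnm)) ?_
    have : u 0 = x := by simp [u]
    rw [this]
    exact hBs _ _ hT
  have hM0 : M (Finset.univ.image v) := by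
    refine ⟨by rw [Finset.card_image_of_injective _ hv]; rfl, ?_⟩
    intro x hx y hy hxy
    simp only [Finset.mem_image, Finset.mem_univ, true_and] at hx hy
    obtain ⟨n, rfl⟩ := hx
    obtain ⟨m, rfl⟩ := hy
    exact hvT n m (fun h => hxy (by rw [h]))
  have repl : ∀ s, M s → ∀ x ∈ s, ∀ d ∉ s, M (insert d (s.erase x)) := by
    rintro s hs x hx d hd
    have hBd : ∀ y ∈ s, T y d := fun y hy =>
      (hbt y d (by rintro rfl; exact hd hy)).resolve_left (keyM s hs y hy d hd)
    refine ⟨?_, ?_⟩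
    · rw [Finset.card_insert_of_notMem (fun h => hd (Finset.mem_of_mem_erase h)),
        Finset.card_erase_of_mem hx, hs.1]
    · intro y hy z hz hyz
      rcases Finset.mem_insert.1 hy with rfl | hy₁ <;>
        rcases Finset.mem_insert.1 hz with rfl | hz₁
      · exact absurd rfl hyz
      · exact hTs _ _ (hBd z (Finset.mem_of_mem_erase hz₁))
      · exact hBd y (Finset.mem_of_mem_erase hy₁)
      · exact hs.2 y (Finset.mem_of_mem_erase hy₁) z (Finset.mem_of_mem_erase hz₁) hyz
  obtain ⟨i, j, hij, hT⟩ := hb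
  have fin : ∀ s, M s → i ∈ s → j ∈ s → False := by
    intro s hs hi hj
    obtain ⟨d, hd⟩ : sᶜ.Nonempty := by
      rw [← Finset.card_pos, Finset.card_compl, hs.1]; decide
    rw [Finset.mem_compl] at hd
    refine keyM _ (repl s hs i hi d hd) j ?_ i ?_ (hBs _ _ hT)
    · exact Finset.mem_insert_of_mem (Finset.mem_erase.2 ⟨hij.symm, hj⟩)
    · simp only [Finset.mem_insert, Finset.mem_erase, not_or]
      exact ⟨by rintro rfl; exact hd hi, fun h => h.1 rfl⟩
  have fin2 : ∀ s, M s → i ∈ s → False := by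
    intro s hs hi
    by_cases hj : j ∈ s
    · exact fin s hs hi hj
    · exact keyM s hs i hi j hj hT
  by_cases hi : i ∈ Finset.univ.image v
  · exact fin2 _ hM0 hi
  · exact fin2 _ (repl _ hM0 (v 0) (by simp) i hi) (Finset.mem_insert_self _ _)

theorem ramsey {B : Fin 6 → Fin 6 → Prop}
    (hB : ∀ x y z, x ≠ y → x ≠ z → y ≠ z → B x y → B x z → B y z → False) :
    ∃ x y z, x ≠ y ∧ x ≠ z ∧ y ≠ z ∧ ¬ B x y ∧ ¬ B x z ∧ ¬ B y z := by
  by_contra hcon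
  push Not at hcon
  have L1 : ∀ x y z, 0 ≠ x → 0 ≠ y → 0 ≠ z → x ≠ y → x ≠ z → y ≠ z →
      B 0 x → B 0 y → B 0 z → False := by
    intro x y z hx hy hz hxy hxz hyz b1 b2 b3
    by_cases c1 : B x y
    · exact hB 0 x y hx hy hxy b1 b2 c1
    by_cases c2 : B x z
    · exact hB 0 x z hx hz hxz b1 b3 c2
    · exact hB 0 y z hy hz hyz b2 b3 (hcon x y z hxy hxz hyz c1 c2)
  have L2 : ∀ x y z, 0 ≠ x → 0 ≠ y → 0 ≠ z → x ≠ y → x ≠ z → y ≠ z →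
      ¬ B 0 x → ¬ B 0 y → ¬ B 0 z → False := by
    intro x y z hx hy hz hxy hxz hyz b1 b2 b3
    exact hB x y z hxy hxz hyz (hcon 0 x y hx hy hxy b1 b2) (hcon 0 x z hx hz hxz b1 b3)
      (hcon 0 y z hy hz hyz b2 b3)
  have t123 := L1 1 2 3 (by decide) (by decide) (by decide) (by decide) (by decide) (by decide)
  have t124 := L1 1 2 4 (by decide) (by decide) (by decide) (by decide) (by decide) (by decide)
  have t125 := L1 1 2 5 (by decide) (by decide) (by decide) (by decide) (by decide) (by decide)
  have t134 := L1 1 3 4 (by decide) (by decide) (by decide) (by decide) (by decide) (by decide)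
  have t135 := L1 1 3 5 (by decide) (by decide) (by decide) (by decide) (by decide) (by decide)
  have t145 := L1 1 4 5 (by decide) (by decide) (by decide) (by decide) (by decide) (by decide)
  have t234 := L1 2 3 4 (by decide) (by decide) (by decide) (by decide) (by decide) (by decide)
  have t235 := L1 2 3 5 (by decide) (by decide) (by decide) (by decide) (by decide) (by decide)
  have t245 := L1 2 4 5 (by decide) (by decide) (by decide) (by decide) (by decide) (by decide)
  have t345 := L1 3 4 5 (by decide) (by decide) (by decide) (by decide) (by decide) (by decide)
  have u123 := L2 1 2 3 (by decide) (by decide) (by decide) (by decide) (by decide) (by decide)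
  have u124 := L2 1 2 4 (by decide) (by decide) (by decide) (by decide) (by decide) (by decide)
  have u125 := L2 1 2 5 (by decide) (by decide) (by decide) (by decide) (by decide) (by decide)
  have u134 := L2 1 3 4 (by decide) (by decide) (by decide) (by decide) (by decide) (by decide)
  have u135 := L2 1 3 5 (by decide) (by decide) (by decide) (by decide) (by decide) (by decide)
  have u145 := L2 1 4 5 (by decide) (by decide) (by decide) (by decide) (by decide) (by decide)
  have u234 := L2 2 3 4 (by decide) (by decide) (by decide) (by decide) (by decide) (by decide)
  have u235 := L2 2 3 5 (by decide) (by decide) (by decide) (by decide) (by decide) (by decide)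
  have u245 := L2 2 4 5 (by decide) (by decide) (by decide) (by decide) (by decide) (by decide)
  have u345 := L2 3 4 5 (by decide) (by decide) (by decide) (by decide) (by decide) (by decide)
  clear L1 L2 hcon hB
  by_cases b1 : B 0 1 <;> by_cases b2 : B 0 2 <;> by_cases b3 : B 0 3 <;> by_cases b4 : B 0 4 <;>
    by_cases b5 : B 0 5 <;> simp_all

/-- For a mixed 6×6 complex Hadamard matrix (all pairs of distinct rows
binary or ternary, with both kinds occurring): (1) no three distinct rows are pairwise
binary; (2) no four distinct rows are pairwise ternary; (3) some three distinct rows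
are pairwise ternary. -/
theorem stmt_16 (h : Matrix (Fin 6) (Fin 6) ℂ) (hH : IsCHM h)
    (hbt : ∀ i₁ i₂ : Fin 6, i₁ ≠ i₂ → BinaryPair h i₁ i₂ ∨ TernaryPair h i₁ i₂)
    (hb : ∃ i₁ i₂ : Fin 6, i₁ ≠ i₂ ∧ BinaryPair h i₁ i₂)
    (ht : ∃ i₁ i₂ : Fin 6, i₁ ≠ i₂ ∧ TernaryPair h i₁ i₂) :
    (¬ ∃ i₁ i₂ i₃ : Fin 6, i₁ ≠ i₂ ∧ i₁ ≠ i₃ ∧ i₂ ≠ i₃ ∧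
        BinaryPair h i₁ i₂ ∧ BinaryPair h i₁ i₃ ∧ BinaryPair h i₂ i₃) ∧
    (¬ ∃ i₁ i₂ i₃ i₄ : Fin 6, i₁ ≠ i₂ ∧ i₁ ≠ i₃ ∧ i₁ ≠ i₄ ∧ i₂ ≠ i₃ ∧ i₂ ≠ i₄ ∧ i₃ ≠ i₄ ∧
        TernaryPair h i₁ i₂ ∧ TernaryPair h i₁ i₃ ∧ TernaryPair h i₁ i₄ ∧
        TernaryPair h i₂ i₃ ∧ TernaryPair h i₂ i₄ ∧ TernaryPair h i₃ i₄) ∧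
    (∃ i₁ i₂ i₃ : Fin 6, i₁ ≠ i₂ ∧ i₁ ≠ i₃ ∧ i₂ ≠ i₃ ∧
        TernaryPair h i₁ i₂ ∧ TernaryPair h i₁ i₃ ∧ TernaryPair h i₂ i₃) := by
  have hu : ∀ i, Uni (h i) := fun i k => hH.1 i k
  have hbt' : ∀ i j, i ≠ j → BinF (fun k => h i k / h j k) ∨ TerF (fun k => h i k / h j k) :=
    fun i j hij => (hbt i j hij).imp (binF_of hH.1) (terF_of hH.1)
  have hBs : ∀ i j, BinF (fun k => h i k / h j k) → BinF (fun k => h j k / h i k) :=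
    fun i j hij => hij.inv
  have hTs : ∀ i j, TerF (fun k => h i k / h j k) → TerF (fun k => h j k / h i k) :=
    fun i j hij => hij.inv (hu i) (hu j)
  have part1 := no_triple (B := fun i j => BinF (fun k => h i k / h j k))
    (T := fun i j => TerF (fun k => h i k / h j k)) hBs hTs hbt'
    (by
      intro a b c d hab hac hbc had hbd hcd h1 h2 h3 hT
      rcases hbt' a d had with ha | ha
      · rcases hbt' b d hbd with hb' | hb'
        · exact lemma1b (hu a) (hu b) (hu c) (hu d) h1 h2 h3 ha hb' hT
        · exact lemma1a (hu b) (hu c) (hu a) (hu d) h3 (hBs _ _ h1) (hBs _ _ h2) hb' hT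
      · exact lemma1a (hu a) (hu c) (hu b) (hu d) h2 h1 (hBs _ _ h3) ha hT)
    (by
      obtain ⟨i, j, hij, hT⟩ := ht
      exact ⟨i, j, hij, terF_of hH.1 hT⟩)
  have part2 := no_quad (B := fun i j => BinF (fun k => h i k / h j k))
    (T := fun i j => TerF (fun k => h i k / h j k)) hBs hTs hbt'
    (by
      intro v hv e he hT hB
      exact lemma2 (H := fun n => h (v n)) (fun n => hu (v n)) hT (hu e)
        (fun n => hbt' e (v n) (he n).symm) hB)
    (by
      obtain ⟨i, j, hij, hB⟩ := hb
      exact ⟨i, j, hij, binF_of hH.1 hB⟩)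
  refine ⟨?_, ?_, ?_⟩
  · rintro ⟨a, b, c, hab, hac, hbc, h1, h2, h3⟩
    exact part1 a b c hab hac hbc (binF_of hH.1 h1) (binF_of hH.1 h2) (binF_of hH.1 h3)
  · rintro ⟨a, b, c, d, hab, hac, had, hbc, hbd, hcd, h1, h2, h3, h4, h5, h6⟩
    have g1 := terF_of hH.1 h1
    have g2 := terF_of hH.1 h2
    have g3 := terF_of hH.1 h3
    have g4 := terF_of hH.1 h4
    have g5 := terF_of hH.1 h5
    have g6 := terF_of hH.1 h6
    refine part2 ![a, b, c, d] ?_ ?_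
    · intro i j hij
      fin_cases i <;> fin_cases j <;> simp_all
    · intro i j hij
      fin_cases i <;> fin_cases j <;>
        first | exact absurd rfl hij | assumption | (apply hTs; assumption)
  · obtain ⟨x, y, z, hxy, hxz, hyz, h1, h2, h3⟩ :=
      ramsey (B := fun i j => BinF (fun k => h i k / h j k)) part1
    exact ⟨x, y, z, hxy, hxz, hyz, (hbt x y hxy).resolve_left (fun hc => h1 (binF_of hH.1 hc)),
      (hbt x z hxz).resolve_left (fun hc => h2 (binF_of hH.1 hc)),
      (hbt y z hyz).resolve_left (fun hc => h3 (binF_of hH.1 hc))⟩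
end

section
/- Let h be a 6×6 complex Hadamard matrix such that every pair of distinct rows of h is binary or ternary, with at least one binary pair and at least one ternary pair. Then h is equivalent to F₂₃^{rs} or to F₃₂^{rs} for some complex numbers r, s of modulus 1; conversely, every matrix F₂₃^{rs} and F₃₂^{rs} is a complex Hadamard matrix all of whose pairs of distinct rows are binary or ternary, with both types occurring. -/
/-- The Diţă deformation `F₂₃^{rs}` of `F₂ ⊗ F₃`. -/
noncomputable def F23 (r s : ℂ) : Matrix (Fin 6) (Fin 6) ℂ :=
  !![1, 1,     1,     1,  1,          1;
     1, ω,     ω ^ 2, r,  ω * r,      ω ^ 2 * r;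
     1, ω ^ 2, ω,     s,  ω ^ 2 * s,  ω * s;
     1, 1,     1,     -1, -1,         -1;
     1, ω,     ω ^ 2, -r, -(ω * r),   -(ω ^ 2 * r);
     1, ω ^ 2, ω,     -s, -(ω ^ 2 * s), -(ω * s)]

/-- The Diţă deformation `F₃₂^{rs}` of `F₃ ⊗ F₂`. -/
noncomputable def F32 (r s : ℂ) : Matrix (Fin 6) (Fin 6) ℂ :=
  !![1, 1,  1,         1,            1,         1;
     1, -1, r,         -r,           s,         -s;
     1, 1,  ω,         ω,            ω ^ 2,     ω ^ 2;
     1, -1, ω * r,     -(ω * r),     ω ^ 2 * s, -(ω ^ 2 * s);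
     1, 1,  ω ^ 2,     ω ^ 2,        ω,         ω;
     1, -1, ω ^ 2 * r, -(ω ^ 2 * r), ω * s,     -(ω * s)]


lemma om_sq_add : ω ^ 2 + ω + 1 = 0 := by
  have h := Complex.isPrimitiveRoot_exp 3 (by norm_num)
  have h2 := h.geom_sum_eq_zero (by norm_num)
  have e : Complex.exp (2 * Real.pi * Complex.I / (3:ℕ)) = ω := by unfold ω; norm_num
  rw [e] at h2
  simp [Finset.sum_range_succ] at h2
  linear_combination h2

lemma om_sq : ω ^ 2 = -1 - ω := by linear_combination om_sq_add

lemma om_cube : ω ^ 3 = 1 := by linear_combination (ω - 1) * om_sq_add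

lemma om_norm : ‖ω‖ = 1 := by
  have := congrArg norm om_cube
  rw [norm_pow, norm_one] at this
  exact (pow_eq_one_iff_of_nonneg (norm_nonneg _) (by norm_num)).1 this

lemma conj_mul_of {x : ℂ} (hx : ‖x‖ = 1) : (starRingEnd ℂ) x * x = 1 := by
  rw [Complex.conj_mul', hx]; norm_num

lemma ne_of {x : ℂ} (hx : ‖x‖ = 1) : x ≠ 0 := by
  intro h; rw [h] at hx; simp at hx

lemma om_conj : (starRingEnd ℂ) ω = ω ^ 2 := by
  have h := conj_mul_of om_norm
  have h2 := om_cube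
  have : ω ≠ 0 := ne_of om_norm
  apply mul_right_cancel₀ this
  rw [h]; linear_combination -h2

lemma om_ne_one : ω ≠ 1 := by
  intro h; have := om_sq_add; rw [h] at this; norm_num at this

lemma om_im : ω.im ≠ 0 := by
  intro h
  have h1 := om_conj
  rw [Complex.conj_eq_iff_im.2 h] at h1
  have : ω * (ω - 1) = 0 := by linear_combination -h1
  rcases mul_eq_zero.1 this with h2 | h2
  · exact ne_of om_norm h2
  · exact om_ne_one (by linear_combination h2)

/-- integer combinations of `1, ω` vanish only trivially -/
lemma om_indep (a b : ℤ) (h : (a : ℂ) + b * ω = 0) : a = 0 ∧ b = 0 := by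
  have h1 := congrArg Complex.im h
  have h2 := congrArg Complex.re h
  simp at h1 h2
  have hb : b = 0 := by
    rcases h1 with h1 | h1
    · exact h1
    · exact absurd h1 om_im
  subst hb
  simp at h2
  exact ⟨h2, rfl⟩

lemma conj_eq_inv {x : ℂ} (hx : ‖x‖ = 1) : (starRingEnd ℂ) x = x⁻¹ :=
  eq_inv_of_mul_eq_one_left (conj_mul_of hx)

/-- three unimodular numbers with zero sum -/
lemma z3 {x y z : ℂ} (hx : ‖x‖ = 1) (hy : ‖y‖ = 1) (hz : ‖z‖ = 1) (h : x + y + z = 0) :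
    (y = ω * x ∧ z = ω ^ 2 * x) ∨ (y = ω ^ 2 * x ∧ z = ω * x) := by
  have h2 := congrArg (starRingEnd ℂ) h
  simp only [map_add, map_zero] at h2
  rw [conj_eq_inv hx, conj_eq_inv hy, conj_eq_inv hz] at h2
  have nx := ne_of hx
  have ny := ne_of hy
  have nz := ne_of hz
  field_simp at h2
  have hw := om_sq_add
  have h3 : (y - ω * x) * (y - ω ^ 2 * x) = 0 := by
    have hz' : z = -x - y := by linear_combination h
    subst hz'
    have hc := om_cube
    linear_combination -h2 - x * y * hw + x ^ 2 * hc
  rcases mul_eq_zero.1 h3 with h4 | h4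
  · left
    constructor
    · linear_combination h4
    · linear_combination h - h4 - x * hw
  · right
    constructor
    · linear_combination h4
    · linear_combination h - h4 - x * hw

/-- cube roots -/
lemma cube_eq {x y : ℂ} (h : x ^ 3 = y ^ 3) : x = y ∨ x = ω * y ∨ x = ω ^ 2 * y := by
  have hw := om_sq_add
  have hc := om_cube
  have h3 : (x - y) * ((x - ω * y) * (x - ω ^ 2 * y)) = 0 := by
    linear_combination h - (x^2 * y - x * y^2 * ω) * hw + (x * y ^ 2 - y ^ 3) * hc - x * y^2 * hc
  rcases mul_eq_zero.1 h3 with h4 | h4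
  · left; linear_combination h4
  rcases mul_eq_zero.1 h4 with h4 | h4
  · right; left; linear_combination h4
  · right; right; linear_combination h4

/-- two unimodular numbers are determined by their nonzero sum -/
lemma two_sum {u v u' v' : ℂ} (hu : ‖u‖ = 1) (hv : ‖v‖ = 1) (hu' : ‖u'‖ = 1) (hv' : ‖v'‖ = 1)
    (h : u + v = u' + v') (hne : u + v ≠ 0) : (u' = u ∧ v' = v) ∨ (u' = v ∧ v' = u) := by
  have h2 := congrArg (starRingEnd ℂ) h
  simp only [map_add] at h2
  rw [conj_eq_inv hu, conj_eq_inv hv, conj_eq_inv hu', conj_eq_inv hv'] at h2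
  have n1 := ne_of hu
  have n2 := ne_of hv
  have n3 := ne_of hu'
  have n4 := ne_of hv'
  field_simp at h2
  have h3 : (u + v) * (u' * v' - u * v) = 0 := by linear_combination h2 - u * v * h
  have h4 : u' * v' = u * v := by
    rcases mul_eq_zero.1 h3 with h4 | h4
    · exact absurd h4 hne
    · linear_combination h4
  have h5 : (u' - u) * (u' - v) = 0 := by linear_combination -u' * h - h4
  rcases mul_eq_zero.1 h5 with h6 | h6
  · left; exact ⟨by linear_combination h6, by linear_combination -h - h6⟩
  · right; exact ⟨by linear_combination h6, by linear_combination -h - h6⟩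

/-- a unimodular triple whose sum is minus three -/
lemma three_neg {x y z : ℂ} (hx : ‖x‖ = 1) (hy : ‖y‖ = 1) (hz : ‖z‖ = 1)
    (h : x + y + z = -3) : x = -1 ∧ y = -1 ∧ z = -1 := by
  have key : ∀ w : ℂ, ‖w‖ = 1 → w.re ^ 2 + w.im ^ 2 = 1 := by
    intro w hw
    have := Complex.normSq_eq_norm_sq w
    rw [hw, Complex.normSq_apply] at this
    nlinarith
  have hr := congrArg Complex.re h
  simp at hr
  have kx := key x hx
  have ky := key y hy
  have kz := key z hz
  have bx : -1 ≤ x.re := by nlinarith [sq_nonneg x.im]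
  have yy : -1 ≤ y.re := by nlinarith [sq_nonneg y.im]
  have bz : -1 ≤ z.re := by nlinarith [sq_nonneg z.im]
  have fin : ∀ w : ℂ, w.re ^ 2 + w.im ^ 2 = 1 → w.re = -1 → w = -1 := by
    intro w hw h1
    rw [h1] at hw
    have : w.im = 0 := by nlinarith
    apply Complex.ext <;> simp [h1, this]
  exact ⟨fin x kx (by linarith), fin y ky (by linarith), fin z kz (by linarith)⟩

/-- perm-form of binary -/
def Bin (f : Fin 6 → ℂ) : Prop := ∃ σ : Equiv.Perm (Fin 6), ∀ k, f (σ k) = - f k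

/-- perm-form of ternary -/
def Ter (f : Fin 6 → ℂ) : Prop := ∃ e : Equiv.Perm (Fin 6),
  f (e 1) = ω * f (e 0) ∧ f (e 2) = ω ^ 2 * f (e 0) ∧
  f (e 4) = ω * f (e 3) ∧ f (e 5) = ω ^ 2 * f (e 3)

/-- some value is taken three times -/
def Three (f : Fin 6 → ℂ) : Prop := ∃ k l m : Fin 6, k ≠ l ∧ k ≠ m ∧ l ≠ m ∧ f k = f l ∧ f k = f m

/-- rows quotient -/
noncomputable def qq (h : Matrix (Fin 6) (Fin 6) ℂ) (i j : Fin 6) (k : Fin 6) : ℂ :=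
  h i k * (starRingEnd ℂ) (h j k)

lemma exists_perm_of_rowProd (h : Matrix (Fin 6) (Fin 6) ℂ) (i j : Fin 6) (v : Fin 6 → ℂ)
    (hh : rowProd h i j = Multiset.map v Finset.univ.val) :
    ∃ e : Equiv.Perm (Fin 6), ∀ k, qq h i j (e k) = v k := by
  classical
  have key : ∀ y : ℂ, Nonempty ({k // v k = y} ≃ {k // qq h i j k = y}) := by
    intro y
    have h1 := congrArg (Multiset.count y) hh
    unfold rowProd at h1
    rw [Multiset.count_map, Multiset.count_map] at h1
    refine ⟨Fintype.equivOfCardEq ?_⟩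
    rw [Fintype.card_subtype, Fintype.card_subtype]
    simp only [Finset.card, Finset.filter_val]
    simp only [eq_comm (a := y)] at h1
    exact h1.symm
  let E := fun y => (key y).some
  exact ⟨Equiv.ofFiberEquiv E, fun k => Equiv.ofFiberEquiv_map E k⟩

lemma bin_of (h : Matrix (Fin 6) (Fin 6) ℂ) (i j : Fin 6) (hb : BinaryPair h i j) :
    Bin (qq h i j) := by
  obtain ⟨x, y, z, -, -, -, hh⟩ := hb
  obtain ⟨e, he⟩ := exists_perm_of_rowProd h i j ![x, -x, y, -y, z, -z] (by rw [hh]; rfl)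
  let s : Equiv.Perm (Fin 6) := Equiv.swap 0 1 * Equiv.swap 2 3 * Equiv.swap 4 5
  refine ⟨(e.symm.trans s).trans e, ?_⟩
  intro k
  obtain ⟨l, rfl⟩ := e.surjective k
  simp only [Equiv.trans_apply, Equiv.symm_apply_apply, he]
  have : ∀ l, s l = ![1,0,3,2,5,4] l := by decide
  rw [this]
  fin_cases l <;> simp

lemma ter_of (h : Matrix (Fin 6) (Fin 6) ℂ) (i j : Fin 6) (hb : TernaryPair h i j) :
    Ter (qq h i j) := by
  obtain ⟨x, y, -, -, hh⟩ := hb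
  obtain ⟨e, he⟩ := exists_perm_of_rowProd h i j ![x, ω * x, ω ^ 2 * x, y, ω * y, ω ^ 2 * y]
    (by rw [hh]; rfl)
  refine ⟨e, ?_⟩
  simp [he]

lemma sum_perm (f : Fin 6 → ℂ) (e : Equiv.Perm (Fin 6)) :
    f (e 0) + f (e 1) + f (e 2) + f (e 3) + f (e 4) + f (e 5)
      = f 0 + f 1 + f 2 + f 3 + f 4 + f 5 := by
  have := Equiv.sum_comp e f
  simpa [Fin.sum_univ_six] using this

lemma bin_pow {f : Fin 6 → ℂ} (hf : Bin f) (n : ℕ) (hn : Odd n) :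
    f 0 ^ n + f 1 ^ n + f 2 ^ n + f 3 ^ n + f 4 ^ n + f 5 ^ n = 0 := by
  obtain ⟨σ, hσ⟩ := hf
  have h := sum_perm (fun k => f k ^ n) σ
  simp only [hσ, hn.neg_pow] at h
  linear_combination (-1/2 : ℂ) * h

lemma ter_sum {f : Fin 6 → ℂ} (hf : Ter f) : f 0 + f 1 + f 2 + f 3 + f 4 + f 5 = 0 := by
  obtain ⟨e, h1, h2, h3, h4⟩ := hf
  rw [← sum_perm f e, h1, h2, h3, h4]
  linear_combination (f (e 0) + f (e 3)) * om_sq_add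

lemma bin_comp {f : Fin 6 → ℂ} (hf : Bin f) (e : Equiv.Perm (Fin 6)) : Bin (fun k => f (e k)) := by
  obtain ⟨σ, hσ⟩ := hf
  refine ⟨(e.trans σ).trans e.symm, fun k => ?_⟩
  simp [hσ]

lemma ter_comp {f : Fin 6 → ℂ} (hf : Ter f) (e : Equiv.Perm (Fin 6)) : Ter (fun k => f (e k)) := by
  obtain ⟨σ, hσ⟩ := hf
  refine ⟨σ.trans e.symm, ?_⟩
  simpa using hσ

lemma ter_comp' {f : Fin 6 → ℂ} (e : Equiv.Perm (Fin 6)) (hf : Ter (fun k => f (e k))) : Ter f := by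
  have := ter_comp hf e.symm
  simpa using this

lemma three_comp {f : Fin 6 → ℂ} (e : Equiv.Perm (Fin 6)) (hf : Three (fun k => f (e k))) :
    Three f := by
  obtain ⟨k, l, m, h1, h2, h3, h4, h5⟩ := hf
  exact ⟨e k, e l, e m, by simpa using h1, by simpa using h2, by simpa using h3, h4, h5⟩

/-- two zero-sum triples give a ternary function -/
lemma ter_of_sums {f : Fin 6 → ℂ} (hu : Uni f) (h1 : f 0 + f 1 + f 2 = 0)
    (h2 : f 3 + f 4 + f 5 = 0) : Ter f := by
  rcases z3 (hu 0) (hu 1) (hu 2) h1 with ⟨a, b⟩ | ⟨a, b⟩ <;>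
  rcases z3 (hu 3) (hu 4) (hu 5) h2 with ⟨c, d⟩ | ⟨c, d⟩
  · exact ⟨1, a, b, c, d⟩
  · refine ⟨Equiv.swap 4 5, ?_⟩
    have e : ∀ k, Equiv.swap (4 : Fin 6) 5 k = ![0, 1, 2, 3, 5, 4] k := by decide
    simp only [e]; exact ⟨a, b, d, c⟩
  · refine ⟨Equiv.swap 1 2, ?_⟩
    have e : ∀ k, Equiv.swap (1 : Fin 6) 2 k = ![0, 2, 1, 3, 4, 5] k := by decide
    simp only [e]; exact ⟨b, a, c, d⟩
  · refine ⟨Equiv.swap 1 2 * Equiv.swap 4 5, ?_⟩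
    have e : ∀ k, (Equiv.swap (1 : Fin 6) 2 * Equiv.swap (4 : Fin 6) 5 : Equiv.Perm (Fin 6)) k = ![0, 2, 1, 3, 5, 4] k := by decide
    simp only [e]; exact ⟨b, a, d, c⟩

lemma uni_conj {f : Fin 6 → ℂ} (hu : Uni f) : Uni (fun k => (starRingEnd ℂ) (f k)) := by
  intro k; simpa using hu k

lemma uni_mul {f g : Fin 6 → ℂ} (hu : Uni f) (hv : Uni g) : Uni (fun k => f k * g k) := by
  intro k; simp [hu k, hv k]

lemma uni_comp {f : Fin 6 → ℂ} (hu : Uni f) (e : Equiv.Perm (Fin 6)) : Uni (fun k => f (e k)) :=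
  fun k => hu (e k)

lemma bin_conj {f : Fin 6 → ℂ} (hf : Bin f) : Bin (fun k => (starRingEnd ℂ) (f k)) := by
  obtain ⟨σ, hσ⟩ := hf
  exact ⟨σ, fun k => by simp [hσ]⟩

lemma ter_conj {f : Fin 6 → ℂ} (hu : Uni f) (hf : Ter f) :
    Ter (fun k => (starRingEnd ℂ) (f k)) := by
  obtain ⟨e, h1, h2, h3, h4⟩ := hf
  apply ter_comp' e
  apply ter_of_sums (fun k => by simpa using hu (e k))
  · rw [← map_add, ← map_add, h1, h2]
    have : f (e 0) + ω * f (e 0) + ω ^ 2 * f (e 0) = 0 := by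
      linear_combination f (e 0) * om_sq_add
    rw [this, map_zero]
  · rw [← map_add, ← map_add, h3, h4]
    have : f (e 3) + ω * f (e 3) + ω ^ 2 * f (e 3) = 0 := by
      linear_combination f (e 3) * om_sq_add
    rw [this, map_zero]

lemma three_conj {f : Fin 6 → ℂ} (hf : Three (fun k => (starRingEnd ℂ) (f k))) : Three f := by
  obtain ⟨k, l, m, h1, h2, h3, h4, h5⟩ := hf
  exact ⟨k, l, m, h1, h2, h3, (starRingEnd ℂ).injective h4, (starRingEnd ℂ).injective h5⟩

/-- conclusion of the analysis of binary-ternary-ternary triples -/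
def Concl (b c : Fin 6 → ℂ) : Prop :=
  Three b ∨ (Ter b ∧ (∃ κ : ℂ, ∀ k, b k ^ 3 = κ ∨ b k ^ 3 = -κ) ∧
    ∀ k l, b k ^ 3 = b l ^ 3 → c k * b k = c l * b l)

lemma concl_comp {b c : Fin 6 → ℂ} (e : Equiv.Perm (Fin 6))
    (h : Concl (fun k => b (e k)) (fun k => c (e k))) : Concl b c := by
  rcases h with h | ⟨h1, ⟨κ, h2⟩, h3⟩
  · exact Or.inl (three_comp e h)
  · refine Or.inr ⟨ter_comp' e h1, ⟨κ, fun k => ?_⟩, fun k l => ?_⟩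
    · simpa using h2 (e.symm k)
    · simpa using h3 (e.symm k) (e.symm l)

lemma concl_swap {b c d : Fin 6 → ℂ} (hb : Uni b) (hcd : ∀ k, c k = b k * d k)
    (h : Concl (fun k => (starRingEnd ℂ) (b k)) d) : Concl b c := by
  rcases h with h | ⟨h1, ⟨κ, h2⟩, h3⟩
  · exact Or.inl (three_conj h)
  · refine Or.inr ⟨?_, ⟨(starRingEnd ℂ) κ, fun k => ?_⟩, fun k l hkl => ?_⟩
    · simpa using ter_conj (uni_conj hb) h1
    · rcases h2 k with h | h
      · left; have := congrArg (starRingEnd ℂ) h; simpa using this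
      · right; have := congrArg (starRingEnd ℂ) h; simpa using this
    · have h4 := h3 k l (by rw [← map_pow, hkl, map_pow])
      rw [hcd, hcd]
      have e1 := conj_mul_of (hb k)
      have e2 := conj_mul_of (hb l)
      linear_combination (b k ^ 3) * h4 - d k * b k ^ 2 * e1 + d l * b l ^ 2 * e2
        + d l * (starRingEnd ℂ) (b l) * hkl

/-- helper to conclude once `b` has zero sums on both halves -/
lemma concl_mk {b c : Fin 6 → ℂ} (hb : Uni b)
    (h1 : b 1 = ω ^ 2 * b 0) (h2 : b 2 = ω * b 0) (h3 : b 4 = ω ^ 2 * b 3) (h4 : b 5 = ω * b 3)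
    (h5 : b 0 ^ 3 + b 3 ^ 3 = 0)
    (c1 : c 1 = ω * c 0) (c2 : c 2 = ω ^ 2 * c 0) (c4 : c 4 = ω * c 3) (c5 : c 5 = ω ^ 2 * c 3) :
    Concl b c := by
  have hw := om_sq_add
  have hc := om_cube
  have e1 : b 1 ^ 3 = b 0 ^ 3 := by rw [h1]; linear_combination b 0 ^ 3 * (ω ^ 3 + 1) * hc
  have e2 : b 2 ^ 3 = b 0 ^ 3 := by rw [h2]; linear_combination b 0 ^ 3 * hc
  have e3 : b 3 ^ 3 = - b 0 ^ 3 := by linear_combination h5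
  have e4 : b 4 ^ 3 = - b 0 ^ 3 := by
    rw [h3]; linear_combination b 3 ^ 3 * (ω ^ 3 + 1) * hc + h5
  have e5 : b 5 ^ 3 = - b 0 ^ 3 := by rw [h4]; linear_combination b 3 ^ 3 * hc + h5
  have n0 : b 0 ^ 3 ≠ - b 0 ^ 3 := by
    intro h
    have : b 0 ^ 3 = 0 := by linear_combination h / 2
    exact ne_of (hb 0) (by simpa using this)
  have n1 := n0.symm
  have f1 : c 1 * b 1 = c 0 * b 0 := by rw [h1, c1]; linear_combination c 0 * b 0 * hc
  have f2 : c 2 * b 2 = c 0 * b 0 := by rw [h2, c2]; linear_combination c 0 * b 0 * hc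
  have f4 : c 4 * b 4 = c 3 * b 3 := by rw [h3, c4]; linear_combination c 3 * b 3 * hc
  have f5 : c 5 * b 5 = c 3 * b 3 := by rw [h4, c5]; linear_combination c 3 * b 3 * hc
  refine Or.inr ⟨?_, ⟨b 0 ^ 3, ?_⟩, ?_⟩
  · apply ter_of_sums hb
    · rw [h1, h2]; linear_combination b 0 * hw
    · rw [h3, h4]; linear_combination b 3 * hw
  · intro k
    fin_cases k <;> simp [e1, e2, e3, e4, e5]
  · intro k l
    fin_cases k <;> fin_cases l <;> simp [e1, e2, e3, e4, e5, f1, f2, f4, f5, n0, n1]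

/-- triple version -/
lemma triple_div {b0 b1 b2 c0 c1 c2 d0 d1 d2 : ℂ} (u0 : ‖d0‖ = 1) (u1 : ‖d1‖ = 1) (u2 : ‖d2‖ = 1)
    (e0 : c0 = b0 * d0) (e1 : c1 = b1 * d1) (e2 : c2 = b2 * d2)
    (hc1 : c1 = ω * c0) (hc2 : c2 = ω ^ 2 * c0) (hd : d0 + d1 + d2 = 0) :
    (b0 = b1 ∧ b0 = b2) ∨ (b1 = ω ^ 2 * b0 ∧ b2 = ω * b0) := by
  have n0 := ne_of u0
  have nw := ne_of om_norm
  have hc := om_cube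
  rcases z3 u0 u1 u2 hd with ⟨a, b⟩ | ⟨a, b⟩
  · left
    constructor
    · apply mul_right_cancel₀ (mul_ne_zero nw n0)
      linear_combination -ω * e0 + e1 - hc1 + b1 * a
    · apply mul_right_cancel₀ (mul_ne_zero (pow_ne_zero 2 nw) n0)
      linear_combination -ω ^ 2 * e0 + e2 - hc2 + b2 * b
  · right
    constructor
    · apply mul_right_cancel₀ (mul_ne_zero (pow_ne_zero 2 nw) n0)
      linear_combination ω * e0 - e1 + hc1 - b1 * a - ω * b0 * d0 * hc
    · apply mul_right_cancel₀ (mul_ne_zero nw n0)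
      linear_combination ω ^ 2 * e0 - e2 + hc2 - b2 * b

lemma three_mk {f : Fin 6 → ℂ} (h1 : f 0 = f 1) (h2 : f 0 = f 2) : Three f :=
  ⟨0, 1, 2, by decide, by decide, by decide, h1, h2⟩

/-- case (iii) -/
lemma case_iii {b c d : Fin 6 → ℂ} (hb : Uni b) (hd : Uni d)
    (hcd : ∀ k, c k = b k * d k) (c1 : c 1 = ω * c 0) (c2 : c 2 = ω ^ 2 * c 0)
    (c4 : c 4 = ω * c 3) (c5 : c 5 = ω ^ 2 * c 3) (hB : Bin b)
    (d1 : d 0 + d 1 + d 2 = 0) (d2 : d 3 + d 4 + d 5 = 0) : Concl b c := by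
  have s1 := bin_pow hB 1 (by decide)
  have s3 := bin_pow hB 3 (by decide)
  have hw := om_sq_add
  have hc := om_cube
  rcases triple_div (hd 0) (hd 1) (hd 2) (hcd 0) (hcd 1) (hcd 2) c1 c2 d1 with ⟨p, q⟩ | ⟨p, q⟩
  · exact Or.inl (three_mk p q)
  rcases triple_div (hd 3) (hd 4) (hd 5) (hcd 3) (hcd 4) (hcd 5) c4 c5 d2 with ⟨p', q'⟩ | ⟨p', q'⟩
  · exact Or.inl ⟨3, 4, 5, by decide, by decide, by decide, p', q'⟩
  · refine concl_mk hb p q p' q' ?_ c1 c2 c4 c5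
    rw [p, q, p', q'] at s3
    linear_combination s3 / 3 - (b 0 ^ 3 + b 3 ^ 3) * (ω ^ 3 + 2) / 3 * hc

/-- powers of `ω` indexed by residues, with integer coordinates in the basis `1, ω` -/
noncomputable def ww (a : Fin 3) : ℂ := ![1, ω, ω ^ 2] a
def wX (a : Fin 3) : ℤ := ![1, 0, -1] a
def wY (a : Fin 3) : ℤ := ![0, 1, -1] a

lemma ww_eq (a : Fin 3) : ww a = (wX a : ℂ) + (wY a : ℂ) * ω := by
  fin_cases a <;> simp [ww, wX, wY, om_sq]; ring

lemma ww_mul (a b : Fin 3) : ww a * ww b = ww (a + b) := by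
  have hc := om_cube
  fin_cases a <;> fin_cases b <;> simp [ww] <;>
    first
    | ring1
    | linear_combination hc
    | linear_combination ω * hc

lemma ww_conj (a : Fin 3) : (starRingEnd ℂ) (ww a) = ww (-a) := by
  have hc := om_cube
  fin_cases a <;> simp [ww, om_conj]
  linear_combination ω * hc

lemma ww_cube {x y : ℂ} (h : x ^ 3 = y ^ 3) : ∃ a : Fin 3, x = ww a * y := by
  rcases cube_eq h with h | h | h
  · exact ⟨0, by simp [ww, h]⟩
  · exact ⟨1, by simp [ww, h]⟩
  · exact ⟨2, by simp [ww, h]⟩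

set_option maxRecDepth 100000 in
lemma finite_check : ∀ e1 e2 e3 e4 e5 : Fin 3,
    1 + wX e1 + wX e2 + wX e3 + wX e4 + wX e5 = 0 →
    wY e1 + wY e2 + wY e3 + wY e4 + wY e5 = 0 → ∀ t : Fin 3,
    wX 0 + wX (1 - e1) + wX (2 - e2) - wX (t - e3) - wX (t + 1 - e4) - wX (t + 2 - e5) = 0 →
    wY 0 + wY (1 - e1) + wY (2 - e2) - wY (t - e3) - wY (t + 1 - e4) - wY (t + 2 - e5) = 0 →
    (1 - e1 = 0 ∧ 2 - e2 = 0) ∨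
    (1 - e1 = 2 ∧ 2 - e2 = 1 ∧ t + 1 - e4 = 2 + (t - e3) ∧ t + 2 - e5 = 1 + (t - e3)) := by
  decide

/-- case (i): all cubes of `d` agree -/
lemma case_i {b c d : Fin 6 → ℂ} (hb : Uni b) (hd : Uni d) (hcu : Uni c)
    (hcd : ∀ k, c k = b k * d k) (c1 : c 1 = ω * c 0) (c2 : c 2 = ω ^ 2 * c 0)
    (c4 : c 4 = ω * c 3) (c5 : c 5 = ω ^ 2 * c 3) (hB : Bin b)
    (hds : d 0 + d 1 + d 2 + d 3 + d 4 + d 5 = 0)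
    (hdc : ∀ k, d k ^ 3 = d 0 ^ 3) : Concl b c := by
  have s1 := bin_pow hB 1 (by decide)
  have s3 := bin_pow hB 3 (by decide)
  have hw := om_sq_add
  have hc := om_cube
  have n0 := ne_of (hd 0)
  have hbk : ∀ k, b k * d 0 ^ 3 * 1 = b k * d k ^ 3 := fun k => by rw [hdc k, mul_one]
  have hb3 : ∀ k, b k ^ 3 * d 0 ^ 3 = c k ^ 3 := fun k => by
    rw [hcd k, ← hdc k]; ring
  have hX : c 3 ^ 3 = (- c 0) ^ 3 := by
    have : c 0 ^ 3 + c 1 ^ 3 + c 2 ^ 3 + c 3 ^ 3 + c 4 ^ 3 + c 5 ^ 3 = 0 := by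
      rw [← hb3, ← hb3, ← hb3, ← hb3, ← hb3, ← hb3]
      linear_combination d 0 ^ 3 * s3
    rw [c1, c2, c4, c5] at this
    linear_combination this / 3 - (c 0 ^ 3 + c 3 ^ 3) * (ω ^ 3 + 2) / 3 * hc
  obtain ⟨t, ht⟩ := ww_cube hX
  choose e he using fun k => ww_cube (hdc k)
  have hcoef : ∀ k, b k = c k * (starRingEnd ℂ) (d 0) * ww (- e k) := by
    intro k
    have h1 := conj_mul_of (hd k)
    have h2 : (starRingEnd ℂ) (d k) = ww (- e k) * (starRingEnd ℂ) (d 0) := by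
      conv_lhs => rw [he k]
      rw [map_mul, ww_conj]
    rw [h2] at h1
    rw [hcd k]
    linear_combination -b k * h1
  set K := c 0 * (starRingEnd ℂ) (d 0) with hK
  have nK : K ≠ 0 := mul_ne_zero (ne_of (hcu 0)) (ne_of (by simpa using hd 0))
  have w1 : ω = ww 1 := by simp [ww]
  have w2 : ω ^ 2 = ww 2 := by simp [ww]
  have b0 : b 0 = K := by
    have := hcd 0
    rw [hK, this]; linear_combination -b 0 * conj_mul_of (hd 0)
  have b1 : b 1 = K * ww (1 - e 1) := by
    rw [hcoef 1, c1, w1, sub_eq_add_neg, ← ww_mul]; ring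
  have b2 : b 2 = K * ww (2 - e 2) := by
    rw [hcoef 2, c2, w2, sub_eq_add_neg, ← ww_mul]; ring
  have b3 : b 3 = - (K * ww (t - e 3)) := by
    rw [hcoef 3, ht, sub_eq_add_neg, ← ww_mul]; ring
  have b4 : b 4 = - (K * ww (t + 1 - e 4)) := by
    rw [hcoef 4, c4, ht, w1, sub_eq_add_neg, ← ww_mul, ← ww_mul]; ring
  have b5 : b 5 = - (K * ww (t + 2 - e 5)) := by
    rw [hcoef 5, c5, ht, w2, sub_eq_add_neg, ← ww_mul, ← ww_mul]; ring
  have A1 : (1:ℂ) + ww (e 1) + ww (e 2) + ww (e 3) + ww (e 4) + ww (e 5) = 0 := by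
    apply mul_right_cancel₀ n0
    rw [he 1, he 2, he 3, he 4, he 5] at hds
    linear_combination hds
  have A2 : ww 0 + ww (1 - e 1) + ww (2 - e 2) - ww (t - e 3) - ww (t + 1 - e 4)
      - ww (t + 2 - e 5) = 0 := by
    apply mul_left_cancel₀ nK
    have : ww 0 = 1 := by simp [ww]
    rw [b0, b1, b2, b3, b4, b5] at s1
    rw [this]
    linear_combination s1
  simp only [ww_eq] at A1 A2
  have B1 := om_indep (1 + wX (e 1) + wX (e 2) + wX (e 3) + wX (e 4) + wX (e 5))
    (wY (e 1) + wY (e 2) + wY (e 3) + wY (e 4) + wY (e 5))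
    (by push_cast; linear_combination A1)
  have B2 := om_indep (wX 0 + wX (1 - e 1) + wX (2 - e 2) - wX (t - e 3) - wX (t + 1 - e 4)
      - wX (t + 2 - e 5)) (wY 0 + wY (1 - e 1) + wY (2 - e 2) - wY (t - e 3) - wY (t + 1 - e 4)
      - wY (t + 2 - e 5)) (by push_cast; linear_combination A2)
  rcases finite_check _ _ _ _ _ B1.1 B1.2 t B2.1 B2.2 with ⟨p, q⟩ | ⟨p, q, r, s⟩
  · left
    apply three_mk
    · rw [b0, b1, p]; simp [ww]
    · rw [b0, b2, q]; simp [ww]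
  · refine concl_mk hb ?_ ?_ ?_ ?_ ?_ c1 c2 c4 c5
    · rw [b0, b1, p, w2]; ring
    · rw [b0, b2, q, w1]; ring
    · rw [b3, b4, r, w2, ← ww_mul]; ring
    · rw [b3, b5, s, w1, ← ww_mul]; ring
    · have h1 := hb3 0
      have h2 := hb3 3
      apply mul_right_cancel₀ (pow_ne_zero 3 n0)
      linear_combination h1 + h2 + hX

lemma half_dis (a b c : Fin 6) (ha : 3 ≤ a) (hb : 3 ≤ b) (hc : 3 ≤ c) (h1 : a ≠ b) (h2 : a ≠ c)
    (h3 : b ≠ c) (f : Fin 6 → ℂ) :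
    f a + f b + f c = f 3 + f 4 + f 5 ∧ f a * f b * f c = f 3 * f 4 * f 5 := by
  have key : ∀ a : Fin 6, 3 ≤ a → a = 3 ∨ a = 4 ∨ a = 5 := by decide
  rcases key a ha with rfl | rfl | rfl <;> rcases key b hb with rfl | rfl | rfl <;>
    rcases key c hc with rfl | rfl | rfl <;> first
    | exact absurd rfl h1
    | exact absurd rfl h2
    | exact absurd rfl h3
    | (constructor <;> ring)

set_option maxHeartbeats 1000000 in
/-- the main computation for binary-ternary-ternary, `m ≥ 2` -/
lemma btt_core {b c d : Fin 6 → ℂ} (hb : Uni b) (hd : Uni d) (hcu : Uni c)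
    (hcd : ∀ k, c k = b k * d k) (c1 : c 1 = ω * c 0) (c2 : c 2 = ω ^ 2 * c 0)
    (c4 : c 4 = ω * c 3) (c5 : c 5 = ω ^ 2 * c 3) (hB : Bin b)
    (e : Equiv.Perm (Fin 6)) (d1 : d (e 1) = ω * d (e 0)) (d2 : d (e 2) = ω ^ 2 * d (e 0))
    (d4 : d (e 4) = ω * d (e 3)) (d5 : d (e 5) = ω ^ 2 * d (e 3))
    (hm : (e.symm 0 < 3 ∧ e.symm 1 < 3) ∨ (e.symm 0 < 3 ∧ e.symm 2 < 3) ∨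
      (e.symm 1 < 3 ∧ e.symm 2 < 3)) : Concl b c := by
  have hw := om_sq_add
  have hc := om_cube
  have hT : Ter d := ⟨e, d1, d2, d4, d5⟩
  have hds := ter_sum hT
  have s3 := bin_pow hB 3 (by decide)
  have s9 := bin_pow hB 9 (by decide)
  -- values of the inverse cubes of `d`
  set P := (starRingEnd ℂ) (d (e 0)) ^ 3 with hP
  set Q := (starRingEnd ℂ) (d (e 3)) ^ 3 with hQ
  have nP : P ≠ 0 := pow_ne_zero 3 (ne_of (by simpa using hd (e 0)))
  have nQ : Q ≠ 0 := pow_ne_zero 3 (ne_of (by simpa using hd (e 3)))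
  set D : Fin 6 → ℂ := fun k => (starRingEnd ℂ) (d k) ^ 3 with hD
  have D0 : D (e 0) = P := rfl
  have D3 : D (e 3) = Q := rfl
  have D1 : D (e 1) = P := by
    simp only [hD, hP, d1, map_mul, om_conj]
    linear_combination (starRingEnd ℂ) (d (e 0)) ^ 3 * (ω ^ 3 + 1) * hc
  have D2 : D (e 2) = P := by
    simp only [hD, hP, d2, map_mul, map_pow, om_conj]
    linear_combination (starRingEnd ℂ) (d (e 0)) ^ 3 * (ω ^ 9 + ω ^ 6 + ω ^ 3 + 1) * hc
  have D4 : D (e 4) = Q := by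
    simp only [hD, hQ, d4, map_mul, om_conj]
    linear_combination (starRingEnd ℂ) (d (e 3)) ^ 3 * (ω ^ 3 + 1) * hc
  have D5 : D (e 5) = Q := by
    simp only [hD, hQ, d5, map_mul, map_pow, om_conj]
    linear_combination (starRingEnd ℂ) (d (e 3)) ^ 3 * (ω ^ 9 + ω ^ 6 + ω ^ 3 + 1) * hc
  have DP : ∀ k, e.symm k < 3 → D k = P := by
    intro k hk
    obtain ⟨l, rfl⟩ := e.surjective k
    rw [Equiv.symm_apply_apply] at hk
    have : ∀ l : Fin 6, l < 3 → l = 0 ∨ l = 1 ∨ l = 2 := by decide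
    rcases this l hk with rfl | rfl | rfl <;> assumption
  have DQ : ∀ k, ¬ e.symm k < 3 → D k = Q := by
    intro k hk
    obtain ⟨l, rfl⟩ := e.surjective k
    rw [Equiv.symm_apply_apply] at hk
    have : ∀ l : Fin 6, ¬ l < 3 → l = 3 ∨ l = 4 ∨ l = 5 := by decide
    rcases this l hk with rfl | rfl | rfl <;> assumption
  have tot := sum_perm D e
  have tot3 := sum_perm (fun k => D k ^ 3) e
  simp only [D0, D1, D2, D3, D4, D5] at tot tot3
  have hdb : ∀ k, b k ^ 3 = c k ^ 3 * D k := by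
    intro k
    have h1 : b k = c k * (starRingEnd ℂ) (d k) := by
      rw [hcd k]; linear_combination -b k * conj_mul_of (hd k)
    simp only [hD]; rw [h1]; ring
  have hdb9 : ∀ k, b k ^ 9 = c k ^ 9 * D k ^ 3 := by
    intro k
    have : b k ^ 9 = (b k ^ 3) ^ 3 := by ring
    rw [this, hdb]; ring
  have cube_back : ∀ k l, D k = D l → d k ^ 3 = d l ^ 3 := by
    intro k l h
    have := congrArg (starRingEnd ℂ) h
    simpa [hD] using this
  set X := c 0 ^ 3 with hX
  set Y := c 3 ^ 3 with hY
  have nX : X ≠ 0 := pow_ne_zero 3 (ne_of (hcu 0))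
  have nY : Y ≠ 0 := pow_ne_zero 3 (ne_of (hcu 3))
  have X1 : c 1 ^ 3 = X := by rw [c1]; linear_combination c 0 ^ 3 * hc
  have X2 : c 2 ^ 3 = X := by rw [c2]; linear_combination c 0 ^ 3 * (ω ^ 3 + 1) * hc
  have X4 : c 4 ^ 3 = Y := by rw [c4]; linear_combination c 3 ^ 3 * hc
  have X5 : c 5 ^ 3 = Y := by rw [c5]; linear_combination c 3 ^ 3 * (ω ^ 3 + 1) * hc
  have S3 : X * (D 0 + D 1 + D 2) + Y * (D 3 + D 4 + D 5) = 0 := by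
    rw [hdb, hdb, hdb, hdb, hdb, hdb, X1, X2, X4, X5] at s3
    linear_combination s3
  have p9 : ∀ z : ℂ, z ^ 9 = (z ^ 3) ^ 3 := fun z => by ring
  have S9 : X ^ 3 * (D 0 ^ 3 + D 1 ^ 3 + D 2 ^ 3) + Y ^ 3 * (D 3 ^ 3 + D 4 ^ 3 + D 5 ^ 3) = 0 := by
    rw [hdb9, hdb9, hdb9, hdb9, hdb9, hdb9, p9 (c 0), p9 (c 1), p9 (c 2), p9 (c 3), p9 (c 4),
      p9 (c 5), X1, X2, X4, X5] at s9
    linear_combination s9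
  -- case (i) and case (ii)
  have hi : P = Q → Concl b c := by
    intro hPQ
    have hall : ∀ k, D k = P := by
      intro k
      by_cases h : e.symm k < 3
      · exact DP k h
      · rw [DQ k h, hPQ]
    exact case_i hb hd hcu hcd c1 c2 c4 c5 hB hds
      (fun k => cube_back k 0 (by rw [hall, hall]))
  have hii : X = Y → Concl b c := by
    intro hXY
    apply concl_swap hb hcd
    apply concl_comp e
    have hall : ∀ k, c k ^ 3 = X := by
      intro k
      fin_cases k
      · rfl
      · exact X1
      · exact X2
      · exact hXY.symm
      · exact X4.trans hXY.symm
      · exact X5.trans hXY.symm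
    apply case_i (c := fun k => d (e k)) (d := fun k => c (e k)) (uni_comp (uni_conj hb) e)
      (uni_comp hcu e) (uni_comp hd e) ?_ d1 d2 d4 d5 (bin_comp (bin_conj hB) e) ?_
      (fun k => by simp only [hall])
    · intro k
      show d (e k) = (starRingEnd ℂ) (b (e k)) * c (e k)
      rw [hcd]; linear_combination -d (e k) * conj_mul_of (hb (e k))
    · rw [sum_perm c e]
      exact ter_sum ⟨1, c1, c2, c4, c5⟩
  -- the case m = 2
  have two : D 0 + D 1 + D 2 = 2 * P + Q → D 0 ^ 3 + D 1 ^ 3 + D 2 ^ 3 = 2 * P ^ 3 + Q ^ 3 →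
      Concl b c := by
    intro h1 h3
    have h1' : D 3 + D 4 + D 5 = P + 2 * Q := by linear_combination -tot - h1
    have h3' : D 3 ^ 3 + D 4 ^ 3 + D 5 ^ 3 = P ^ 3 + 2 * Q ^ 3 := by
      linear_combination -tot3 - h3
    rw [h1, h1'] at S3
    rw [h3, h3'] at S9
    have hY3 : Y ^ 3 * (P + 2 * Q) ^ 3 = - X ^ 3 * (2 * P + Q) ^ 3 := by
      have : Y * (P + 2 * Q) = - (X * (2 * P + Q)) := by linear_combination S3
      calc Y ^ 3 * (P + 2 * Q) ^ 3 = (Y * (P + 2 * Q)) ^ 3 := by ring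
        _ = _ := by rw [this]; ring
    have hfin : X ^ 3 * ((P - Q) * (P + Q)) ^ 3 = 0 := by
      linear_combination (-1/6 : ℂ) * (P + 2 * Q) ^ 3 * S9 + (1/6 : ℂ) * (P ^ 3 + 2 * Q ^ 3) * hY3
    have h4 : (P - Q) * (P + Q) = 0 := by
      rcases mul_eq_zero.1 hfin with h | h
      · exact absurd h (pow_ne_zero 3 nX)
      · simpa using h
    rcases mul_eq_zero.1 h4 with h5 | h5
    · exact hi (by linear_combination h5)
    · apply hii
      have hQP : Q = -P := by linear_combination h5
      rw [hQP] at S3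
      apply mul_right_cancel₀ nP
      linear_combination S3
  by_cases t0 : e.symm 0 < 3 <;> by_cases t1 : e.symm 1 < 3 <;> by_cases t2 : e.symm 2 < 3
  · -- m = 3
    have g3 : ∀ k, ¬ k < 3 → 3 ≤ e k := by
      intro k hk
      by_contra h
      push Not at h
      have : ∀ l : Fin 6, l < 3 → l = 0 ∨ l = 1 ∨ l = 2 := by decide
      rcases this _ h with h | h | h
      · rw [← h] at t0; simp at t0; exact hk t0
      · rw [← h] at t1; simp at t1; exact hk t1
      · rw [← h] at t2; simp at t2; exact hk t2
    have hh := (half_dis (e 3) (e 4) (e 5) (g3 3 (by decide)) (g3 4 (by decide)) (g3 5 (by decide))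
      (by simp) (by simp) (by simp) d).1
    have hz : d 3 + d 4 + d 5 = 0 := by
      rw [← hh, d4, d5]; linear_combination d (e 3) * hw
    exact case_iii hb hd hcd c1 c2 c4 c5 hB (by linear_combination hds - hz) hz
  · apply two
    · rw [DP 0 t0, DP 1 t1, DQ 2 t2]; ring
    · rw [DP 0 t0, DP 1 t1, DQ 2 t2]; ring
  · apply two
    · rw [DP 0 t0, DQ 1 t1, DP 2 t2]; ring
    · rw [DP 0 t0, DQ 1 t1, DP 2 t2]; ring
  · exfalso; tauto
  · apply two
    · rw [DQ 0 t0, DP 1 t1, DP 2 t2]; ring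
    · rw [DQ 0 t0, DP 1 t1, DP 2 t2]; ring
  all_goals exfalso; tauto

/-- exchange of the two halves -/
def flip6 : Equiv.Perm (Fin 6) := Equiv.addRight 3

lemma flip6_apply (k : Fin 6) : flip6 k = k + 3 := rfl

/-- binary-ternary-ternary triples -/
lemma btt {b c d : Fin 6 → ℂ} (hb : Uni b) (hd : Uni d) (hcu : Uni c)
    (hcd : ∀ k, c k = b k * d k) (hB : Bin b) (hc : Ter c) (hT : Ter d) : Concl b c := by
  obtain ⟨e, c1, c2, c4, c5⟩ := hc
  apply concl_comp e
  obtain ⟨e', d1, d2, d4, d5⟩ := ter_comp hT e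
  by_cases hm : (e'.symm 0 < 3 ∧ e'.symm 1 < 3) ∨ (e'.symm 0 < 3 ∧ e'.symm 2 < 3) ∨
      (e'.symm 1 < 3 ∧ e'.symm 2 < 3)
  · exact btt_core (uni_comp hb e) (uni_comp hd e) (uni_comp hcu e) (fun k => hcd (e k))
      c1 c2 c4 c5 (bin_comp hB e) e' d1 d2 d4 d5 hm
  · refine btt_core (uni_comp hb e) (uni_comp hd e) (uni_comp hcu e) (fun k => hcd (e k))
      c1 c2 c4 c5 (bin_comp hB e) (flip6.trans e') d4 d5 d1 d2 ?_
    have : ∀ k, flip6.symm k < 3 ↔ ¬ k < 3 := by decide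
    simp only [Equiv.symm_trans_apply, this]
    tauto

/-- a bijection flipping sign cannot preserve a half with zero cube sum -/
lemma half_prod {g : Fin 6 → ℂ} (hg : Uni g) (hB : Bin g)
    (h1 : g 0 ^ 3 + g 1 ^ 3 + g 2 ^ 3 = 0) : g 3 * g 4 * g 5 = - (g 0 * g 1 * g 2) := by
  obtain ⟨σ, hσ⟩ := hB
  have n : ∀ k, g k ^ 3 ≠ 0 := fun k => pow_ne_zero 3 (ne_of (hg k))
  have h3 : ∀ k, g (σ k) ^ 3 = - g k ^ 3 := fun k => by rw [hσ]; ring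
  have hlt : ∀ l : Fin 6, l < 3 → l = 0 ∨ l = 1 ∨ l = 2 := by decide
  have key : ∀ k l : Fin 6, k < 3 → l < 3 → g l ^ 3 ≠ - g k ^ 3 := by
    intro k l hk hl h
    have n0 := n 0
    have n1 := n 1
    have n2 := n 2
    rcases hlt k hk with rfl | rfl | rfl <;> rcases hlt l hl with rfl | rfl | rfl
    · apply n0; linear_combination h / 2
    · apply n2; linear_combination h1 - h
    · apply n1; linear_combination h1 - h
    · apply n2; linear_combination h1 - h
    · apply n1; linear_combination h / 2
    · apply n0; linear_combination h1 - h
    · apply n1; linear_combination h1 - h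
    · apply n0; linear_combination h1 - h
    · apply n2; linear_combination h / 2
  have hs : ∀ k : Fin 6, k < 3 → 3 ≤ σ k := by
    intro k hk
    by_contra h
    exact key k (σ k) hk (not_le.1 h) (h3 k)
  have hh := (half_dis (σ 0) (σ 1) (σ 2) (hs 0 (by decide)) (hs 1 (by decide)) (hs 2 (by decide))
      (by simp) (by simp) (by simp) g).2
  rw [← hh, hσ, hσ, hσ]; ring

/-- conclusion of the binary-binary-ternary analysis -/
def Concl2 (f g : Fin 6 → ℂ) : Prop :=
  (∀ k, ∃ l, l ≠ k ∧ f l = f k) ∧ (∀ k l, k ≠ l → f k = f l → g k = - g l)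

lemma concl2_comp {f g : Fin 6 → ℂ} (e : Equiv.Perm (Fin 6))
    (h : Concl2 (fun k => f (e k)) (fun k => g (e k))) : Concl2 f g := by
  refine ⟨fun k => ?_, fun k l hkl => ?_⟩
  · obtain ⟨l, h1, h2⟩ := h.1 (e.symm k)
    refine ⟨e l, fun h3 => h1 (by simp [← h3]), by simpa using h2⟩
  · have := h.2 (e.symm k) (e.symm l) (by simpa using hkl)
    simpa using this

lemma om_sq_ne_one : ω ^ 2 ≠ 1 := by
  intro h
  have hc := om_cube
  exact om_ne_one (by linear_combination hc - ω * h)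

lemma om_sq_ne : ω ^ 2 ≠ ω := by
  intro h
  have hc := om_cube
  exact om_sq_ne_one (by linear_combination hc - ω * h + h - h)

/-- doubled ternary pairs -/
lemma doubled {f g : Fin 6 → ℂ} (hf : Uni f) (hg : Uni g)
    (f1 : f 1 = ω * f 0) (f2 : f 2 = ω ^ 2 * f 0) (f3 : f 3 = f 0) (f4 : f 4 = ω * f 0)
    (f5 : f 5 = ω ^ 2 * f 0) (hs : g 0 + g 1 + g 2 + g 3 + g 4 + g 5 = 0)
    (hs' : g 0 * (starRingEnd ℂ) (f 0) + g 1 * (starRingEnd ℂ) (f 1) + g 2 * (starRingEnd ℂ) (f 2)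
      + g 3 * (starRingEnd ℂ) (f 3) + g 4 * (starRingEnd ℂ) (f 4)
      + g 5 * (starRingEnd ℂ) (f 5) = 0) (hn : ¬ Ter g) : Concl2 f g := by
  have hw := om_sq_add
  have hc := om_cube
  have n0 : (starRingEnd ℂ) (f 0) ≠ 0 := ne_of (by simpa using hf 0)
  have hs2 : (g 0 + g 3) + ω ^ 2 * (g 1 + g 4) + ω * (g 2 + g 5) = 0 := by
    rw [f1, f2, f3, f4, f5] at hs'
    simp only [map_mul, map_pow, om_conj] at hs'
    apply mul_right_cancel₀ n0
    linear_combination hs' - (starRingEnd ℂ) (f 0) * (g 2 + g 5) * ω * hc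
  -- sums over doubled columns
  have t1 : g 1 + g 4 = ω ^ 2 * (g 0 + g 3) := by
    have h : (ω ^ 2 - ω) * (g 1 + g 4 - ω ^ 2 * (g 0 + g 3)) = 0 := by
      linear_combination hs2 - ω * hs - (g 0 + g 3) * (ω - 1) * hc
    rcases mul_eq_zero.1 h with h | h
    · exact absurd (by linear_combination h) om_sq_ne
    · linear_combination h
  have t2 : g 2 + g 5 = ω * (g 0 + g 3) := by
    linear_combination hs - t1 - (g 0 + g 3) * hw
  by_cases hz : g 0 + g 3 = 0
  · rw [hz, mul_zero] at t1 t2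
    have a0 : g 0 = - g 3 := by linear_combination hz
    have a1 : g 1 = - g 4 := by linear_combination t1
    have a2 : g 2 = - g 5 := by linear_combination t2
    have m1 := om_ne_one
    have m2 := om_sq_ne_one
    have m3 := om_sq_ne
    have nf := ne_of (hf 0)
    constructor
    · intro k
      fin_cases k
      · exact ⟨3, by decide, f3⟩
      · exact ⟨4, by decide, by simp [f4, f1]⟩
      · exact ⟨5, by decide, by simp [f5, f2]⟩
      · exact ⟨0, by decide, f3.symm⟩
      · exact ⟨1, by decide, by simp [f4, f1]⟩
      · exact ⟨2, by decide, by simp [f5, f2]⟩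
    · intro k l
      fin_cases k <;> fin_cases l <;>
        simp [f1, f2, f3, f4, f5, a0, a1, a2, m1, m2, m3, m1.symm, m2.symm, m3.symm, nf]
  · exfalso
    apply hn
    have hwn := om_norm
    have r1 := two_sum (u := g 0) (v := g 3) (u' := ω * g 1) (v' := ω * g 4) (hg 0) (hg 3)
      (by simp [hwn, hg 1]) (by simp [hwn, hg 4])
      (by linear_combination -ω * t1 - (g 0 + g 3) * hc) hz
    have r2 := two_sum (u := g 0) (v := g 3) (u' := ω ^ 2 * g 2) (v' := ω ^ 2 * g 5) (hg 0) (hg 3)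
      (by simp [hwn, hg 2]) (by simp [hwn, hg 5])
      (by linear_combination -ω ^ 2 * t2 - (g 0 + g 3) * hc) hz
    have q1 : ∀ x y : ℂ, ω * x = y → x = ω ^ 2 * y := fun x y h => by
      linear_combination -x * hc + ω ^ 2 * h
    have q2 : ∀ x y : ℂ, ω ^ 2 * x = y → x = ω * y := fun x y h => by
      linear_combination -x * hc + ω * h
    rcases r1 with ⟨u1, v1⟩ | ⟨u1, v1⟩ <;> rcases r2 with ⟨u2, v2⟩ | ⟨u2, v2⟩ <;>
      replace u1 := q1 _ _ u1 <;> replace v1 := q1 _ _ v1 <;>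
      replace u2 := q2 _ _ u2 <;> replace v2 := q2 _ _ v2
    · apply ter_of_sums hg
      · linear_combination u1 + u2 + g 0 * hw
      · linear_combination v1 + v2 + g 3 * hw
    · apply ter_comp' (Equiv.swap 2 5)
      have e : ∀ k, Equiv.swap (2 : Fin 6) 5 k = ![0, 1, 5, 3, 4, 2] k := by decide
      apply ter_of_sums (uni_comp hg _)
      · simp only [e]; simp; linear_combination u1 + v2 + g 0 * hw
      · simp only [e]; simp; linear_combination v1 + u2 + g 3 * hw
    · apply ter_comp' (Equiv.swap 1 4)
      have e : ∀ k, Equiv.swap (1 : Fin 6) 4 k = ![0, 4, 2, 3, 1, 5] k := by decide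
      apply ter_of_sums (uni_comp hg _)
      · simp only [e]; simp; linear_combination v1 + u2 + g 0 * hw
      · simp only [e]; simp; linear_combination u1 + v2 + g 3 * hw
    · apply ter_comp' (Equiv.swap 0 3)
      have e : ∀ k, Equiv.swap (0 : Fin 6) 3 k = ![3, 1, 2, 0, 4, 5] k := by decide
      apply ter_of_sums (uni_comp hg _)
      · simp only [e]; simp; linear_combination u1 + u2 + g 3 * hw
      · simp only [e]; simp; linear_combination v1 + v2 + g 0 * hw

/-- binary-binary-ternary triples -/
lemma bbt {f g : Fin 6 → ℂ} (hf : Uni f) (hg : Uni g) (hT : Ter f) (hB : Bin g)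
    (hB' : Bin (fun k => g k * (starRingEnd ℂ) (f k))) (hn : ¬ Ter g) : Concl2 f g := by
  obtain ⟨e, f1, f2, f4, f5⟩ := hT
  apply concl2_comp e
  replace hB := bin_comp hB e
  replace hB' := bin_comp hB' e
  replace hn : ¬ Ter (fun k => g (e k)) := fun h => hn (ter_comp' e h)
  replace hf := uni_comp hf e
  replace hg := uni_comp hg e
  change Bin (fun k => (fun k => g (e k)) k * (starRingEnd ℂ) ((fun k => f (e k)) k)) at hB'
  change (fun k => f (e k)) 1 = ω * (fun k => f (e k)) 0 at f1
  change (fun k => f (e k)) 2 = ω ^ 2 * (fun k => f (e k)) 0 at f2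
  change (fun k => f (e k)) 4 = ω * (fun k => f (e k)) 3 at f4
  change (fun k => f (e k)) 5 = ω ^ 2 * (fun k => f (e k)) 3 at f5
  generalize (fun k => f (e k)) = f at *
  generalize (fun k => g (e k)) = g at *
  have hw := om_sq_add
  have hc := om_cube
  have s1 := bin_pow hB 1 (by decide)
  have s3 := bin_pow hB 3 (by decide)
  have r1 := bin_pow hB' 1 (by decide)
  have r3 := bin_pow hB' 3 (by decide)
  simp only [pow_one] at s1 r1
  set x := (starRingEnd ℂ) (f 0) with hx
  set y := (starRingEnd ℂ) (f 3) with hy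
  have x1 : (starRingEnd ℂ) (f 1) = ω ^ 2 * x := by rw [f1, map_mul, om_conj]
  have x2 : (starRingEnd ℂ) (f 2) = ω * x := by
    rw [f2, map_mul, map_pow, om_conj]; linear_combination ω * x * hc
  have y4 : (starRingEnd ℂ) (f 4) = ω ^ 2 * y := by rw [f4, map_mul, om_conj]
  have y5 : (starRingEnd ℂ) (f 5) = ω * y := by
    rw [f5, map_mul, map_pow, om_conj]; linear_combination ω * y * hc
  have hxy : x ^ 3 = y ^ 3 := by
    rw [x1, x2, y4, y5] at r3
    have h : (g 0 ^ 3 + g 1 ^ 3 + g 2 ^ 3) * (x ^ 3 - y ^ 3) = 0 := by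
      linear_combination r3 - y ^ 3 * s3 - ((g 1 * x) ^ 3 + (g 4 * y) ^ 3) * (ω ^ 3 + 1) * hc
        - ((g 2 * x) ^ 3 + (g 5 * y) ^ 3) * hc
    rcases mul_eq_zero.1 h with h | h
    · have p1 := half_prod hg hB h
      have p2 := half_prod (uni_mul hg (uni_conj hf)) hB' (by
        rw [x1, x2]
        linear_combination x ^ 3 * h + (g 1 * x) ^ 3 * (ω ^ 3 + 1) * hc + (g 2 * x) ^ 3 * hc)
      simp only [← hx, ← hy, x1, x2, y4, y5] at p2
      have nn : g 0 * g 1 * g 2 ≠ 0 := mul_ne_zero (mul_ne_zero (ne_of (hg 0)) (ne_of (hg 1)))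
        (ne_of (hg 2))
      apply mul_left_cancel₀ nn
      linear_combination -y ^ 3 * p1 + p2 + (-g 3 * g 4 * g 5 * y ^ 3 - g 0 * g 1 * g 2 * x ^ 3) * hc
    · linear_combination h
  have hf3 : f 3 ^ 3 = f 0 ^ 3 := by
    have := congrArg (starRingEnd ℂ) hxy
    simp only [hx, hy, map_pow, Complex.conj_conj] at this
    exact this.symm
  rcases cube_eq hf3 with h | h | h
  · rw [h] at f4 f5
    exact doubled hf hg f1 f2 h f4 f5 s1 r1 hn
  · -- f 3 = ω f 0, f 4 = ω² f 0, f 5 = f 0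
    rw [h] at f4 f5
    let e : Equiv.Perm (Fin 6) := Equiv.swap 3 5 * Equiv.swap 4 5
    have he : ∀ k, e k = ![0, 1, 2, 5, 3, 4] k := by decide
    apply concl2_comp e
    have t1 := sum_perm g e
    have t2 := sum_perm (fun k => g k * (starRingEnd ℂ) (f k)) e
    refine doubled (uni_comp hf e) (uni_comp hg e) ?_ ?_ ?_ ?_ ?_ (t1.trans s1) (t2.trans r1)
      (fun h => hn (ter_comp' e h)) <;> simp only [he] <;> simp
    · exact f1
    · exact f2
    · rw [f5]; linear_combination f 0 * hc
    · exact h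
    · rw [f4]; ring
  · rw [h] at f4 f5
    let e : Equiv.Perm (Fin 6) := Equiv.swap 3 4 * Equiv.swap 4 5
    have he : ∀ k, e k = ![0, 1, 2, 4, 5, 3] k := by decide
    apply concl2_comp e
    have t1 := sum_perm g e
    have t2 := sum_perm (fun k => g k * (starRingEnd ℂ) (f k)) e
    refine doubled (uni_comp hf e) (uni_comp hg e) ?_ ?_ ?_ ?_ ?_ (t1.trans s1) (t2.trans r1)
      (fun h => hn (ter_comp' e h)) <;> simp only [he] <;> simp
    · exact f1
    · exact f2
    · rw [f4]; linear_combination f 0 * hc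
    · rw [f5]; linear_combination ω * f 0 * hc
    · exact h

lemma matEquiv_trans {h k l : Matrix (Fin 6) (Fin 6) ℂ} (h1 : MatEquiv h k) (h2 : MatEquiv k l) :
    MatEquiv h l := by
  obtain ⟨σ, τ, a, b, ha, hb, e⟩ := h1
  obtain ⟨σ', τ', a', b', ha', hb', e'⟩ := h2
  refine ⟨σ'.trans σ, τ'.trans τ, fun i => a' i * a (σ' i), fun j => b' j * b (τ' j), ?_, ?_, ?_⟩
  · intro i; simp [ha, ha']
  · intro i; simp [hb, hb']
  · intro i j; rw [e', e]; simp only [Equiv.trans_apply]; ring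

lemma isCHM_equiv {h k : Matrix (Fin 6) (Fin 6) ℂ} (h1 : MatEquiv h k) (hh : IsCHM h) :
    IsCHM k := by
  obtain ⟨σ, τ, a, b, ha, hb, e⟩ := h1
  refine ⟨fun i j => by rw [e]; simp [ha, hb, hh.1], fun i j hij => ?_⟩
  have := hh.2 (σ i) (σ j) (by simpa using hij)
  rw [← Equiv.sum_comp τ] at this
  calc ∑ y, k i y * (starRingEnd ℂ) (k j y)
      = ∑ y, (a i * (starRingEnd ℂ) (a j)) * (h (σ i) (τ y) * (starRingEnd ℂ) (h (σ j) (τ y))) := by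
        apply Finset.sum_congr rfl
        intro y _
        rw [e, e]
        simp only [map_mul]
        have := conj_mul_of (hb y)
        linear_combination (a i * (starRingEnd ℂ) (a j) * h (σ i) (τ y) *
          (starRingEnd ℂ) (h (σ j) (τ y))) * this
    _ = 0 := by rw [← Finset.mul_sum, this, mul_zero]

def RowP (g : Matrix (Fin 6) (Fin 6) ℂ) (x : Fin 6) (t : ℂ) : Prop :=
  g x 1 = ω ∧ g x 2 = ω ^ 2 ∧ g x 3 = t ∧ g x 4 = ω * t ∧ g x 5 = ω ^ 2 * t

def RowM (g : Matrix (Fin 6) (Fin 6) ℂ) (x : Fin 6) (t : ℂ) : Prop :=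
  g x 1 = ω ^ 2 ∧ g x 2 = ω ∧ g x 3 = t ∧ g x 4 = ω ^ 2 * t ∧ g x 5 = ω * t

lemma row_orth {g : Matrix (Fin 6) (Fin 6) ℂ} (hg : IsCHM g) (c0 : ∀ x, g x 0 = 1)
    {x y : Fin 6} (hxy : x ≠ y) :
    1 + g x 1 * (starRingEnd ℂ) (g y 1) + g x 2 * (starRingEnd ℂ) (g y 2) +
      g x 3 * (starRingEnd ℂ) (g y 3) + g x 4 * (starRingEnd ℂ) (g y 4) +
      g x 5 * (starRingEnd ℂ) (g y 5) = 0 := by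
  have := hg.2 x y hxy
  simpa [Fin.sum_univ_six, c0] using this

lemma unit_neg {u v : ℂ} (hv : ‖v‖ = 1) (h : 3 + 3 * (u * (starRingEnd ℂ) v) = 0) : u = -v := by
  have := conj_mul_of hv
  linear_combination (1/3) * v * h - u * this

lemma rowPP {g : Matrix (Fin 6) (Fin 6) ℂ} (hg : IsCHM g) (c0 : ∀ x, g x 0 = 1)
    {x y : Fin 6} (hxy : x ≠ y) {t u : ℂ} (hx : RowP g x t) (hy : RowP g y u) : t = -u := by
  have h := row_orth hg c0 hxy
  obtain ⟨a1, a2, a3, a4, a5⟩ := hx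
  obtain ⟨b1, b2, b3, b4, b5⟩ := hy
  have hu : ‖u‖ = 1 := by rw [← b3]; exact hg.1 _ _
  rw [a1, a2, a3, a4, a5, b1, b2, b3, b4, b5] at h
  simp only [map_mul, map_pow, om_conj] at h
  apply unit_neg hu
  linear_combination h - (1 + t * (starRingEnd ℂ) u) * (om_cube + (ω ^ 3 + 1) * om_cube)

lemma rowMM {g : Matrix (Fin 6) (Fin 6) ℂ} (hg : IsCHM g) (c0 : ∀ x, g x 0 = 1)
    {x y : Fin 6} (hxy : x ≠ y) {t u : ℂ} (hx : RowM g x t) (hy : RowM g y u) : t = -u := by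
  have h := row_orth hg c0 hxy
  obtain ⟨a1, a2, a3, a4, a5⟩ := hx
  obtain ⟨b1, b2, b3, b4, b5⟩ := hy
  have hu : ‖u‖ = 1 := by rw [← b3]; exact hg.1 _ _
  rw [a1, a2, a3, a4, a5, b1, b2, b3, b4, b5] at h
  simp only [map_mul, map_pow, om_conj] at h
  apply unit_neg hu
  linear_combination h - (1 + t * (starRingEnd ℂ) u) * (om_cube + (ω ^ 3 + 1) * om_cube)

lemma row_type {g : Matrix (Fin 6) (Fin 6) ℂ} (hg : IsCHM g) (c0 : ∀ x, g x 0 = 1)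
    (r0 : ∀ y, g 0 y = 1)
    (h3 : g 3 1 = 1 ∧ g 3 2 = 1 ∧ g 3 3 = -1 ∧ g 3 4 = -1 ∧ g 3 5 = -1) (x : Fin 6)
    (hx0 : x ≠ 0) (hx3 : x ≠ 3) :
    ((g x 1 = ω ∧ g x 2 = ω ^ 2) ∨ (g x 1 = ω ^ 2 ∧ g x 2 = ω)) ∧
    ((g x 4 = ω * g x 3 ∧ g x 5 = ω ^ 2 * g x 3) ∨
      (g x 4 = ω ^ 2 * g x 3 ∧ g x 5 = ω * g x 3)) := by
  have e0 := row_orth hg c0 hx0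
  have e3 := row_orth hg c0 hx3
  obtain ⟨q1, q2, q3, q4, q5⟩ := h3
  simp only [r0, q1, q2, q3, q4, q5, map_one, map_neg] at e0 e3
  have s1 : (1 : ℂ) + g x 1 + g x 2 = 0 := by linear_combination (1/2) * e0 + (1/2) * e3
  have s2 : g x 3 + g x 4 + g x 5 = 0 := by linear_combination (1/2) * e0 - (1/2) * e3
  have z1 := z3 (by simp) (hg.1 x 1) (hg.1 x 2) s1
  have z2 := z3 (hg.1 x 3) (hg.1 x 4) (hg.1 x 5) s2
  simp only [mul_one] at z1
  exact ⟨z1, z2⟩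

lemma row_type2 {g : Matrix (Fin 6) (Fin 6) ℂ} (hg : IsCHM g) (c0 : ∀ x, g x 0 = 1)
    (r0 : ∀ y, g 0 y = 1)
    (h3 : g 3 1 = 1 ∧ g 3 2 = 1 ∧ g 3 3 = -1 ∧ g 3 4 = -1 ∧ g 3 5 = -1)
    {r : ℂ} (h1 : RowP g 1 r) (x : Fin 6)
    (hx0 : x ≠ 0) (hx1 : x ≠ 1) (hx3 : x ≠ 3) : RowP g x (-r) ∨ RowM g x (g x 3) := by
  have e := row_orth hg c0 hx1
  have h1' := h1
  obtain ⟨b1, b2, b3, b4, b5⟩ := h1'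
  have hr : ‖r‖ = 1 := by rw [← b3]; exact hg.1 _ _
  have hcr : (starRingEnd ℂ) r ≠ 0 := by simpa using ne_of hr
  have hgx : g x 3 ≠ 0 := ne_of (hg.1 x 3)
  rw [b1, b2, b3, b4, b5] at e
  simp only [map_mul, map_pow, om_conj] at e
  have hc := om_cube
  have ha := om_sq_add
  rcases row_type hg c0 r0 h3 x hx0 hx3 with ⟨⟨p1, p2⟩ | ⟨p1, p2⟩, ⟨p4, p5⟩ | ⟨p4, p5⟩⟩
  · left
    have hP : RowP g x (g x 3) := ⟨p1, p2, rfl, p4, p5⟩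
    have := rowPP hg c0 hx1 hP h1
    rwa [this] at hP
  · exfalso
    rw [p1, p2, p4, p5] at e
    have : (3 : ℂ) = 0 := by
      linear_combination e - (2 + ω ^ 3) * hc - g x 3 * (starRingEnd ℂ) r * (ω * hc + ω ^ 2 * hc + ha)
    norm_num at this
  · exfalso
    rw [p1, p2, p4, p5] at e
    have : 3 * (g x 3 * (starRingEnd ℂ) r) = 0 := by
      linear_combination e - g x 3 * (starRingEnd ℂ) r * (2 + ω ^ 3) * hc - (ω * hc + ω ^ 2 * hc + ha)
    simp [hgx] at this
    exact ne_of hr this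
  · right; exact ⟨p1, p2, rfl, p4, p5⟩

lemma finish23 {g : Matrix (Fin 6) (Fin 6) ℂ} (c0 : ∀ x, g x 0 = 1)
    (r0 : ∀ y, g 0 y = 1)
    (h3 : g 3 1 = 1 ∧ g 3 2 = 1 ∧ g 3 3 = -1 ∧ g 3 4 = -1 ∧ g 3 5 = -1)
    {r s : ℂ} (σ : Equiv.Perm (Fin 6)) (s0 : σ 0 = 0) (s1 : σ 1 = 1) (s3 : σ 3 = 3)
    (h1 : RowP g 1 r) (h4 : RowP g (σ 4) (-r)) (h2 : RowM g (σ 2) s) (h5 : RowM g (σ 5) (-s)) :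
    MatEquiv g (F23 r s) := by
  obtain ⟨q1, q2, q3, q4, q5⟩ := h3
  obtain ⟨a1, a2, a3, a4, a5⟩ := h1
  obtain ⟨b1, b2, b3, b4, b5⟩ := h4
  obtain ⟨d1, d2, d3, d4, d5⟩ := h2
  obtain ⟨f1, f2, f3, f4, f5⟩ := h5
  refine ⟨σ, 1, fun _ => 1, fun _ => 1, by simp, by simp, ?_⟩
  intro i j
  fin_cases i <;> fin_cases j <;> simp [F23, *]

lemma core23a {g : Matrix (Fin 6) (Fin 6) ℂ} (hg : IsCHM g) (c0 : ∀ x, g x 0 = 1)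
    (r0 : ∀ y, g 0 y = 1)
    (h3 : g 3 1 = 1 ∧ g 3 2 = 1 ∧ g 3 3 = -1 ∧ g 3 4 = -1 ∧ g 3 5 = -1)
    {r : ℂ} (h1 : RowP g 1 r) : ∃ r s : ℂ, ‖r‖ = 1 ∧ ‖s‖ = 1 ∧ MatEquiv g (F23 r s) := by
  have hr : ‖r‖ = 1 := by rw [← h1.2.2.1]; exact hg.1 _ _
  have nr := ne_of hr
  have hPP : ∀ x y : Fin 6, x ≠ y → RowP g x (-r) → RowP g y (-r) → False := by
    intro x y hxy hx hy
    have := rowPP hg c0 hxy hx hy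
    apply nr; linear_combination (-1/2) * this
  have k2 := row_type2 hg c0 r0 h3 h1 2 (by decide) (by decide) (by decide)
  have k4 := row_type2 hg c0 r0 h3 h1 4 (by decide) (by decide) (by decide)
  have k5 := row_type2 hg c0 r0 h3 h1 5 (by decide) (by decide) (by decide)
  have w24 : ∀ k, Equiv.swap (2 : Fin 6) 4 k = ![0, 1, 4, 3, 2, 5] k := by decide
  have w45 : ∀ k, Equiv.swap (4 : Fin 6) 5 k = ![0, 1, 2, 3, 5, 4] k := by decide
  rcases k2 with k2 | k2 <;> rcases k4 with k4 | k4 <;> rcases k5 with k5 | k5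
  · exact (hPP 2 4 (by decide) k2 k4).elim
  · exact (hPP 2 4 (by decide) k2 k4).elim
  · exact (hPP 2 5 (by decide) k2 k5).elim
  · have := rowMM hg c0 (by decide) k5 k4
    rw [this] at k5
    exact ⟨r, g 4 3, hr, hg.1 _ _, finish23 c0 r0 h3 (Equiv.swap 2 4) (by decide) (by decide)
      (by decide) h1 (by simpa [w24] using k2) (by simpa [w24] using k4) (by simpa [w24] using k5)⟩
  · exact (hPP 4 5 (by decide) k4 k5).elim
  · have := rowMM hg c0 (by decide) k5 k2
    rw [this] at k5
    exact ⟨r, g 2 3, hr, hg.1 _ _, finish23 c0 r0 h3 1 (by decide) (by decide)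
      (by decide) h1 k4 k2 k5⟩
  · have := rowMM hg c0 (by decide) k4 k2
    rw [this] at k4
    exact ⟨r, g 2 3, hr, hg.1 _ _, finish23 c0 r0 h3 (Equiv.swap 4 5) (by decide) (by decide)
      (by decide) h1 (by simpa [w45] using k5) (by simpa [w45] using k2) (by simpa [w45] using k4)⟩
  · exfalso
    have e1 := rowMM hg c0 (by decide) k2 k4
    have e2 := rowMM hg c0 (by decide) k2 k5
    have e3 := rowMM hg c0 (by decide) k4 k5
    apply ne_of (hg.1 2 3)
    linear_combination (1/2) * (e1 + e2 - e3)

lemma colperm_equiv (g : Matrix (Fin 6) (Fin 6) ℂ) (τ : Equiv.Perm (Fin 6)) :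
    MatEquiv g (fun x y => g x (τ y)) :=
  ⟨1, τ, fun _ => 1, fun _ => 1, by simp, by simp, by simp⟩

lemma core23 {g : Matrix (Fin 6) (Fin 6) ℂ} (hg : IsCHM g) (c0 : ∀ x, g x 0 = 1)
    (r0 : ∀ y, g 0 y = 1) (h31 : g 3 1 = 1) (h32 : g 3 2 = 1) :
    ∃ r s : ℂ, ‖r‖ = 1 ∧ ‖s‖ = 1 ∧ MatEquiv g (F23 r s) := by
  have e := row_orth hg c0 (x := 3) (y := 0) (by decide)
  simp only [r0, h31, h32, map_one] at e
  obtain ⟨h33, h34, h35⟩ := three_neg (hg.1 3 3) (hg.1 3 4) (hg.1 3 5) (by linear_combination e)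
  have w12 : ∀ k, Equiv.swap (1 : Fin 6) 2 k = ![0, 2, 1, 3, 4, 5] k := by decide
  have w45 : ∀ k, Equiv.swap (4 : Fin 6) 5 k = ![0, 1, 2, 3, 5, 4] k := by decide
  have main : ∀ τ : Equiv.Perm (Fin 6), τ 0 = 0 → RowP (fun x y => g x (τ y)) 1 (g 1 3) →
      (g 3 (τ 1) = 1 ∧ g 3 (τ 2) = 1 ∧ g 3 (τ 3) = -1 ∧ g 3 (τ 4) = -1 ∧ g 3 (τ 5) = -1) →
      ∃ r s : ℂ, ‖r‖ = 1 ∧ ‖s‖ = 1 ∧ MatEquiv g (F23 r s) := by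
    intro τ h0 hP hq
    have := colperm_equiv g τ
    obtain ⟨r, s, hr, hs, hE⟩ := core23a (isCHM_equiv this hg) (fun x => by simp [h0, c0])
      (fun y => by simp [r0]) hq hP
    exact ⟨r, s, hr, hs, matEquiv_trans this hE⟩
  rcases row_type hg c0 r0 ⟨h31, h32, h33, h34, h35⟩ 1 (by decide) (by decide) with
    ⟨⟨p1, p2⟩ | ⟨p1, p2⟩, ⟨p4, p5⟩ | ⟨p4, p5⟩⟩
  · exact main 1 rfl ⟨p1, p2, rfl, p4, p5⟩ ⟨h31, h32, h33, h34, h35⟩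
  · refine main (Equiv.swap 4 5) (by decide) ?_ ?_ <;> simp [RowP, *]
  · refine main (Equiv.swap 1 2) (by decide) ?_ ?_ <;> simp [RowP, *]
  · have e : ∀ k, (Equiv.swap (1 : Fin 6) 2 * Equiv.swap (4 : Fin 6) 5 : Equiv.Perm (Fin 6)) k
      = ![0, 2, 1, 3, 5, 4] k := by decide
    refine main (Equiv.swap 1 2 * Equiv.swap 4 5) (by decide) ?_ ?_ <;>
      simp only [RowP, e] <;> simp [*]

lemma perm_three (k l m : Fin 6) (h1 : k ≠ l) (h2 : k ≠ m) (h3 : l ≠ m) :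
    ∃ τ : Equiv.Perm (Fin 6), τ 0 = k ∧ τ 1 = l ∧ τ 2 = m := by
  let f : Fin 3 → Fin 6 := ![0, 1, 2]
  let g : Fin 3 → Fin 6 := ![k, l, m]
  have hf : Function.Injective f := by decide
  have hg : Function.Injective g := by
    intro a b hab
    fin_cases a <;> fin_cases b <;> simp_all [g]
  obtain ⟨τ, hτ⟩ := Equiv.Perm.exists_extending_pair f g hf hg
  exact ⟨τ, hτ 0, hτ 1, hτ 2⟩

lemma R1 {h : Matrix (Fin 6) (Fin 6) ℂ} (hh : IsCHM h) {i j : Fin 6} (hij : i ≠ j)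
    (ht : Three (qq h i j)) : ∃ r s : ℂ, ‖r‖ = 1 ∧ ‖s‖ = 1 ∧ MatEquiv h (F23 r s) := by
  obtain ⟨k, l, m, hkl, hkm, hlm, e1, e2⟩ := ht
  obtain ⟨τ, t0, t1, t2⟩ := perm_three k l m hkl hkm hlm
  have : ∃ n, n ≠ i ∧ n ≠ j := by clear e1 e2; revert i j; decide
  obtain ⟨n, hni, hnj⟩ := this
  obtain ⟨ρ, u0, u1, -⟩ := perm_three i j n hij hni.symm hnj.symm
  let σ : Equiv.Perm (Fin 6) := (Equiv.swap 1 3).trans ρ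
  have s0 : σ 0 = i := by simpa [σ, Equiv.swap_apply_def] using u0
  have s3 : σ 3 = j := by simpa [σ, Equiv.swap_apply_def] using u1
  let a : Fin 6 → ℂ := fun x => (starRingEnd ℂ) (h (σ x) (τ 0)) * h i (τ 0)
  let b : Fin 6 → ℂ := fun y => (starRingEnd ℂ) (h i (τ y))
  let g : Matrix (Fin 6) (Fin 6) ℂ := fun x y => a x * b y * h (σ x) (τ y)
  have hE : MatEquiv h g := ⟨σ, τ, a, b, fun x => by simp [a, hh.1], fun y => by simp [b, hh.1],
    fun x y => rfl⟩
  have key : ∀ x y, (starRingEnd ℂ) (h x y) * h x y = 1 := fun x y => conj_mul_of (hh.1 x y)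
  obtain ⟨r, s, hr, hs, hF⟩ := core23 (isCHM_equiv hE hh) (g := g)
    (fun x => by
      simp only [g, a, b]
      linear_combination (starRingEnd ℂ (h (σ x) (τ 0)) * h (σ x) (τ 0)) * key i (τ 0) + key (σ x) (τ 0))
    (fun y => by
      simp only [g, a, b, s0]
      linear_combination (starRingEnd ℂ (h i (τ 0)) * h i (τ 0)) * key i (τ y) + key i (τ 0))
    (by
      simp only [g, a, b, s3, t0, t1]
      simp only [qq] at e1
      have e1' := congrArg (starRingEnd ℂ) e1
      simp only [map_mul, Complex.conj_conj] at e1'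
      linear_combination (starRingEnd ℂ (h j k) * h i k) * (-e1') +
        (starRingEnd ℂ (h j k) * h j k) * key i k + key j k)
    (by
      simp only [g, a, b, s3, t0, t2]
      simp only [qq] at e2
      have e1' := congrArg (starRingEnd ℂ) e2
      simp only [map_mul, Complex.conj_conj] at e1'
      linear_combination (starRingEnd ℂ (h j k) * h i k) * (-e1') +
        (starRingEnd ℂ (h j k) * h j k) * key i k + key j k)
  exact ⟨r, s, hr, hs, matEquiv_trans hE hF⟩

lemma isCHM_transpose {h : Matrix (Fin 6) (Fin 6) ℂ} (hh : IsCHM h) :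
    IsCHM (fun x y => h y x) := by
  refine ⟨fun i j => hh.1 j i, fun k l hkl => ?_⟩
  have h1 : h * h.conjTranspose = (6 : ℂ) • (1 : Matrix (Fin 6) (Fin 6) ℂ) := by
    ext i j
    rw [Matrix.mul_apply]
    simp only [Matrix.conjTranspose_apply, Matrix.smul_apply, smul_eq_mul]
    by_cases hij : i = j
    · subst hij
      have : ∀ k, h i k * star (h i k) = 1 := fun k => by
        rw [mul_comm]; exact conj_mul_of (hh.1 i k)
      simp only [this]; simp
    · rw [Matrix.one_apply_ne hij, mul_zero]; exact hh.2 i j hij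
  have h2 : ((1/6 : ℂ) • h.conjTranspose) * h = 1 := by
    apply mul_eq_one_comm.1
    rw [Matrix.mul_smul, h1, smul_smul]; norm_num
  have h3 := congrFun (congrFun h2 l) k
  rw [Matrix.one_apply_ne (Ne.symm hkl), Matrix.smul_mul, Matrix.smul_apply, Matrix.mul_apply] at h3
  simp only [Matrix.conjTranspose_apply, smul_eq_mul] at h3
  have h4 : ∑ x, star (h x l) * h x k = 0 := by
    rcases mul_eq_zero.1 h3 with h | h
    · norm_num at h
    · exact h
  rw [← h4]
  exact Finset.sum_congr rfl fun x _ => mul_comm _ _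

lemma R2 {h : Matrix (Fin 6) (Fin 6) ℂ} (hh : IsCHM h) {k l : Fin 6} (hkl : k ≠ l)
    (ht : Three (qq (fun x y => h y x) k l)) :
    ∃ r s : ℂ, ‖r‖ = 1 ∧ ‖s‖ = 1 ∧ MatEquiv h (F32 r s) := by
  obtain ⟨r, s, hr, hs, σ, τ, a, b, ha, hb, e⟩ := R1 (isCHM_transpose hh) hkl ht
  refine ⟨r, s, hr, hs, ?_⟩
  have hE : MatEquiv h (fun x y => F23 r s y x) :=
    ⟨τ, σ, b, a, hb, ha, fun i j => by
      have := e j i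
      show F23 r s j i = _
      rw [this]; ring⟩
  refine matEquiv_trans hE ?_
  refine ⟨⟨![0, 3, 1, 4, 2, 5], ![0, 2, 4, 1, 3, 5], by decide, by decide⟩,
    ⟨![0, 3, 1, 4, 2, 5], ![0, 2, 4, 1, 3, 5], by decide, by decide⟩,
    fun _ => 1, fun _ => 1, by simp, by simp, ?_⟩
  intro i j
  fin_cases i <;> fin_cases j <;> simp [F23, F32]

set_option maxRecDepth 100000 in
lemma three_others : ∀ a c : Fin 6, ∃ x y z : Fin 6, x ≠ y ∧ x ≠ z ∧ y ≠ z ∧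
    (x ≠ a ∧ x ≠ c) ∧ (y ≠ a ∧ y ≠ c) ∧ (z ≠ a ∧ z ≠ c) := by decide

/-- two perfect matchings of the six columns without common edge -/
lemma matching_contra {f g β : Fin 6 → ℂ}
    (pf : Concl2 f β) (pg : Concl2 g β)
    (nf : ¬ Three f) (ng : ¬ Three g) (nb : ¬ Three β)
    (N : ∀ k l, k ≠ l → f k = f l → g k = g l → False) : False := by
  obtain ⟨pf1, pf2⟩ := pf
  obtain ⟨pg1, pg2⟩ := pg
  obtain ⟨l1, h1, f1⟩ := pf1 0
  obtain ⟨l2, h2, g2⟩ := pg1 0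
  obtain ⟨m, hm, gm⟩ := pg1 l1
  obtain ⟨n, hn, fn⟩ := pf1 l2
  have h12 : l1 ≠ l2 := by
    rintro rfl; exact N _ _ h1 f1 g2
  have hm0 : m ≠ 0 := by
    rintro rfl; exact N _ _ h1 f1 gm.symm
  have hm2 : m ≠ l2 := by
    rintro rfl; exact N _ _ h1 f1 (gm.symm.trans g2)
  have hn0 : n ≠ 0 := by
    rintro rfl; exact N _ _ h2 fn.symm g2
  have b1 := pf2 _ _ h1 f1
  have b2 := pg2 _ _ h2 g2
  have bm := pg2 _ _ hm gm
  have bn := pf2 _ _ hn fn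
  have em : β 0 = β m := by rw [bm, b1]; ring
  have en : β 0 = β n := by rw [bn, b2]; ring
  by_cases hmn : m = n
  · subst hmn
    have hu : ∃ u, u ∉ ({0, l1, l2, m} : Finset (Fin 6)) := by
      by_contra hc
      push Not at hc
      have h5 : ({0, l1, l2, m} : Finset (Fin 6)) = Finset.univ :=
        Finset.eq_univ_iff_forall.2 hc
      have h6 := congrArg Finset.card h5
      have h7 := Finset.card_le_four (a := (0 : Fin 6)) (b := l1) (c := l2) (d := m)
      rw [h6] at h7
      simp at h7
    obtain ⟨u, hu⟩ := hu
    simp only [Finset.mem_insert, Finset.mem_singleton, not_or] at hu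
    obtain ⟨u0, u1, u2, um⟩ := hu
    obtain ⟨v, hv, fv⟩ := pf1 u
    obtain ⟨w, hw, gw⟩ := pg1 u
    have fa : f u ≠ f 0 := fun e => nf ⟨u, 0, l1, u0, u1, h1.symm, e, e.trans f1.symm⟩
    have fb : f u ≠ f l2 := fun e => nf ⟨u, l2, m, u2, um, hn.symm, e, e.trans fn.symm⟩
    have ga : g u ≠ g 0 := fun e => ng ⟨u, 0, l2, u0, u2, h2.symm, e, e.trans g2.symm⟩
    have gb : g u ≠ g l1 := fun e => ng ⟨u, l1, m, u1, um, hm.symm, e, e.trans gm.symm⟩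
    have v0 : v ≠ 0 := by rintro rfl; exact fa fv.symm
    have v1 : v ≠ l1 := by rintro rfl; exact fa (fv.symm.trans f1)
    have v2 : v ≠ l2 := by rintro rfl; exact fb fv.symm
    have vm : v ≠ m := by rintro rfl; exact fb (fv.symm.trans fn)
    have w0 : w ≠ 0 := by rintro rfl; exact ga gw.symm
    have w2 : w ≠ l2 := by rintro rfl; exact ga (gw.symm.trans g2)
    have w1 : w ≠ l1 := by rintro rfl; exact gb gw.symm
    have wm : w ≠ m := by rintro rfl; exact gb (gw.symm.trans gm)
    by_cases hvw : v = w
    · subst hvw; exact N _ _ hv fv gw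
    · have h8 := Finset.card_le_univ ({0, l1, l2, m, u, v, w} : Finset (Fin 6))
      have h9 : ({0, l1, l2, m, u, v, w} : Finset (Fin 6)).card = 7 := by
        rw [Finset.card_insert_of_notMem, Finset.card_insert_of_notMem,
          Finset.card_insert_of_notMem, Finset.card_insert_of_notMem,
          Finset.card_insert_of_notMem, Finset.card_insert_of_notMem, Finset.card_singleton]
        all_goals simp only [Finset.mem_insert, Finset.mem_singleton, not_or]
        all_goals simp only [ne_eq] at *
        · exact hvw
        · exact ⟨fun e => hv e.symm, fun e => hw e.symm⟩
        · exact ⟨fun e => um e.symm, fun e => vm e.symm, fun e => wm e.symm⟩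
        · exact ⟨fun e => hm2 e.symm, fun e => u2 e.symm, fun e => v2 e.symm, fun e => w2 e.symm⟩
        · exact ⟨h12, fun e => hm e.symm, fun e => u1 e.symm, fun e => v1 e.symm,
            fun e => w1 e.symm⟩
        · exact ⟨fun e => h1 e.symm, fun e => h2 e.symm, fun e => hm0 e.symm, fun e => u0 e.symm,
            fun e => v0 e.symm, fun e => w0 e.symm⟩
      rw [h9] at h8
      simp at h8
  · exact nb ⟨0, m, n, hm0.symm, hn0.symm, hmn, em, en⟩

/-- if a zero-sum function only depends on the sign of `b ^ 3`, its two values are opposite -/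
lemma two_values {b v : Fin 6 → ℂ} {κ : ℂ} (hκ : κ ≠ 0)
    (hb : ∀ k, b k ^ 3 = κ ∨ b k ^ 3 = -κ)
    (hs : b 0 ^ 3 + b 1 ^ 3 + b 2 ^ 3 + b 3 ^ 3 + b 4 ^ 3 + b 5 ^ 3 = 0)
    (hv : ∀ k l, b k ^ 3 = b l ^ 3 → v k = v l)
    (hvs : v 0 + v 1 + v 2 + v 3 + v 4 + v 5 = 0)
    {p q : Fin 6} (hp : b p ^ 3 = κ) (hq : b q ^ 3 = -κ) : v p = - v q := by
  have key : ∀ k, 2 * κ * v k = κ * (v p + v q) + b k ^ 3 * (v p - v q) := by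
    intro k
    rcases hb k with h | h
    · rw [hv k p (h.trans hp.symm), h]; ring
    · rw [hv k q (h.trans hq.symm), h]; ring
  have : 6 * κ * (v p + v q) = 0 := by
    linear_combination 2 * κ * hvs - (v p - v q) * hs - key 0 - key 1 - key 2 - key 3 - key 4 - key 5
  have h2 : v p + v q = 0 := by simpa [hκ] using this
  linear_combination h2

section
variable {h : Matrix (Fin 6) (Fin 6) ℂ}

lemma qq_uni (hh : IsCHM h) (i j : Fin 6) : Uni (qq h i j) := by
  intro k; simp [qq, hh.1]

lemma qq_conj (i j : Fin 6) : qq h j i = fun k => (starRingEnd ℂ) (qq h i j k) := by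
  funext k; simp [qq, mul_comm]

lemma qq_mul (hh : IsCHM h) (i j k : Fin 6) (l : Fin 6) :
    qq h k i l = qq h j i l * qq h k j l := by
  simp only [qq]
  linear_combination (-h k l * (starRingEnd ℂ) (h i l)) * conj_mul_of (hh.1 j l)

lemma ter_symm (hh : IsCHM h) {i j : Fin 6} (ht : Ter (qq h i j)) : Ter (qq h j i) := by
  rw [qq_conj]; exact ter_conj (qq_uni hh i j) ht

lemma ter_trans (hh : IsCHM h)
    (hall : ∀ i j : Fin 6, i ≠ j → Bin (qq h i j) ∨ Ter (qq h i j))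
    (n1 : ∀ i j : Fin 6, i ≠ j → ¬ Three (qq h i j))
    {i j k : Fin 6} (hij : j ≠ i) (h1 : Ter (qq h k i)) (h2 : Ter (qq h k j)) :
    Ter (qq h j i) := by
  rcases hall j i hij with hB | hT
  · rcases btt (qq_uni hh j i) (qq_uni hh k j) (qq_uni hh k i) (qq_mul hh i j k) hB h1 h2 with h3 | h3
    · exact absurd h3 (n1 j i hij)
    · exact h3.1
  · exact hT

lemma all_ter_contra (hh : IsCHM h)
    (n1 : ∀ i j : Fin 6, i ≠ j → ¬ Three (qq h i j))
    (hT : ∀ i j : Fin 6, i ≠ j → Ter (qq h i j))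
    {i j : Fin 6} (hij : i ≠ j) (hB : Bin (qq h i j)) : False := by
  obtain ⟨x, y, z, hxy, hxz, hyz, ⟨xi, xj⟩, ⟨yi, yj⟩, ⟨zi, zj⟩⟩ := three_others i j
  have C : ∀ k, k ≠ i → k ≠ j → (∃ κ : ℂ, ∀ l, qq h i j l ^ 3 = κ ∨ qq h i j l ^ 3 = -κ) ∧
      ∀ l m, qq h i j l ^ 3 = qq h i j m ^ 3 → qq h k j l * qq h i j l = qq h k j m * qq h i j m := by
    intro k ki kj
    rcases btt (qq_uni hh i j) (qq_uni hh k i) (qq_uni hh k j) (qq_mul hh j i k) hB (hT _ _ kj)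
      (hT _ _ ki) with h3 | h3
    · exact absurd h3 (n1 i j hij)
    · exact h3.2
  obtain ⟨⟨κ, hκ⟩, -⟩ := C x xi xj
  have hs := bin_pow hB 3 (by decide)
  have hn0 : ∀ l, qq h i j l ≠ 0 := fun l => ne_of (qq_uni hh i j l)
  have hκ0 : κ ≠ 0 := by
    rintro rfl
    have := hκ 0
    simp at this
    exact hn0 0 this
  have hp : ∃ p, qq h i j p ^ 3 = κ := by
    by_contra hc
    push Not at hc
    have e : ∀ l, qq h i j l ^ 3 = -κ := fun l => (hκ l).resolve_left (hc l)
    simp only [e] at hs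
    apply hκ0; linear_combination (-1/6) * hs
  have hq : ∃ p, qq h i j p ^ 3 = -κ := by
    by_contra hc
    push Not at hc
    have e : ∀ l, qq h i j l ^ 3 = κ := fun l => (hκ l).resolve_right (hc l)
    simp only [e] at hs
    apply hκ0; linear_combination (1/6) * hs
  obtain ⟨p, hp⟩ := hp
  obtain ⟨q, hq⟩ := hq
  have V : ∀ x y, x ≠ y → x ≠ i → x ≠ j → y ≠ i → y ≠ j → qq h x y p = - qq h x y q := by
    intro x y hxy xi xj yi yj
    refine two_values hκ0 hκ hs ?_ ?_ hp hq
    · intro k l hkl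
      have e1 := (C x xi xj).2 k l hkl
      have e2 := (C y yi yj).2 k l hkl
      have F : ∀ k, qq h x y k = (qq h x j k * qq h i j k) * (starRingEnd ℂ) (qq h y j k * qq h i j k) := by
        intro k
        simp only [qq, map_mul, Complex.conj_conj]
        have a1 := conj_mul_of (hh.1 j k)
        have a2 := conj_mul_of (hh.1 i k)
        linear_combination (-h x k * (starRingEnd ℂ) (h y k)) *
          (a2 + ((starRingEnd ℂ) (h i k) * h i k) * a1 +
          ((starRingEnd ℂ) (h i k) * h i k) * ((starRingEnd ℂ) (h j k) * h j k) * a1)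
      rw [F, F, e1, e2]
    · have := hh.2 x y hxy
      simpa [Fin.sum_univ_six, qq] using this
  have v1 := V x y hxy xi xj yi yj
  have v2 := V y z hyz yi yj zi zj
  have v3 := V x z hxz xi xj zi zj
  rw [qq_mul hh z y x, qq_mul hh z y x, v1, v2] at v3
  have w1 := ne_of (qq_uni hh x y q)
  have w2 := ne_of (qq_uni hh y z q)
  have : qq h y z q * qq h x y q = 0 := by linear_combination (1/2) * v3
  rcases mul_eq_zero.1 this with h | h
  · exact w2 h
  · exact w1 h

lemma cols_of_rows (hh : IsCHM h) (a b k l : Fin 6) (ε : ℂ)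
    (e : qq h b a k = ε * qq h b a l) :
    h b k * (starRingEnd ℂ) (h b l) = ε * (h a k * (starRingEnd ℂ) (h a l)) := by
  simp only [qq] at e
  have a1 := conj_mul_of (hh.1 a k)
  have a2 := conj_mul_of (hh.1 b l)
  linear_combination (h a k * (starRingEnd ℂ) (h b l)) * e
    - (h b k * (starRingEnd ℂ) (h b l)) * a1 + (ε * h a k * (starRingEnd ℂ) (h a l)) * a2

lemma combine (hh : IsCHM h)
    (hall : ∀ i j : Fin 6, i ≠ j → Bin (qq h i j) ∨ Ter (qq h i j))
    (hb : ∃ i j : Fin 6, i ≠ j ∧ Bin (qq h i j)) (ht : ∃ i j : Fin 6, i ≠ j ∧ Ter (qq h i j))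
    (n1 : ∀ i j : Fin 6, i ≠ j → ¬ Three (qq h i j))
    (n2 : ∀ k l : Fin 6, k ≠ l → ¬ Three (qq (fun x y => h y x) k l)) : False := by
  obtain ⟨c, a, hca, hTca⟩ := ht
  by_cases hA : ∀ b, b ≠ a → Ter (qq h b a)
  · obtain ⟨i, j, hij, hB⟩ := hb
    refine all_ter_contra hh n1 (fun x y hxy => ?_) hij hB
    by_cases hxa : x = a
    · subst hxa; exact ter_symm hh (hA y hxy.symm)
    · by_cases hya : y = a
      · subst hya; exact hA x hxy
      · exact ter_trans hh hall n1 hxy (ter_symm hh (hA y hya)) (ter_symm hh (hA x hxa))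
  · push Not at hA
    have L : ∀ d b, d ≠ a → Ter (qq h d a) → b ≠ a → ¬ Ter (qq h b a) →
        Concl2 (qq h d a) (qq h b a) := by
      intro d b hda hTd hba hnb
      have hbd : b ≠ d := by rintro rfl; exact hnb hTd
      have hBd : Bin (qq h b d) := by
        rcases hall b d hbd with h | h
        · exact h
        · exact absurd (ter_trans hh hall n1 hba hTd (ter_symm hh h)) hnb
      refine bbt (qq_uni hh d a) (qq_uni hh b a) hTd ((hall b a hba).resolve_right hnb) ?_ hnb
      convert hBd using 1
      funext k
      simp only [qq, map_mul, Complex.conj_conj]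
      linear_combination (h b k * (starRingEnd ℂ) (h d k)) * conj_mul_of (hh.1 a k)
    by_cases hD : ∃ d, d ≠ a ∧ d ≠ c ∧ Ter (qq h d a)
    · obtain ⟨d, hda, hdc, hTd⟩ := hD
      obtain ⟨b, hba, hnb⟩ := hA
      refine matching_contra (L c b hca hTca hba hnb) (L d b hda hTd hba hnb)
        (n1 _ _ hca) (n1 _ _ hda) (n1 _ _ hba) ?_
      intro k l hkl e1 e2
      refine n2 k l hkl ⟨a, c, d, hca.symm, hda.symm, hdc.symm, ?_, ?_⟩
      · have := cols_of_rows hh a c k l 1 (by rw [e1, one_mul])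
        simpa [qq] using this.symm
      · have := cols_of_rows hh a d k l 1 (by rw [e2, one_mul])
        simpa [qq] using this.symm
    · push Not at hD
      obtain ⟨x, y, z, hxy, hxz, hyz, ⟨xa, xc⟩, ⟨ya, yc⟩, ⟨za, zc⟩⟩ := three_others a c
      have Lx := L c x hca hTca xa (hD x xa xc)
      have Ly := L c y hca hTca ya (hD y ya yc)
      have Lz := L c z hca hTca za (hD z za zc)
      obtain ⟨l, hl, fl⟩ := Lx.1 0
      have ex := cols_of_rows hh a x l 0 (-1) (by rw [Lx.2 l 0 hl fl]; ring)
      have ey := cols_of_rows hh a y l 0 (-1) (by rw [Ly.2 l 0 hl fl]; ring)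
      have ez := cols_of_rows hh a z l 0 (-1) (by rw [Lz.2 l 0 hl fl]; ring)
      refine n2 l 0 hl ⟨x, y, z, hxy, hxz, hyz, ?_, ?_⟩
      · exact ex.trans ey.symm
      · exact ex.trans ez.symm

end

lemma forward (h : Matrix (Fin 6) (Fin 6) ℂ) (hh : IsCHM h)
    (hall : ∀ i₁ i₂ : Fin 6, i₁ ≠ i₂ → BinaryPair h i₁ i₂ ∨ TernaryPair h i₁ i₂)
    (hb : ∃ i₁ i₂ : Fin 6, i₁ ≠ i₂ ∧ BinaryPair h i₁ i₂)
    (ht : ∃ i₁ i₂ : Fin 6, i₁ ≠ i₂ ∧ TernaryPair h i₁ i₂) :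
    ∃ r s : ℂ, ‖r‖ = 1 ∧ ‖s‖ = 1 ∧ (MatEquiv h (F23 r s) ∨ MatEquiv h (F32 r s)) := by
  by_contra hc
  refine combine hh (fun i j hij => (hall i j hij).imp (bin_of h i j) (ter_of h i j)) ?_ ?_ ?_ ?_
  · obtain ⟨i, j, hij, hB⟩ := hb
    exact ⟨i, j, hij, bin_of h i j hB⟩
  · obtain ⟨i, j, hij, hB⟩ := ht
    exact ⟨i, j, hij, ter_of h i j hB⟩
  · intro i j hij h3
    obtain ⟨r, s, hr, hs, hE⟩ := R1 hh hij h3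
    exact hc ⟨r, s, hr, hs, Or.inl hE⟩
  · intro i j hij h3
    obtain ⟨r, s, hr, hs, hE⟩ := R2 hh hij h3
    exact hc ⟨r, s, hr, hs, Or.inr hE⟩

lemma rowProd_perm (h : Matrix (Fin 6) (Fin 6) ℂ) (i j : Fin 6) (e : Equiv.Perm (Fin 6)) :
    rowProd h i j = Multiset.map (fun k => qq h i j (e k)) Finset.univ.val := by
  have : (Finset.univ : Finset (Fin 6)).val = Multiset.map e Finset.univ.val := by
    have h2 := Finset.map_univ_equiv e
    have h3 := congrArg Finset.val h2
    simp
  unfold rowProd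
  conv_lhs => rw [this]
  rw [Multiset.map_map]
  rfl

lemma binary_mk (h : Matrix (Fin 6) (Fin 6) ℂ) (hu : ∀ i j, ‖h i j‖ = 1) (i j : Fin 6)
    (e : Equiv.Perm (Fin 6)) (h1 : qq h i j (e 1) = -qq h i j (e 0))
    (h2 : qq h i j (e 3) = -qq h i j (e 2)) (h3 : qq h i j (e 5) = -qq h i j (e 4)) :
    BinaryPair h i j := by
  refine ⟨qq h i j (e 0), qq h i j (e 2), qq h i j (e 4), by simp [qq, hu], by simp [qq, hu],
    by simp [qq, hu], ?_⟩
  rw [rowProd_perm h i j e, ← h1, ← h2, ← h3]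
  rfl

lemma ternary_mk (h : Matrix (Fin 6) (Fin 6) ℂ) (hu : ∀ i j, ‖h i j‖ = 1) (i j : Fin 6)
    (e : Equiv.Perm (Fin 6)) (h1 : qq h i j (e 1) = ω * qq h i j (e 0))
    (h2 : qq h i j (e 2) = ω ^ 2 * qq h i j (e 0)) (h3 : qq h i j (e 4) = ω * qq h i j (e 3))
    (h4 : qq h i j (e 5) = ω ^ 2 * qq h i j (e 3)) :
    TernaryPair h i j := by
  refine ⟨qq h i j (e 0), qq h i j (e 3), by simp [qq, hu], by simp [qq, hu], ?_⟩
  rw [rowProd_perm h i j e, ← h1, ← h2, ← h3, ← h4]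
  rfl

lemma sum_of_pair (h : Matrix (Fin 6) (Fin 6) ℂ) (i j : Fin 6)
    (hp : BinaryPair h i j ∨ TernaryPair h i j) :
    ∑ k, h i k * (starRingEnd ℂ) (h j k) = 0 := by
  have e : ∑ k, h i k * (starRingEnd ℂ) (h j k) = (rowProd h i j).sum := rfl
  rw [e]
  rcases hp with ⟨x, y, z, -, -, -, hh⟩ | ⟨x, y, -, -, hh⟩
  · rw [hh]; simp
  · rw [hh]; simp
    linear_combination (x + y) * om_sq_add

lemma F23_uni {r s : ℂ} (hr : ‖r‖ = 1) (hs : ‖s‖ = 1) (i j : Fin 6) : ‖F23 r s i j‖ = 1 := by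
  fin_cases i <;> fin_cases j <;> simp [F23, hr, hs, om_norm]

lemma F32_uni {r s : ℂ} (hr : ‖r‖ = 1) (hs : ‖s‖ = 1) (i j : Fin 6) : ‖F32 r s i j‖ = 1 := by
  fin_cases i <;> fin_cases j <;> simp [F32, hr, hs, om_norm]

/-- columns paired at distance three -/
def pA : Equiv.Perm (Fin 6) := ⟨![0, 3, 1, 4, 2, 5], ![0, 2, 4, 1, 3, 5], by decide, by decide⟩
/-- both triples reversed -/
def pB : Equiv.Perm (Fin 6) := ⟨![0, 2, 1, 3, 5, 4], ![0, 2, 1, 3, 5, 4], by decide, by decide⟩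
/-- even columns, then odd columns -/
def pC : Equiv.Perm (Fin 6) := ⟨![0, 2, 4, 1, 3, 5], ![0, 3, 1, 4, 2, 5], by decide, by decide⟩
/-- even columns, then odd columns, reversed -/
def pD : Equiv.Perm (Fin 6) := ⟨![0, 4, 2, 1, 5, 3], ![0, 3, 2, 5, 1, 4], by decide, by decide⟩

def t23 (i j : Fin 6) : Fin 3 := ![![0, 2, 1, 0, 2, 1], ![1, 0, 2, 1, 0, 2], ![2, 1, 0, 2, 1, 0],
  ![0, 2, 1, 0, 2, 1], ![1, 0, 2, 1, 0, 2], ![2, 1, 0, 2, 1, 0]] i j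

lemma F23_bin {r s : ℂ} (hr : ‖r‖ = 1) (hs : ‖s‖ = 1) (i j : Fin 6) (hij : i ≠ j)
    (ht : t23 i j = 0) : BinaryPair (F23 r s) i j := by
  have r1 := conj_mul_of hr
  have s1 := conj_mul_of hs
  have hc := om_cube
  apply binary_mk _ (F23_uni hr hs) i j pA
  all_goals
    fin_cases i <;> fin_cases j <;>
    first
    | exact absurd rfl hij
    | exact absurd ht (by decide)
    | simp [pA, qq, F23, om_conj]
  all_goals grind

lemma F23_ter {r s : ℂ} (hr : ‖r‖ = 1) (hs : ‖s‖ = 1) (i j : Fin 6)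
    (ht : t23 i j ≠ 0) : TernaryPair (F23 r s) i j := by
  have hc := om_cube
  by_cases h1 : t23 i j = 1
  · apply ternary_mk _ (F23_uni hr hs) i j 1
    all_goals
      fin_cases i <;> fin_cases j <;>
      first
      | exact absurd h1 (by decide)
      | simp [qq, F23, om_conj]
    all_goals grind
  · apply ternary_mk _ (F23_uni hr hs) i j pB
    all_goals
      fin_cases i <;> fin_cases j <;>
      first
      | exact absurd rfl ht
      | exact absurd rfl h1
      | simp [pB, qq, F23, om_conj]
    all_goals grind

def t32 (i j : Fin 6) : Fin 3 := ![![0, 0, 2, 0, 1, 0], ![0, 0, 0, 2, 0, 1], ![1, 0, 0, 0, 2, 0],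
  ![0, 1, 0, 0, 0, 2], ![2, 0, 1, 0, 0, 0], ![0, 2, 0, 1, 0, 0]] i j

lemma F32_bin {r s : ℂ} (hr : ‖r‖ = 1) (hs : ‖s‖ = 1) (i j : Fin 6) (hij : i ≠ j)
    (ht : t32 i j = 0) : BinaryPair (F32 r s) i j := by
  apply binary_mk _ (F32_uni hr hs) i j 1
  all_goals
    fin_cases i <;> fin_cases j <;>
    first
    | exact absurd rfl hij
    | exact absurd ht (by decide)
    | simp [qq, F32, om_conj]

lemma F32_ter {r s : ℂ} (hr : ‖r‖ = 1) (hs : ‖s‖ = 1) (i j : Fin 6)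
    (ht : t32 i j ≠ 0) : TernaryPair (F32 r s) i j := by
  have hc := om_cube
  have r1 := conj_mul_of hr
  have s1 := conj_mul_of hs
  by_cases h1 : t32 i j = 1
  · apply ternary_mk _ (F32_uni hr hs) i j pC
    all_goals
      fin_cases i <;> fin_cases j <;>
      first
      | exact absurd h1 (by decide)
      | simp [pC, qq, F32, om_conj]
    all_goals grind
  · apply ternary_mk _ (F32_uni hr hs) i j pD
    all_goals
      fin_cases i <;> fin_cases j <;>
      first
      | exact absurd rfl ht
      | exact absurd rfl h1
      | simp [pD, qq, F32, om_conj]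
    all_goals grind

lemma F23_all {r s : ℂ} (hr : ‖r‖ = 1) (hs : ‖s‖ = 1) (i j : Fin 6) (hij : i ≠ j) :
    BinaryPair (F23 r s) i j ∨ TernaryPair (F23 r s) i j := by
  by_cases h : t23 i j = 0
  · exact Or.inl (F23_bin hr hs i j hij h)
  · exact Or.inr (F23_ter hr hs i j h)

lemma F32_all {r s : ℂ} (hr : ‖r‖ = 1) (hs : ‖s‖ = 1) (i j : Fin 6) (hij : i ≠ j) :
    BinaryPair (F32 r s) i j ∨ TernaryPair (F32 r s) i j := by
  by_cases h : t32 i j = 0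
  · exact Or.inl (F32_bin hr hs i j hij h)
  · exact Or.inr (F32_ter hr hs i j h)

/-- A mixed 6×6 complex Hadamard matrix (all pairs of distinct rows binary
or ternary, with both kinds occurring) is equivalent to some `F₂₃^{rs}` or `F₃₂^{rs}`
with unimodular `r, s`; conversely every `F₂₃^{rs}` and `F₃₂^{rs}` is a complex Hadamard
matrix all of whose pairs of distinct rows are binary or ternary, both kinds occurring. -/
theorem stmt_18 :
    (∀ h : Matrix (Fin 6) (Fin 6) ℂ, IsCHM h →
      (∀ i₁ i₂ : Fin 6, i₁ ≠ i₂ → BinaryPair h i₁ i₂ ∨ TernaryPair h i₁ i₂) →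
      (∃ i₁ i₂ : Fin 6, i₁ ≠ i₂ ∧ BinaryPair h i₁ i₂) →
      (∃ i₁ i₂ : Fin 6, i₁ ≠ i₂ ∧ TernaryPair h i₁ i₂) →
      ∃ r s : ℂ, ‖r‖ = 1 ∧ ‖s‖ = 1 ∧
        (MatEquiv h (F23 r s) ∨ MatEquiv h (F32 r s))) ∧
    (∀ r s : ℂ, ‖r‖ = 1 → ‖s‖ = 1 →
      (IsCHM (F23 r s) ∧
        (∀ i₁ i₂ : Fin 6, i₁ ≠ i₂ →
          BinaryPair (F23 r s) i₁ i₂ ∨ TernaryPair (F23 r s) i₁ i₂) ∧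
        (∃ i₁ i₂ : Fin 6, i₁ ≠ i₂ ∧ BinaryPair (F23 r s) i₁ i₂) ∧
        (∃ i₁ i₂ : Fin 6, i₁ ≠ i₂ ∧ TernaryPair (F23 r s) i₁ i₂)) ∧
      (IsCHM (F32 r s) ∧
        (∀ i₁ i₂ : Fin 6, i₁ ≠ i₂ →
          BinaryPair (F32 r s) i₁ i₂ ∨ TernaryPair (F32 r s) i₁ i₂) ∧
        (∃ i₁ i₂ : Fin 6, i₁ ≠ i₂ ∧ BinaryPair (F32 r s) i₁ i₂) ∧
        (∃ i₁ i₂ : Fin 6, i₁ ≠ i₂ ∧ TernaryPair (F32 r s) i₁ i₂))) := by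
  refine ⟨forward, fun r s hr hs => ⟨⟨⟨F23_uni hr hs, fun i j hij => ?_⟩, F23_all hr hs, ?_, ?_⟩,
    ⟨⟨F32_uni hr hs, fun i j hij => ?_⟩, F32_all hr hs, ?_, ?_⟩⟩⟩
  · exact sum_of_pair _ i j (F23_all hr hs i j hij)
  · exact ⟨0, 3, by decide, F23_bin hr hs 0 3 (by decide) (by decide)⟩
  · exact ⟨0, 1, by decide, F23_ter hr hs 0 1 (by decide)⟩
  · exact sum_of_pair _ i j (F32_all hr hs i j hij)
  · exact ⟨0, 1, by decide, F32_bin hr hs 0 1 (by decide) (by decide)⟩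
  · exact ⟨0, 2, by decide, F32_ter hr hs 0 2 (by decide)⟩
end
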